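/- Let m, n ≥ 1 be mutually prime integers with n < 2m, and let α > 0. Let h₀ : ℝ → ℝ be a smooth function with period 2mπ/n (hence 2mπ-periodic) satisfying h₀ + h₀'' > 0 everywhere, and suppose h₀ has property (P): both h₀ and the curvature κ₀ = (h₀ + h₀'')^{−1} are symmetric with respect to θ = 0 and θ = mπ/n (i.e. h₀(−θ) = h₀(θ) and h₀(mπ/n + θ) = h₀(mπ/n − θ), and similarly for κ₀), both are strictly decreasing on (0, mπ/n), and h₀(mπ/n) > 0 (so the initial curve is of Abresch–Langer type, in the class A_{m,n}). Then the area-preserving (AP) support-function flow with initial data h₀ admits a smooth solution h on ℝ × [0,∞), 2mπ-periodic in θ with h + h_θθ > 0 for all time, and there exists a constant c > 0 such that the curvature κ = (h + h_θθ)^{−1} converges, together with all its θ-derivatives, uniformly to c as t → ∞; that is, the flow exists globally and converges in the C^∞ metric to an m-fold circle. -/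

import Mathlib

open Real MeasureTheory Filter

/-- Second derivative of the support function in the angle variable. -/
noncomputable def hpp (h : ℝ → ℝ → ℝ) (θ t : ℝ) : ℝ :=
  iteratedDeriv 2 (fun x => h x t) θ

/-- Nonlocal term of the area-preserving flow. -/
noncomputable def lamAP (m : ℕ) (α : ℝ) (h : ℝ → ℝ → ℝ) (t : ℝ) : ℝ :=
  (∫ θ in (0:ℝ)..(2 * m * π), (h θ t + hpp h θ t) ^ (1 - α)) /
    (∫ θ in (0:ℝ)..(2 * m * π), h θ t)

/-- Curvature of the initial curve determined by its support function. -/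
noncomputable def curv₀ (h₀ : ℝ → ℝ) (θ : ℝ) : ℝ :=
  (h₀ θ + iteratedDeriv 2 h₀ θ)⁻¹

namespace APF

/-- Formal expressions in the time derivatives of the speed and of the nonlocal term. -/
inductive Ex : Type
  | c (r : ℝ) : Ex
  | pw (s : ℝ) : Ex
  | z (j : ℕ) : Ex
  | l (j : ℕ) : Ex
  | p (j : ℕ) : Ex
  | h : Ex
  | q : Ex
  | add (a b : Ex) : Ex
  | mul (a b : Ex) : Ex

/-- Values of the atoms. -/
structure Env where
  z : ℕ → ℝ
  l : ℕ → ℝ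
  p : ℕ → ℝ
  h : ℝ
  q : ℝ

noncomputable def ev (v : Env) : Ex → ℝ
  | .c r => r
  | .pw s => v.z 0 ^ s
  | .z j => v.z j
  | .l j => v.l j
  | .p j => v.p j
  | .h => v.h
  | .q => v.q
  | .add a b => ev v a + ev v b
  | .mul a b => ev v a * ev v b

/-- Formal time derivative. -/
noncomputable def dt : Ex → Ex
  | .c _ => .c 0
  | .pw s => .mul (.mul (.c s) (.pw (s - 1))) (.z 1)
  | .z j => .z (j + 1)
  | .l j => .l (j + 1)
  | .p j => .p (j + 1)
  | .h => .add (.l 0) (.mul (.c (-1)) (.z 0))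
  | .q => .mul (.c (-1)) (.p 0)
  | .add a b => .add (dt a) (dt b)
  | .mul a b => .add (.mul (dt a) b) (.mul a (dt b))

/-- The curvature radius. -/
noncomputable def rhoE (α : ℝ) : Ex := .pw (-(1/α))
noncomputable def gE (α : ℝ) : Ex := .mul (.c (-1)) (rhoE α)
noncomputable def g1 (α : ℝ) : Ex := .mul (.c (1/α)) (.pw (-(1/α) - 1))
noncomputable def EE (α : ℝ) : ℕ → Ex
  | 0 => .c 0
  | j + 1 => .add (.mul (dt (g1 α)) (.z (j + 1))) (dt (EE α j))
noncomputable def RE (α : ℝ) : ℕ → Ex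
  | 0 => gE α
  | j + 1 => .add (.mul (g1 α) (.z (j + 1))) (EE α j)
noncomputable def GG (α : ℝ) : ℕ → Ex
  | 0 => .mul (rhoE α) (.z 0)
  | j + 1 => .add (.mul (dt (gE α)) (.l j)) (dt (GG α j))
noncomputable def TE (α : ℝ) (j : ℕ) : Ex := .add (.mul (gE α) (.l j)) (GG α j)

lemma ev_dt_RE (α : ℝ) (v : Env) (j : ℕ) : ev v (dt (RE α j)) = ev v (RE α (j + 1)) := by
  cases j with
  | zero => simp only [RE, gE, rhoE, g1, EE, dt, ev]; ring
  | succ j => simp only [RE, EE, dt, ev]; ring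

lemma ev_dt_TE (α : ℝ) (v : Env) (j : ℕ) : ev v (dt (TE α j)) = ev v (TE α (j + 1)) := by
  simp only [TE, GG, dt, ev]; ring

/-- Formal space derivative. -/
noncomputable def dx (α : ℝ) : Ex → Ex
  | .c _ => .c 0
  | .pw s => .mul (.mul (.c s) (.pw (s - 1))) (.p 0)
  | .z j => .p j
  | .l _ => .c 0
  | .p j => .add (RE α (j + 1)) (.add (.mul (.c (-1)) (.z j)) (.l j))
  | .h => .q
  | .q => .add (rhoE α) (.mul (.c (-1)) .h)
  | .add a b => .add (dx α a) (dx α b)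
  | .mul a b => .add (.mul (dx α a) b) (.mul a (dx α b))

def low : Ex → ℕ → Prop
  | .c _, _ => True
  | .pw _, _ => True
  | .z j, k => j ≤ k
  | .l j, k => j + 1 ≤ k
  | .p _, _ => False
  | .h, _ => False
  | .q, _ => False
  | .add a b, k => low a k ∧ low b k
  | .mul a b, k => low a k ∧ low b k

lemma low_mono {e : Ex} {k k' : ℕ} (hk : k ≤ k') (h : low e k) : low e k' := by
  induction e with
  | c => trivial
  | pw => trivial
  | z j => simp only [low] at *; omega
  | l j => simp only [low] at *; omega
  | p => exact h
  | h => exact h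
  | q => exact h
  | add a b iha ihb => exact ⟨iha h.1, ihb h.2⟩
  | mul a b iha ihb => exact ⟨iha h.1, ihb h.2⟩

lemma low_dt {e : Ex} {k : ℕ} (h : low e k) : low (dt e) (k + 1) := by
  induction e with
  | c => trivial
  | pw => simp [low, dt]
  | z j => simp only [low, dt] at *; omega
  | l j => simp only [low, dt] at *; omega
  | p => exact h.elim
  | h => exact h.elim
  | q => exact h.elim
  | add a b iha ihb => exact ⟨iha h.1, ihb h.2⟩
  | mul a b iha ihb =>
    exact ⟨⟨iha h.1, low_mono (Nat.le_succ _) h.2⟩, ⟨low_mono (Nat.le_succ _) h.1, ihb h.2⟩⟩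

lemma low_EE (α : ℝ) (j : ℕ) : low (EE α j) j := by
  induction j with
  | zero => trivial
  | succ j ih =>
    refine ⟨⟨?_, ?_⟩, low_dt ih⟩
    · exact low_mono (by omega) (low_dt (e := g1 α) (k := 0) ⟨trivial, trivial⟩)
    · simp [low]

lemma low_GG (α : ℝ) (j : ℕ) : low (GG α j) j := by
  induction j with
  | zero => simp [GG, low, rhoE]
  | succ j ih =>
    refine ⟨⟨?_, ?_⟩, low_dt ih⟩
    · exact low_mono (by omega) (low_dt (e := gE α) (k := 0) ⟨trivial, trivial⟩)
    · simp [low]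

lemma low_RE (α : ℝ) (j : ℕ) : low (RE α j) j := by
  cases j with
  | zero => exact ⟨trivial, trivial⟩
  | succ j =>
    exact ⟨⟨⟨trivial, trivial⟩, by simp [low]⟩, low_mono (Nat.le_succ _) (low_EE α j)⟩

lemma rpow_bd {c C : ℝ} (hc : 0 < c) (s : ℝ) :
    ∃ K : ℝ, 0 ≤ K ∧ ∀ x, c ≤ x → x ≤ C → |x ^ s| ≤ K := by
  have hcont : ContinuousOn (fun x : ℝ => x ^ s) (Set.Icc c C) := by
    intro x hx
    exact (Real.continuousAt_rpow_const x s (Or.inl (by linarith [hx.1]))).continuousWithinAt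
  obtain ⟨K, hK⟩ := isCompact_Icc.exists_bound_of_continuousOn hcont
  refine ⟨max K 0, le_max_right _ _, fun x h1 h2 => ?_⟩
  exact le_trans (by simpa using hK x ⟨h1, h2⟩) (le_max_left _ _)

lemma rpow_lip {c C : ℝ} (hc : 0 < c) (s : ℝ) :
    ∃ K : ℝ, 0 ≤ K ∧ ∀ x y, c ≤ x → x ≤ C → c ≤ y → y ≤ C → |x ^ s - y ^ s| ≤ K * |x - y| := by
  obtain ⟨K, hK0, hK⟩ := rpow_bd (C := C) hc (s - 1)
  refine ⟨|s| * K, by positivity, fun x y hx1 hx2 hy1 hy2 => ?_⟩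
  have := (convex_Icc c C).norm_image_sub_le_of_norm_hasDerivWithin_le (f := fun x : ℝ => x ^ s)
    (f' := fun x => s * x ^ (s - 1)) (C := |s| * K) (x := y) (y := x)
    (fun u hu => (Real.hasDerivAt_rpow_const (Or.inl (by linarith [hu.1]))).hasDerivWithinAt)
    (fun u hu => by
      rw [norm_mul]
      exact mul_le_mul_of_nonneg_left (hK u hu.1 hu.2) (abs_nonneg _)) ⟨hy1, hy2⟩ ⟨hx1, hx2⟩
  simpa using this

def LB (c C M : ℝ) (k : ℕ) (v : Env) : Prop :=
  c ≤ v.z 0 ∧ v.z 0 ≤ C ∧ (∀ j, j ≤ k → |v.z j| ≤ M) ∧ (∀ j, j + 1 ≤ k → |v.l j| ≤ M)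

def VV (k : ℕ) (v : Env) : ℝ :=
  ∑ j ∈ Finset.range (k + 1), |v.z (j + 1)| + ∑ j ∈ Finset.range k, |v.l (j + 1)|

lemma VV_nonneg (k : ℕ) (v : Env) : 0 ≤ VV k v := by unfold VV; positivity

lemma z_le_VV {k j : ℕ} (h : j ≤ k) (v : Env) : |v.z (j + 1)| ≤ VV k v := by
  unfold VV
  have := Finset.single_le_sum (f := fun j => |v.z (j + 1)|) (s := Finset.range (k + 1))
    (fun i _ => abs_nonneg _) (Finset.mem_range.2 (by omega : j < k + 1))
  have h2 : 0 ≤ ∑ j ∈ Finset.range k, |v.l (j + 1)| := by positivity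
  linarith

lemma l_le_VV {k j : ℕ} (h : j < k) (v : Env) : |v.l (j + 1)| ≤ VV k v := by
  unfold VV
  have := Finset.single_le_sum (f := fun j => |v.l (j + 1)|) (s := Finset.range k)
    (fun i _ => abs_nonneg _) (Finset.mem_range.2 h)
  have h2 : 0 ≤ ∑ j ∈ Finset.range (k + 1), |v.z (j + 1)| := by positivity
  linarith

lemma ev_bd {c C : ℝ} (hc : 0 < c) (M : ℝ) (k : ℕ) (e : Ex) (he : low e k) :
    ∃ K : ℝ, 0 ≤ K ∧ ∀ v, LB c C M k v → |ev v e| ≤ K := by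
  induction e with
  | c r => exact ⟨|r|, abs_nonneg _, fun v _ => le_rfl⟩
  | pw s =>
    obtain ⟨K, h0, hK⟩ := rpow_bd (C := C) hc s
    exact ⟨K, h0, fun v hv => hK _ hv.1 hv.2.1⟩
  | z j => exact ⟨max M 0, le_max_right _ _, fun v hv => (hv.2.2.1 j he).trans (le_max_left _ _)⟩
  | l j => exact ⟨max M 0, le_max_right _ _, fun v hv => (hv.2.2.2 j he).trans (le_max_left _ _)⟩
  | p => exact he.elim
  | h => exact he.elim
  | q => exact he.elim
  | add a b iha ihb =>
    obtain ⟨K1, h1, hK1⟩ := iha he.1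
    obtain ⟨K2, h2, hK2⟩ := ihb he.2
    exact ⟨K1 + K2, by positivity, fun v hv =>
      (abs_add_le _ _).trans (add_le_add (hK1 v hv) (hK2 v hv))⟩
  | mul a b iha ihb =>
    obtain ⟨K1, h1, hK1⟩ := iha he.1
    obtain ⟨K2, h2, hK2⟩ := ihb he.2
    refine ⟨K1 * K2, by positivity, fun v hv => ?_⟩
    simp only [ev, abs_mul]
    exact mul_le_mul (hK1 v hv) (hK2 v hv) (abs_nonneg _) h1

lemma dt_bd {c C : ℝ} (hc : 0 < c) (M : ℝ) (k : ℕ) (e : Ex) (he : low e k) :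
    ∃ K : ℝ, 0 ≤ K ∧ ∀ v, LB c C M k v → |ev v (dt e)| ≤ K * VV k v := by
  induction e with
  | c r => exact ⟨0, le_rfl, fun v _ => by simp [ev, dt]⟩
  | pw s =>
    obtain ⟨K, h0, hK⟩ := rpow_bd (C := C) hc (s - 1)
    refine ⟨|s| * K, by positivity, fun v hv => ?_⟩
    simp only [ev, dt, abs_mul]
    have h1 := z_le_VV (Nat.zero_le k) v
    have h2 := hK _ hv.1 hv.2.1
    gcongr
  | z j => exact ⟨1, zero_le_one, fun v hv => by simpa [ev, dt] using z_le_VV (show j ≤ k from he) v⟩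
  | l j => exact ⟨1, zero_le_one, fun v hv => by simpa [ev, dt] using l_le_VV (show j < k from he) v⟩
  | p => exact he.elim
  | h => exact he.elim
  | q => exact he.elim
  | add a b iha ihb =>
    obtain ⟨K1, h1, hK1⟩ := iha he.1
    obtain ⟨K2, h2, hK2⟩ := ihb he.2
    refine ⟨K1 + K2, by positivity, fun v hv => ?_⟩
    have := add_le_add (hK1 v hv) (hK2 v hv)
    simp only [ev, dt]
    calc _ ≤ _ := abs_add_le _ _
      _ ≤ _ := this
      _ = _ := by ring
  | mul a b iha ihb =>
    obtain ⟨K1, h1, hK1⟩ := iha he.1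
    obtain ⟨K2, h2, hK2⟩ := ihb he.2
    obtain ⟨A1, a1, hA1⟩ := ev_bd (C := C) hc M k a he.1
    obtain ⟨A2, a2, hA2⟩ := ev_bd (C := C) hc M k b he.2
    refine ⟨K1 * A2 + A1 * K2, by positivity, fun v hv => ?_⟩
    simp only [ev, dt]
    have hV := VV_nonneg k v
    calc _ ≤ _ := abs_add_le _ _
      _ ≤ (K1 * VV k v) * A2 + A1 * (K2 * VV k v) := by
        rw [abs_mul, abs_mul]
        exact add_le_add (mul_le_mul (hK1 v hv) (hA2 v hv) (abs_nonneg _) (by positivity))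
          (mul_le_mul (hA1 v hv) (hK2 v hv) (abs_nonneg _) a1)
      _ = _ := by ring

/-- All atoms bounded. -/
def Bd (c C : ℝ) (B : ℕ → ℝ) (v : Env) : Prop :=
  c ≤ v.z 0 ∧ v.z 0 ≤ C ∧ (∀ j, |v.z j| ≤ B j) ∧ (∀ j, |v.l j| ≤ B j) ∧ (∀ j, |v.p j| ≤ B j) ∧
    |v.h| ≤ B 0 ∧ |v.q| ≤ B 0

def Df (B : ℕ → ℝ) (η : ℝ) (v w : Env) : Prop :=
  (∀ j, |v.z j - w.z j| ≤ B j * η) ∧ (∀ j, |v.l j - w.l j| ≤ B j * η) ∧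
    (∀ j, |v.p j - w.p j| ≤ B j * η) ∧ |v.h - w.h| ≤ B 0 * η ∧ |v.q - w.q| ≤ B 0 * η

lemma ev_bdall {c C : ℝ} (hc : 0 < c) (B : ℕ → ℝ) (e : Ex) :
    ∃ K : ℝ, 0 ≤ K ∧ ∀ v, Bd c C B v → |ev v e| ≤ K := by
  induction e with
  | c r => exact ⟨|r|, abs_nonneg _, fun v _ => le_rfl⟩
  | pw s =>
    obtain ⟨K, h0, hK⟩ := rpow_bd (C := C) hc s
    exact ⟨K, h0, fun v hv => hK _ hv.1 hv.2.1⟩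
  | z j => exact ⟨|B j|, abs_nonneg _, fun v hv => (hv.2.2.1 j).trans (le_abs_self _)⟩
  | l j => exact ⟨|B j|, abs_nonneg _, fun v hv => (hv.2.2.2.1 j).trans (le_abs_self _)⟩
  | p j => exact ⟨|B j|, abs_nonneg _, fun v hv => (hv.2.2.2.2.1 j).trans (le_abs_self _)⟩
  | h => exact ⟨|B 0|, abs_nonneg _, fun v hv => (hv.2.2.2.2.2.1).trans (le_abs_self _)⟩
  | q => exact ⟨|B 0|, abs_nonneg _, fun v hv => (hv.2.2.2.2.2.2).trans (le_abs_self _)⟩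
  | add a b iha ihb =>
    obtain ⟨K1, h1, hK1⟩ := iha
    obtain ⟨K2, h2, hK2⟩ := ihb
    exact ⟨K1 + K2, by positivity, fun v hv =>
      (abs_add_le _ _).trans (add_le_add (hK1 v hv) (hK2 v hv))⟩
  | mul a b iha ihb =>
    obtain ⟨K1, h1, hK1⟩ := iha
    obtain ⟨K2, h2, hK2⟩ := ihb
    refine ⟨K1 * K2, by positivity, fun v hv => ?_⟩
    simp only [ev, abs_mul]
    exact mul_le_mul (hK1 v hv) (hK2 v hv) (abs_nonneg _) h1

lemma ev_lip {c C : ℝ} (hc : 0 < c) (B B' : ℕ → ℝ) (e : Ex) :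
    ∃ K : ℝ, 0 ≤ K ∧ ∀ v w η, 0 ≤ η → Bd c C B v → Bd c C B w → Df B' η v w →
      |ev v e - ev w e| ≤ K * η := by
  have aux : ∀ b η : ℝ, 0 ≤ η → b * η ≤ |b| * η := fun b η h =>
    mul_le_mul_of_nonneg_right (le_abs_self _) h
  induction e with
  | c r => exact ⟨0, le_rfl, fun v w η h0 _ _ _ => by simp [ev]⟩
  | pw s =>
    obtain ⟨K, h0, hK⟩ := rpow_lip (C := C) hc s
    refine ⟨K * |B' 0|, by positivity, fun v w η h0 hv hw hd => ?_⟩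
    calc _ ≤ _ := hK _ _ hv.1 hv.2.1 hw.1 hw.2.1
      _ ≤ K * (|B' 0| * η) := by
        gcongr
        exact (hd.1 0).trans (aux _ _ h0)
      _ = _ := by ring
  | z j => exact ⟨|B' j|, abs_nonneg _, fun v w η h0 _ _ hd => (hd.1 j).trans (aux _ _ h0)⟩
  | l j => exact ⟨|B' j|, abs_nonneg _, fun v w η h0 _ _ hd => (hd.2.1 j).trans (aux _ _ h0)⟩
  | p j => exact ⟨|B' j|, abs_nonneg _, fun v w η h0 _ _ hd => (hd.2.2.1 j).trans (aux _ _ h0)⟩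
  | h => exact ⟨|B' 0|, abs_nonneg _, fun v w η h0 _ _ hd => (hd.2.2.2.1).trans (aux _ _ h0)⟩
  | q => exact ⟨|B' 0|, abs_nonneg _, fun v w η h0 _ _ hd => (hd.2.2.2.2).trans (aux _ _ h0)⟩
  | add a b iha ihb =>
    obtain ⟨K1, h1, hK1⟩ := iha
    obtain ⟨K2, h2, hK2⟩ := ihb
    refine ⟨K1 + K2, by positivity, fun v w η h0 hv hw hd => ?_⟩
    simp only [ev]
    calc _ = |(ev v a - ev w a) + (ev v b - ev w b)| := by congr 1; ring
      _ ≤ _ := abs_add_le _ _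
      _ ≤ _ := add_le_add (hK1 v w η h0 hv hw hd) (hK2 v w η h0 hv hw hd)
      _ = _ := by ring
  | mul a b iha ihb =>
    obtain ⟨K1, h1, hK1⟩ := iha
    obtain ⟨K2, h2, hK2⟩ := ihb
    obtain ⟨A1, a1, hA1⟩ := ev_bdall (C := C) hc B a
    obtain ⟨A2, a2, hA2⟩ := ev_bdall (C := C) hc B b
    refine ⟨K1 * A2 + A1 * K2, by positivity, fun v w η h0 hv hw hd => ?_⟩
    simp only [ev]
    calc _ = |(ev v a - ev w a) * ev v b + ev w a * (ev v b - ev w b)| := by congr 1; ring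
      _ ≤ _ := abs_add_le _ _
      _ ≤ (K1 * η) * A2 + A1 * (K2 * η) := by
        rw [abs_mul, abs_mul]
        exact add_le_add
          (mul_le_mul (hK1 v w η h0 hv hw hd) (hA2 v hv) (abs_nonneg _) (by positivity))
          (mul_le_mul (hA1 w hw) (hK2 v w η h0 hv hw hd) (abs_nonneg _) a1)
      _ = _ := by ring

lemma ev_tendsto {ι : Type*} {f : Filter ι} {V : ι → Env} {v : Env} (h0 : 0 < v.z 0)
    (hz : ∀ j, Tendsto (fun n => (V n).z j) f (nhds (v.z j)))
    (hl : ∀ j, Tendsto (fun n => (V n).l j) f (nhds (v.l j)))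
    (hp : ∀ j, Tendsto (fun n => (V n).p j) f (nhds (v.p j)))
    (hh : Tendsto (fun n => (V n).h) f (nhds v.h))
    (hq : Tendsto (fun n => (V n).q) f (nhds v.q)) (e : Ex) :
    Tendsto (fun n => ev (V n) e) f (nhds (ev v e)) := by
  induction e with
  | c r => exact tendsto_const_nhds
  | pw s => exact (hz 0).rpow_const (Or.inl h0.ne')
  | z j => exact hz j
  | l j => exact hl j
  | p j => exact hp j
  | h => exact hh
  | q => exact hq
  | add a b iha ihb => exact iha.add ihb
  | mul a b iha ihb => exact iha.mul ihb

/-- A path of environments along which the formal time derivative is the time derivative. -/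
lemma ev_hasDerivAt {V : ℝ → Env} {t : ℝ} (h0 : 0 < (V t).z 0)
    (hz : ∀ j, HasDerivAt (fun s => (V s).z j) ((V t).z (j + 1)) t)
    (hl : ∀ j, HasDerivAt (fun s => (V s).l j) ((V t).l (j + 1)) t)
    (hp : ∀ j, HasDerivAt (fun s => (V s).p j) ((V t).p (j + 1)) t)
    (hh : HasDerivAt (fun s => (V s).h) ((V t).l 0 - (V t).z 0) t)
    (hq : HasDerivAt (fun s => (V s).q) (-(V t).p 0) t) (e : Ex) :
    HasDerivAt (fun s => ev (V s) e) (ev (V t) (dt e)) t := by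
  induction e with
  | c r => exact hasDerivAt_const _ _
  | pw s =>
    have := (hz 0).rpow_const (p := s) (Or.inl h0.ne')
    exact this.congr_deriv (by simp only [ev, dt]; ring)
  | z j => exact hz j
  | l j => exact hl j
  | p j => exact hp j
  | h => exact hh.congr_deriv (by simp only [ev, dt]; ring)
  | q => exact hq.congr_deriv (by simp only [ev, dt]; ring)
  | add a b iha ihb => exact iha.add ihb
  | mul a b iha ihb =>
    exact (iha.mul ihb).congr_deriv (by simp only [ev, dt])

end APF

namespace APF

/-- Forward difference quotient. -/
noncomputable def Dp (δ : ℝ) (f : ℤ → ℝ) (i : ℤ) : ℝ := (f (i + 1) - f i) / δ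
/-- Second difference quotient. -/
noncomputable def D2 (δ : ℝ) (f : ℤ → ℝ) (i : ℤ) : ℝ := (f (i + 1) - 2 * f i + f (i - 1)) / δ ^ 2
/-- Sum over one period. -/
noncomputable def av (δ : ℝ) (N : ℕ) (f : ℤ → ℝ) : ℝ := δ * ∑ i ∈ Finset.range (2 * N), f (i : ℤ)

def Per (N : ℕ) (f : ℤ → ℝ) : Prop := ∀ i, f (i + 2 * N) = f i
def Evn (f : ℤ → ℝ) : Prop := ∀ i, f (-i) = f i

lemma Per.mulZ {N : ℕ} {f : ℤ → ℝ} (hf : Per N f) (i k : ℤ) : f (i + k * (2 * N)) = f i := by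
  induction k using Int.induction_on with
  | zero => simp
  | succ k ih =>
    rw [← ih, ← hf (i + k * (2 * N))]
    congr 1; ring
  | pred k ih =>
    rw [← ih, ← hf (i + (-k - 1) * (2 * N))]
    congr 1; ring

lemma Per.rep {N : ℕ} (hN : 0 < N) {f : ℤ → ℝ} (hf : Per N f) (i : ℤ) :
    ∃ k : ℕ, k < 2 * N ∧ f i = f k := by
  have hN' : (0:ℤ) < 2 * N := by omega
  refine ⟨(i % (2 * N)).toNat, ?_, ?_⟩
  · have := Int.emod_lt_of_pos i hN'
    have := Int.emod_nonneg i hN'.ne'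
    omega
  · rw [Int.toNat_of_nonneg (Int.emod_nonneg i hN'.ne')]
    rw [← hf.mulZ (i % (2 * N)) (i / (2 * N))]
    congr 1
    have := Int.emod_add_mul_ediv i (2 * N)
    linarith

/-- The fold of the index set onto a fundamental domain. -/
def rf (N : ℕ) (i : ℤ) : ℕ := min (i % (2 * N)).toNat (2 * N - (i % (2 * N)).toNat)

lemma rf_le (N : ℕ) (i : ℤ) : rf N i ≤ N := by
  unfold rf; omega

lemma rf_add (N : ℕ) (i : ℤ) : rf N (i + 2 * N) = rf N i := by
  unfold rf; simp

lemma rf_neg {N : ℕ} (hN : 0 < N) (i : ℤ) : rf N (-i) = rf N i := by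
  have hN' : (0:ℤ) < 2 * N := by omega
  have h1 := Int.emod_lt_of_pos i hN'
  have h2 := Int.emod_nonneg i hN'.ne'
  have h3 := Int.emod_lt_of_pos (-i) hN'
  have h4 := Int.emod_nonneg (-i) hN'.ne'
  have h5 : (2 * (N:ℤ)) ∣ (i % (2 * N) + (-i) % (2 * N)) := by
    apply Int.dvd_of_emod_eq_zero
    rw [← Int.add_emod]; simp
  obtain ⟨k, hk⟩ := h5
  have hk0 : 0 ≤ k := by
    by_contra hneg
    have : k ≤ -1 := by omega
    nlinarith
  have hk1 : k < 2 := by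
    by_contra hneg
    have : 2 ≤ k := by omega
    nlinarith
  unfold rf
  have : k = 0 ∨ k = 1 := by omega
  rcases this with rfl | rfl <;> omega

lemma fold {N : ℕ} (hN : 0 < N) {f : ℤ → ℝ} (hf : Per N f) (he : Evn f) (i : ℤ) :
    f i = f (rf N i) := by
  have hN' : (0:ℤ) < 2 * N := by omega
  have h1 := Int.emod_lt_of_pos i hN'
  have h2 := Int.emod_nonneg i hN'.ne'
  have h3 : f i = f (i % (2 * N)) := by
    rw [← hf.mulZ (i % (2 * N)) (i / (2 * N))]
    congr 1
    have := Int.emod_add_mul_ediv i (2 * N)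
    linarith
  have h4 : f (i % (2 * N)) = f (2 * N - i % (2 * N)) := by
    rw [← he, ← hf]; congr 1; ring
  unfold rf
  rcases le_total (i % (2 * N)).toNat (2 * N - (i % (2 * N)).toNat) with h | h
  · rw [min_eq_left h, h3]; congr 1; omega
  · rw [min_eq_right h, h3, h4]; congr 1; omega

lemma rf_self {N k : ℕ} (hk : k ≤ N) (hN : 0 < N) : rf N (k : ℤ) = k := by
  have : ((k:ℤ) % (2 * N)) = k := Int.emod_eq_of_lt (by omega) (by omega)
  unfold rf
  rw [this]
  simp only [Int.toNat_natCast]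
  omega

lemma av_congr {δ : ℝ} {N : ℕ} {f g : ℤ → ℝ} (h : ∀ i, f i = g i) : av δ N f = av δ N g := by
  have : f = g := funext h
  rw [this]

lemma av_add (δ : ℝ) (N : ℕ) (f g : ℤ → ℝ) : av δ N (fun i => f i + g i) = av δ N f + av δ N g := by
  simp only [av, Finset.sum_add_distrib]; ring

lemma av_sub (δ : ℝ) (N : ℕ) (f g : ℤ → ℝ) : av δ N (fun i => f i - g i) = av δ N f - av δ N g := by
  simp only [av, Finset.sum_sub_distrib]; ring

lemma av_mul (δ : ℝ) (N : ℕ) (r : ℝ) (f : ℤ → ℝ) : av δ N (fun i => r * f i) = r * av δ N f := by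
  simp only [av, ← Finset.mul_sum]; ring

lemma av_const (δ : ℝ) (N : ℕ) (r : ℝ) : av δ N (fun _ => r) = 2 * (δ * N) * r := by
  simp [av]; ring

lemma av_mono {δ : ℝ} (hδ : 0 ≤ δ) {N : ℕ} {f g : ℤ → ℝ} (h : ∀ i, f i ≤ g i) :
    av δ N f ≤ av δ N g := by
  unfold av
  exact mul_le_mul_of_nonneg_left (Finset.sum_le_sum fun i _ => h _) hδ

lemma av_nonneg {δ : ℝ} (hδ : 0 ≤ δ) {N : ℕ} {f : ℤ → ℝ} (h : ∀ i, 0 ≤ f i) :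
    0 ≤ av δ N f := by
  unfold av
  exact mul_nonneg hδ (Finset.sum_nonneg fun i _ => h _)

lemma abs_av_le {δ : ℝ} (hδ : 0 ≤ δ) {N : ℕ} {f g : ℤ → ℝ} (h : ∀ i, |f i| ≤ g i) :
    |av δ N f| ≤ av δ N g := by
  rw [abs_le]
  constructor
  · have : -av δ N g = av δ N (fun i => (-1) * g i) := by rw [av_mul]; ring
    rw [this]
    exact av_mono hδ fun i => by linarith [neg_abs_le (f i), h i]
  · exact av_mono hδ fun i => (le_abs_self _).trans (h i)

lemma av_shift {δ : ℝ} {N : ℕ} {f : ℤ → ℝ} (hf : Per N f) :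
    av δ N (fun i => f (i + 1)) = av δ N f := by
  have h := Finset.sum_range_sub (fun i : ℕ => f (i : ℤ)) (2 * N)
  have h2 : f ((2 * N : ℕ) : ℤ) = f 0 := by
    have := hf 0
    push_cast
    simpa using this
  simp only [Nat.cast_zero, h2, sub_self, Finset.sum_sub_distrib] at h
  unfold av
  push_cast at h
  congr 1
  linarith

lemma Per.Dp {N : ℕ} {f : ℤ → ℝ} (hf : Per N f) (δ : ℝ) : Per N (Dp δ f) := by
  intro i
  have h1 := hf i
  have h2 := hf (i + 1)
  simp only [APF.Dp]
  rw [show i + 2 * (N:ℤ) + 1 = i + 1 + 2 * N by ring, h1, h2]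

lemma Per.D2 {N : ℕ} {f : ℤ → ℝ} (hf : Per N f) (δ : ℝ) : Per N (D2 δ f) := by
  intro i
  have h1 := hf i
  have h2 := hf (i + 1)
  have h3 := hf (i - 1)
  simp only [APF.D2]
  rw [show i + 2 * (N:ℤ) + 1 = i + 1 + 2 * N by ring,
    show i + 2 * (N:ℤ) - 1 = i - 1 + 2 * N by ring, h1, h2, h3]

lemma Evn.D2 {f : ℤ → ℝ} (hf : Evn f) (δ : ℝ) : Evn (D2 δ f) := by
  intro i
  have h1 := hf i
  have h2 := hf (i + 1)
  have h3 := hf (i - 1)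
  simp only [APF.D2]
  rw [show -i + 1 = -(i - 1) by ring, show -i - 1 = -(i + 1) by ring, h1, h2, h3]
  ring

lemma Per.mul {N : ℕ} {f g : ℤ → ℝ} (hf : Per N f) (hg : Per N g) : Per N (fun i => f i * g i) :=
  fun i => by simp only [hf i, hg i]

/-- Summation by parts. -/
lemma sbp {δ : ℝ} (hδ : δ ≠ 0) {N : ℕ} {f g : ℤ → ℝ} (hf : Per N f) (hg : Per N g) :
    av δ N (fun i => D2 δ f i * g i) = - av δ N (fun i => Dp δ f i * Dp δ g i) := by
  have h1 : av δ N (fun i => D2 δ f i * g i)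
      = av δ N (fun i => Dp δ f i * g i / δ) - av δ N (fun i => Dp δ f (i - 1) * g i / δ) := by
    rw [← av_sub]
    apply av_congr; intro i
    simp only [D2, Dp, sub_add_cancel]
    field_simp
    ring
  have hper : Per N (fun i => Dp δ f (i - 1) * g i / δ) := by
    intro i
    have a := hf.Dp δ (i - 1)
    have b := hg i
    simp only [b]
    rw [show i + 2 * (N:ℤ) - 1 = i - 1 + 2 * N by ring, a]
  rw [h1, ← av_shift hper, ← av_sub]
  have : - av δ N (fun i => Dp δ f i * Dp δ g i)
    = av δ N (fun i => (-1) * (Dp δ f i * Dp δ g i)) := by rw [av_mul]; ring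
  rw [this]
  apply av_congr; intro i
  simp only [Dp, add_sub_cancel_right]
  field_simp
  ring

/-- Discrete Sobolev inequality. -/
lemma sobolev {δ L : ℝ} {N : ℕ} (hN : 0 < N) (hL : 0 < L) (hδ : δ * N = L) {f : ℤ → ℝ}
    (hf : Per N f) (i : ℤ) :
    f i ^ 2 ≤ (1 / L) * av δ N (fun k => f k ^ 2) + 4 * L * av δ N (fun k => Dp δ f k ^ 2) := by
  have hNr : (0:ℝ) < N := by exact_mod_cast hN
  have hδ0 : 0 < δ := by
    by_contra h
    push Not at h
    nlinarith
  obtain ⟨k, hk, hfk⟩ := hf.rep hN i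
  rw [hfk]
  set S := ∑ l ∈ Finset.range (2 * N), |f (l + 1) - f l| with hS
  have key : ∀ a b : ℕ, a ≤ b → b < 2 * N → |f b - f a| ≤ S := by
    intro a b hab hb
    have h := Finset.sum_Ico_sub (fun l : ℕ => f (l : ℤ)) hab
    rw [← h]
    refine (Finset.abs_sum_le_sum_abs _ _).trans ?_
    push_cast
    refine Finset.sum_le_sum_of_subset_of_nonneg ?_ (fun _ _ _ => abs_nonneg _)
    intro l hl
    simp only [Finset.mem_Ico, Finset.mem_range] at *
    omega
  have key2 : ∀ a b : ℕ, a < 2 * N → b < 2 * N → |f b - f a| ≤ S := by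
    intro a b ha hb
    rcases le_total a b with h | h
    · exact key a b h hb
    · rw [abs_sub_comm]; exact key b a h ha
  have hS2 : S ^ 2 ≤ 2 * L * av δ N (fun k => Dp δ f k ^ 2) := by
    have := sq_sum_le_card_mul_sum_sq (s := Finset.range (2 * N))
      (f := fun l : ℕ => |f (l + 1) - f l|)
    rw [← hS, Finset.card_range] at this
    refine this.trans (le_of_eq ?_)
    simp only [av, Dp, div_pow, sq_abs, ← Finset.sum_div]
    rw [← hδ]
    push_cast
    field_simp
  have hS0 : 0 ≤ S := by positivity
  have h3 : ∀ b ∈ Finset.range (2 * N), f k ^ 2 ≤ 2 * f (b:ℤ) ^ 2 + 2 * S ^ 2 := by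
    intro b hb
    have h4 := key2 b k (Finset.mem_range.1 hb) hk
    have h5 : (f k - f b) ^ 2 ≤ S ^ 2 := by
      rw [← sq_abs]; gcongr
    nlinarith [sq_nonneg (f k - 2 * f b)]
  have h6 := Finset.sum_le_sum h3
  simp only [Finset.sum_const, Finset.card_range, Finset.sum_add_distrib, ← Finset.mul_sum,
    nsmul_eq_mul] at h6
  push_cast at h6
  have h7 : 2 * L * f k ^ 2 ≤ 2 * av δ N (fun k => f k ^ 2) + 4 * L * S ^ 2 := by
    have := mul_le_mul_of_nonneg_left h6 hδ0.le
    simp only [av]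
    rw [← hδ]
    nlinarith
  have h8 : f k ^ 2 ≤ (1 / L) * av δ N (fun k => f k ^ 2) + 2 * S ^ 2 := by
    rw [← mul_le_mul_iff_right₀ (show 0 < 2 * L by positivity)]
    refine h7.trans (le_of_eq ?_)
    field_simp
    ring
  nlinarith

end APF

namespace APF

/-- Maximum principle for finite systems of ordinary differential inequalities. -/
lemma maxPrin {ι : Type*} (s : Finset ι) {v v' : ι → ℝ → ℝ} {T : ℝ}
    (hd : ∀ i ∈ s, ∀ t, 0 ≤ t → t ≤ T → HasDerivAt (v i) (v' i t) t)
    (h0 : ∀ i ∈ s, 0 < v i 0)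
    (hz : ∀ i ∈ s, ∀ t, 0 < t → t ≤ T → v i t = 0 → (∀ k ∈ s, 0 ≤ v k t) → 0 < v' i t) :
    ∀ i ∈ s, ∀ t, 0 ≤ t → t ≤ T → 0 < v i t := by
  by_contra hcon
  push Not at hcon
  obtain ⟨i, hi, t, ht0, htT, hvt⟩ := hcon
  set A : Set ℝ := {t | t ∈ Set.Icc 0 T ∧ ∃ i ∈ s, v i t ≤ 0} with hA
  have hcont : ∀ i ∈ s, ContinuousOn (v i) (Set.Icc 0 T) := fun i hi t ht =>
    (hd i hi t ht.1 ht.2).continuousAt.continuousWithinAt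
  have hAeq : A = ⋃ i ∈ s, {t | t ∈ Set.Icc 0 T ∧ v i t ≤ 0} := by
    ext t; simp only [hA, Set.mem_setOf_eq, Set.mem_iUnion]
    constructor
    · rintro ⟨h1, i, hi, h2⟩; exact ⟨i, hi, h1, h2⟩
    · rintro ⟨i, hi, h1, h2⟩; exact ⟨h1, i, hi, h2⟩
  have hclosed : IsClosed A := by
    rw [hAeq]
    apply Set.Finite.isClosed_biUnion s.finite_toSet
    intro i hi
    have := (hcont i hi).preimage_isClosed_of_isClosed isClosed_Icc (isClosed_Iic (a := (0:ℝ)))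
    exact this
  have hcomp : IsCompact A := isCompact_Icc.of_isClosed_subset hclosed (fun t ht => ht.1)
  have hne : A.Nonempty := ⟨t, ⟨ht0, htT⟩, i, hi, hvt⟩
  obtain ⟨τ, hτ, hmin⟩ := hcomp.exists_isLeast hne
  obtain ⟨⟨hτ0, hτT⟩, k, hk, hvk⟩ := hτ
  have hτpos : 0 < τ := by
    rcases hτ0.lt_or_eq with h | h
    · exact h
    · rw [← h] at hvk; linarith [h0 k hk]
  have hbefore : ∀ j ∈ s, ∀ r, 0 ≤ r → r < τ → 0 < v j r := by
    intro j hj r hr0 hr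
    by_contra hneg
    push Not at hneg
    have := hmin (show r ∈ A from ⟨⟨hr0, by linarith⟩, j, hj, hneg⟩)
    linarith
  have hev : ∀ j ∈ s, ∀ᶠ r in nhdsWithin τ (Set.Iio τ), 0 < v j r := by
    intro j hj
    filter_upwards [Ioo_mem_nhdsLT hτpos] with r hr
    exact hbefore j hj r hr.1.le hr.2
  have hge : ∀ j ∈ s, 0 ≤ v j τ := by
    intro j hj
    have h1 : Tendsto (v j) (nhdsWithin τ (Set.Iio τ)) (nhds (v j τ)) :=
      (hd j hj τ hτ0 hτT).continuousAt.continuousWithinAt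
    exact ge_of_tendsto h1 ((hev j hj).mono fun _ h => h.le)
  have hvk0 : v k τ = 0 := le_antisymm hvk (hge k hk)
  have hpos := hz k hk τ hτpos hτT hvk0 hge
  have hslope := (hasDerivAt_iff_tendsto_slope_left_right.1 (hd k hk τ hτ0 hτT)).1
  have : v' k τ ≤ 0 := by
    refine le_of_tendsto hslope ?_
    filter_upwards [hev k hk, self_mem_nhdsWithin] with r hr hr2
    rw [slope_def_field, hvk0]
    have : r - τ < 0 := sub_neg.2 hr2
    rw [sub_zero]
    have := div_neg_of_pos_of_neg hr this
    linarith
  linarith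

lemma anti_of_deriv {f f' : ℝ → ℝ} {T : ℝ} (hd : ∀ t, 0 ≤ t → t ≤ T → HasDerivAt f (f' t) t)
    (h : ∀ t, 0 ≤ t → t ≤ T → f' t ≤ 0) {s t : ℝ} (hs : 0 ≤ s) (hst : s ≤ t) (ht : t ≤ T) :
    f t ≤ f s := by
  have : AntitoneOn f (Set.Icc 0 T) := by
    apply antitoneOn_of_deriv_nonpos (convex_Icc 0 T)
    · exact fun t ht => (hd t ht.1 ht.2).continuousAt.continuousWithinAt
    · intro t ht
      rw [interior_Icc] at ht
      exact (hd t ht.1.le ht.2.le).differentiableAt.differentiableWithinAt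
    · intro t ht
      rw [interior_Icc] at ht
      rw [(hd t ht.1.le ht.2.le).deriv]
      exact h t ht.1.le ht.2.le
  exact this ⟨hs, hst.trans ht⟩ ⟨hs.trans hst, ht⟩ hst

/-- A solution of the semidiscrete flow on the open time set `J`. -/
structure Scheme (α δ : ℝ) (N : ℕ) (a b : ℝ) (e : ℤ → ℝ) (J : Set ℝ) (V : ℤ → ℝ → Env) : Prop where
  openJ : IsOpen J
  apos : 0 < a
  lo : ∀ i t, t ∈ J → a ≤ (V i t).z 0
  hi : ∀ i t, t ∈ J → (V i t).z 0 ≤ b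
  dz : ∀ i t, t ∈ J → ∀ j, HasDerivAt (fun s => (V i s).z j) ((V i t).z (j + 1)) t
  dl : ∀ i t, t ∈ J → ∀ j, HasDerivAt (fun s => (V i s).l j) ((V i t).l (j + 1)) t
  dh : ∀ i t, t ∈ J → HasDerivAt (fun s => (V i s).h) ((V i t).l 0 - (V i t).z 0) t
  lind : ∀ i t j, (V i t).l j = (V 0 t).l j
  pdef : ∀ i t j, (V i t).p j = Dp δ (fun k => (V k t).z j) i
  qdef : ∀ i t, (V i t).q = Dp δ (fun k => (V k t).h) i
  per : ∀ i t, V (i + 2 * N) t = V i t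
  evz : ∀ i t j, (V (-i) t).z j = (V i t).z j
  evh : ∀ i t, (V (-i) t).h = (V i t).h
  rel : ∀ i t, t ∈ J → ev (V i t) (rhoE α) = (V i t).h + D2 δ (fun k => (V k t).h) i - e i
  sum : ∀ t, t ∈ J → av δ N (fun i => ev (V i t) (TE α 0)) = 0

namespace Scheme
variable {α δ : ℝ} {N : ℕ} {a b : ℝ} {e : ℤ → ℝ} {J : Set ℝ} {V : ℤ → ℝ → Env}

lemma pos (S : Scheme α δ N a b e J V) (i : ℤ) {t : ℝ} (ht : t ∈ J) : 0 < (V i t).z 0 :=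
  S.apos.trans_le (S.lo i t ht)

lemma dp (S : Scheme α δ N a b e J V) (i : ℤ) {t : ℝ} (ht : t ∈ J) (j : ℕ) :
    HasDerivAt (fun s => (V i s).p j) ((V i t).p (j + 1)) t := by
  simp only [S.pdef, Dp]
  exact ((S.dz (i + 1) t ht j).sub (S.dz i t ht j)).div_const δ

lemma dq (S : Scheme α δ N a b e J V) (i : ℤ) {t : ℝ} (ht : t ∈ J) :
    HasDerivAt (fun s => (V i s).q) (-(V i t).p 0) t := by
  simp only [S.pdef, S.qdef, Dp]
  refine (((S.dh (i + 1) t ht).sub (S.dh i t ht)).div_const δ).congr_deriv ?_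
  rw [S.lind (i + 1), S.lind i]; ring

lemma dev (S : Scheme α δ N a b e J V) (i : ℤ) {t : ℝ} (ht : t ∈ J) (x : Ex) :
    HasDerivAt (fun s => ev (V i s) x) (ev (V i t) (dt x)) t :=
  ev_hasDerivAt (S.pos i ht) (S.dz i t ht) (S.dl i t ht) (S.dp i ht) (S.dh i t ht) (S.dq i ht) x

lemma dD2 {f f' : ℤ → ℝ → ℝ} {t : ℝ} (h : ∀ i, HasDerivAt (f i) (f' i t) t) (i : ℤ) :
    HasDerivAt (fun s => D2 δ (fun k => f k s) i) (D2 δ (fun k => f' k t) i) t := by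
  simp only [D2]
  exact ((((h (i + 1))).sub ((h i).const_mul 2)).add (h (i - 1))).div_const _

lemma perz (S : Scheme α δ N a b e J V) (t : ℝ) (j : ℕ) : Per N (fun i => (V i t).z j) :=
  fun i => by simp only [S.per i t]
lemma perh (S : Scheme α δ N a b e J V) (t : ℝ) : Per N (fun i => (V i t).h) :=
  fun i => by simp only [S.per i t]
lemma evnz (S : Scheme α δ N a b e J V) (t : ℝ) (j : ℕ) : Evn (fun i => (V i t).z j) :=
  fun i => S.evz i t j
lemma evnh (S : Scheme α δ N a b e J V) (t : ℝ) : Evn (fun i => (V i t).h) :=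
  fun i => S.evh i t

/-- The differentiated evolution equations. -/
lemma eqRE (S : Scheme α δ N a b e J V) (j : ℕ) : ∀ (i : ℤ) {t : ℝ}, t ∈ J →
    ev (V i t) (RE α (j + 1)) = D2 δ (fun k => (V k t).z j) i + (V i t).z j - (V i t).l j := by
  induction j with
  | zero =>
    intro i t ht
    rw [← ev_dt_RE]
    have h1 := S.dev i ht (RE α 0)
    have h2 : HasDerivAt (fun s => -((V i s).h + D2 δ (fun k => (V k s).h) i - e i))
      (-(((V i t).l 0 - (V i t).z 0) + D2 δ (fun k => (V k t).l 0 - (V k t).z 0) i)) t :=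
      (((S.dh i t ht).add (dD2 (f := fun k s => (V k s).h)
        (f' := fun k s => (V k s).l 0 - (V k s).z 0) (fun k => S.dh k t ht) i)).sub_const _).neg
    have h3 : (fun s => ev (V i s) (RE α 0)) =ᶠ[nhds t]
        (fun s => -((V i s).h + D2 δ (fun k => (V k s).h) i - e i)) := by
      filter_upwards [S.openJ.mem_nhds ht] with s hs
      rw [← S.rel i s hs]
      simp [RE, gE, ev]
    have h4 := (h2.congr_of_eventuallyEq h3).unique h1
    rw [← h4]
    simp only [D2]
    rw [S.lind (i + 1), S.lind (i - 1), S.lind i]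
    ring
  | succ j ih =>
    intro i t ht
    rw [← ev_dt_RE]
    have h1 := S.dev i ht (RE α (j + 1))
    have h2 : HasDerivAt (fun s => D2 δ (fun k => (V k s).z j) i + (V i s).z j - (V i s).l j)
      (D2 δ (fun k => (V k t).z (j + 1)) i + (V i t).z (j + 1) - (V i t).l (j + 1)) t :=
      ((dD2 (f := fun k s => (V k s).z j)
        (f' := fun k s => (V k s).z (j + 1)) (fun k => S.dz k t ht j) i).add
          (S.dz i t ht j)).sub (S.dl i t ht j)
    have h3 : (fun s => ev (V i s) (RE α (j + 1))) =ᶠ[nhds t]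
        (fun s => D2 δ (fun k => (V k s).z j) i + (V i s).z j - (V i s).l j) := by
      filter_upwards [S.openJ.mem_nhds ht] with s hs
      exact ih i hs
    exact h1.unique (h2.congr_of_eventuallyEq h3)

lemma dav {f f' : ℤ → ℝ → ℝ} {t : ℝ} (h : ∀ i, HasDerivAt (f i) (f' i t) t) :
    HasDerivAt (fun s => av δ N (fun i => f i s)) (av δ N (fun i => f' i t)) t := by
  unfold av
  apply HasDerivAt.const_mul
  exact HasDerivAt.fun_sum fun i _ => h i

lemma sumTE (S : Scheme α δ N a b e J V) (j : ℕ) : ∀ {t : ℝ}, t ∈ J →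
    av δ N (fun i => ev (V i t) (TE α j)) = 0 := by
  induction j with
  | zero => intro t ht; exact S.sum t ht
  | succ j ih =>
    intro t ht
    have h1 : HasDerivAt (fun s => av δ N (fun i => ev (V i s) (TE α j)))
        (av δ N (fun i => ev (V i t) (dt (TE α j)))) t :=
      dav (f := fun i s => ev (V i s) (TE α j)) (f' := fun i s => ev (V i s) (dt (TE α j)))
        fun i => S.dev i ht _
    have h3 : (fun s => av δ N (fun i => ev (V i s) (TE α j))) =ᶠ[nhds t] (fun _ => 0) := by
      filter_upwards [S.openJ.mem_nhds ht] with s hs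
      exact ih hs
    have h4 := h1.unique ((hasDerivAt_const t (0:ℝ)).congr_of_eventuallyEq h3)
    rw [← h4]
    exact av_congr fun i => (ev_dt_TE α _ j).symm

end Scheme
end APF

namespace APF

lemma chain_anti {f : ℤ → ℝ} {N : ℕ} (h : ∀ i : ℕ, i < N → f (i + 1) ≤ f i) {i k : ℕ}
    (hik : i ≤ k) (hk : k ≤ N) : f k ≤ f i := by
  induction k, hik using Nat.le_induction with
  | base => exact le_rfl
  | succ k hik ih =>
    have := h k (by omega)
    push_cast
    exact this.trans (ih (by omega))

lemma chain_add {f : ℤ → ℝ} {N : ℕ} {η : ℝ} (hη : 0 ≤ η)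
    (h : ∀ i : ℕ, i < N → f (i + 1) ≤ f i + η) {i k : ℕ}
    (hik : i ≤ k) (hk : k ≤ N) : f k ≤ f i + N * η := by
  have : f k ≤ f i + (k - i : ℝ) * η := by
    induction k, hik using Nat.le_induction with
    | base => simp
    | succ k hik ih =>
      have := h k (by omega)
      have := ih (by omega)
      push_cast
      linarith
  refine this.trans ?_
  have h1 : (k:ℝ) ≤ N := by exact_mod_cast hk
  have h2 : (0:ℝ) ≤ i := by positivity
  gcongr
  linarith

lemma refl_N {N : ℕ} {f : ℤ → ℝ} (hf : Per N f) (he : Evn f) : f (N + 1) = f (N - 1) := by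
  rw [← he, ← hf]; congr 1; ring

/-- Discrete Sturm comparison. -/
lemma barrier {L : ℝ} (hL : 0 < L) (hLpi : L < π) : ∃ K δ0 : ℝ, 0 ≤ K ∧ 0 < δ0 ∧
    ∀ (N : ℕ) (δ : ℝ), 0 < δ → δ ≤ δ0 → δ * N = L → ∀ f : ℤ → ℝ, Per N f → Evn f → ∀ η, 0 ≤ η →
    (∀ i : ℕ, i < N → f i + D2 δ f i - η ≤ f (i + 1) + D2 δ f (i + 1)) →
    ∀ i : ℕ, i < N → f (i + 1) ≤ f i + K * η := by
  set μ := (1 + π / L) / 2 with hμ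
  have h1 : 1 < π / L := by rw [lt_div_iff₀ hL]; linarith
  have hμ1 : 1 < μ := by rw [hμ]; linarith
  have hμL : μ * L < π := by
    rw [hμ]; field_simp; linarith
  set φ := (μ * L + π) / 4 with hφ
  have hφ2 : φ < π / 2 := by rw [hφ]; linarith
  have hφ0 : 0 < φ := by rw [hφ]; positivity
  have hcφ : 0 < cos φ := cos_pos_of_mem_Ioo ⟨by linarith [pi_pos], hφ2⟩
  set c' := (μ ^ 2 - 1) / 2 with hc'
  have hc'0 : 0 < c' := by rw [hc']; nlinarith
  refine ⟨1 / (c' * cos φ), min (min (1 / μ) ((μ ^ 2 - 1) / μ ^ 3)) ((π - μ * L) / (2 * μ)),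
    by positivity, ?_, ?_⟩
  · have : 0 < μ ^ 2 - 1 := by nlinarith
    have : 0 < π - μ * L := by linarith
    positivity
  intro N δ hδ hδ0 hδN f hf he η hη hyp
  have hd1 : μ * δ ≤ 1 := by
    have := hδ0.trans ((min_le_left _ _).trans (min_le_left _ _))
    rw [le_div_iff₀ (by positivity)] at this; linarith
  have hd2 : (μ * δ) * μ ^ 2 ≤ μ ^ 2 - 1 := by
    have := hδ0.trans ((min_le_left _ _).trans (min_le_right _ _))
    rw [le_div_iff₀ (by positivity)] at this; linarith
  have hd3 : μ * (L + δ) / 2 ≤ φ := by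
    have := hδ0.trans (min_le_right _ _)
    rw [le_div_iff₀ (by positivity)] at this; rw [hφ]; linarith
  have hcos : (1 + c') * δ ^ 2 ≤ 2 - 2 * cos (μ * δ) := by
    have hx0 : 0 < μ * δ := by positivity
    have h3 := (abs_le.1 (cos_bound (x := μ * δ) (by rw [abs_of_pos hx0]; exact hd1))).2
    rw [abs_of_pos hx0] at h3
    have h4 : (μ * δ) ^ 2 * μ ^ 2 ≤ μ ^ 2 - 1 := by
      refine le_trans ?_ hd2
      have : (μ * δ) ^ 2 ≤ μ * δ := by nlinarith
      exact mul_le_mul_of_nonneg_right this (by positivity)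
    have h5 : (μ * δ) ^ 4 ≤ (μ ^ 2 - 1) * δ ^ 2 := by
      have : (μ * δ) ^ 4 = ((μ * δ) ^ 2 * μ ^ 2) * δ ^ 2 := by ring
      rw [this]; exact mul_le_mul_of_nonneg_right h4 (by positivity)
    have h6 : 0 ≤ (μ ^ 2 - 1) * δ ^ 2 := by
      have : 0 ≤ μ ^ 2 - 1 := by nlinarith
      positivity
    rw [hc']
    nlinarith
  set s : ℤ → ℝ := fun i => cos (μ * δ * (i - (N - 1) / 2)) with hs
  have hsD : ∀ i, s (i + 1) + s (i - 1) = 2 * cos (μ * δ) * s i := by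
    intro i
    simp only [hs]
    push_cast
    rw [show μ * δ * ((i:ℝ) + 1 - (N - 1) / 2) = μ * δ * (i - (N - 1) / 2) + μ * δ by ring,
      show μ * δ * ((i:ℝ) - 1 - (N - 1) / 2) = μ * δ * (i - (N - 1) / 2) - μ * δ by ring,
      cos_add, cos_sub]
    ring
  have hspos : ∀ i : ℤ, -1 ≤ i → i ≤ N → cos φ ≤ s i := by
    intro i hi1 hi2
    have hi1' : (-1:ℝ) ≤ i := by exact_mod_cast hi1
    have hi2' : (i:ℝ) ≤ N := by exact_mod_cast hi2
    simp only [hs]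
    rw [← cos_abs (μ * δ * (i - (N - 1) / 2))]
    apply cos_le_cos_of_nonneg_of_le_pi (abs_nonneg _) (by linarith)
    rw [abs_mul, abs_of_pos (by positivity : 0 < μ * δ)]
    have : |(i:ℝ) - (N - 1) / 2| ≤ (N + 1) / 2 := by
      rw [abs_le]; constructor <;> linarith
    calc μ * δ * |(i:ℝ) - (N - 1) / 2| ≤ μ * δ * ((N + 1) / 2) := by gcongr
      _ = μ * (L + δ) / 2 := by rw [← hδN]; ring
      _ ≤ φ := hd3
  have hs1 : ∀ i, s i ≤ 1 := fun i => cos_le_one _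
  intro i hi
  set v : ℤ → ℝ := fun i => f (i + 1) - f i with hv
  obtain ⟨k, hk, hmax⟩ := Finset.exists_max_image (Finset.range N) (fun i : ℕ => v i / s i)
    ⟨i, Finset.mem_range.2 hi⟩
  rw [Finset.mem_range] at hk
  have hle : ∀ j : ℕ, j < N → v j ≤ v k / s k * s j := by
    intro j hj
    have h := hmax j (Finset.mem_range.2 hj)
    rwa [div_le_iff₀ (hcφ.trans_le (hspos j (by omega) (by omega)))] at h
  set q := v k / s k with hq
  have hsk : 0 < s k := hcφ.trans_le (hspos k (by omega) (by omega))
  have hvk : v k = q * s k := by rw [hq]; field_simp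
  have hqb : q ≤ η / (c' * cos φ) := by
    rcases le_or_gt q 0 with hq0 | hq0
    · exact hq0.trans (by positivity)
    have hr : v (k + 1) ≤ q * s (k + 1) := by
      rcases Nat.lt_or_ge (k + 1) N with h | h
      · have := hle (k + 1) h; push_cast at this; exact this
      · have hkN : (k:ℤ) = N - 1 := by omega
        have h2 : v (k + 1) = - v k := by
          simp only [hv, hkN]
          rw [show (N:ℤ) - 1 + 1 = N by ring, refl_N hf he]; ring
        have h3 := hspos (k + 1) (by omega) (by omega)
        rw [h2, hvk]
        have : 0 < q * s k := by positivity
        have : 0 < q * s (k + 1) := mul_pos hq0 (hcφ.trans_le h3)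
        linarith
    have hl : v (k - 1) ≤ q * s (k - 1) := by
      rcases Nat.eq_zero_or_pos k with h | h
      · have h2 : v (k - 1) = - v k := by
          simp only [hv, h]
          have := he 1
          simp only [Nat.cast_zero, zero_sub, zero_add, neg_add_cancel]
          rw [this]; ring
        have h3 := hspos (k - 1) (by omega) (by omega)
        rw [h2, hvk]
        have : 0 < q * s k := by positivity
        have : 0 < q * s (k - 1) := mul_pos hq0 (hcφ.trans_le h3)
        linarith
      · have := hle (k - 1) (by omega)
        rw [Nat.cast_sub h] at this
        simpa using this
    have h1 := hyp k hk
    have h2 : -η ≤ v k + (v (k + 1) - 2 * v k + v (k - 1)) / δ ^ 2 := by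
      have : v k + (v (k + 1) - 2 * v k + v (k - 1)) / δ ^ 2
        = (f (k + 1) + D2 δ f (k + 1)) - (f k + D2 δ f k) := by
        simp only [hv, D2, sub_add_cancel, add_sub_cancel_right]
        ring
      rw [this]; linarith
    have h3 : v (k + 1) - 2 * v k + v (k - 1) ≤ -(1 + c') * δ ^ 2 * (q * s k) := by
      have h4 := hsD k
      have h5 : q * (s (k + 1) + s (k - 1)) = q * (2 * cos (μ * δ) * s k) := by rw [h4]
      have h6 : 0 < q * s k := by positivity
      nlinarith
    have h4 : (v (k + 1) - 2 * v k + v (k - 1)) / δ ^ 2 ≤ -(1 + c') * (q * s k) := by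
      rw [div_le_iff₀ (by positivity)]; linarith
    have h5 : c' * (q * s k) ≤ η := by rw [hvk] at h2; rw [hvk] at h4; linarith
    rw [le_div_iff₀ (by positivity)]
    have h6 := hspos k (by omega) (by omega)
    calc q * (c' * cos φ) = c' * (q * cos φ) := by ring
      _ ≤ c' * (q * s k) := by gcongr
      _ ≤ η := h5
  have h7 := hle i hi
  have hsi := hspos i (by omega) (by omega)
  have h8 : q * s i ≤ η / (c' * cos φ) := by
    rcases le_or_gt q 0 with hq0 | hq0
    · exact (mul_nonpos_of_nonpos_of_nonneg hq0 (hcφ.le.trans hsi)).trans (by positivity)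
    · calc q * s i ≤ q * 1 := by gcongr; exact hs1 _
        _ ≤ _ := by linarith
  have h9 : f (i + 1) - f i ≤ η / (c' * cos φ) := h7.trans h8
  have h10 : 1 / (c' * cos φ) * η = η / (c' * cos φ) := by ring
  linarith

lemma rho_eq {α : ℝ} (v : Env) : ev v (rhoE α) = v.z 0 ^ (-(1/α)) := rfl

lemma rho_pow {α : ℝ} (hα : 0 < α) {v : Env} (h : 0 < v.z 0) : ev v (rhoE α) ^ (-α) = v.z 0 := by
  rw [rho_eq, ← rpow_mul h.le]
  rw [show -(1/α) * -α = 1 by field_simp, rpow_one]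

lemma ev_dt_rho (α : ℝ) (v : Env) : ev v (dt (rhoE α)) = - ev v (RE α 1) := by
  rw [← ev_dt_RE]; simp [RE, gE, dt, ev]

namespace Scheme
variable {α δ : ℝ} {N : ℕ} {a b : ℝ} {e : ℤ → ℝ} {J : Set ℝ} {V : ℤ → ℝ → Env}

lemma mono (S : Scheme α δ N a b e J V) (hα : 0 < α) {t1 : ℝ}
    (hJ : ∀ t, 0 ≤ t → t ≤ t1 → t ∈ J)
    (h0 : ∀ i : ℕ, i < N → (V (i + 1) 0).z 0 ≤ (V i 0).z 0) :
    ∀ i : ℕ, i < N → ∀ t, 0 ≤ t → t ≤ t1 → (V (i + 1) t).z 0 ≤ (V i t).z 0 := by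
  have hneg : -(1/α) < 0 := by have : 0 < 1/α := by positivity
                               linarith
  set r : ℤ → ℝ → ℝ := fun i t => ev (V i t) (rhoE α) with hr
  have hb0 : ∀ t ∈ J, 0 < b := fun t ht => (S.pos 0 ht).trans_le (S.hi 0 t ht)
  have hr1 : ∀ i t, t ∈ J → b ^ (-(1/α)) ≤ r i t := fun i t ht =>
    rpow_le_rpow_of_nonpos (S.pos i ht) (S.hi i t ht) hneg.le
  have hr2 : ∀ i t, t ∈ J → r i t ≤ a ^ (-(1/α)) := fun i t ht =>
    rpow_le_rpow_of_nonpos S.apos (S.lo i t ht) hneg.le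
  intro i hi t ht0 ht1
  have hbpos := hb0 t (hJ t ht0 ht1)
  obtain ⟨K, hK0, hK⟩ := rpow_lip (c := b ^ (-(1/α))) (C := a ^ (-(1/α)))
    (rpow_pos_of_pos hbpos _) (-α)
  set Ct := K + 2 * K / δ ^ 2 + 1 with hCt
  set G : ℤ → ℝ → ℝ := fun i t => (V i t).z 0 - (V (i + 1) t).z 0 with hG
  -- comparison between `G` and the increments of `r`
  have hGlow : ∀ i t E, t ∈ J → 0 ≤ E → -E ≤ r (i + 1) t - r i t → -(K * E) ≤ G i t := by
    intro i t E ht hE h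
    have e1 : (V i t).z 0 = r i t ^ (-α) := (rho_pow hα (S.pos i ht)).symm
    have e2 : (V (i+1) t).z 0 = r (i+1) t ^ (-α) := (rho_pow hα (S.pos (i+1) ht)).symm
    have hKE : 0 ≤ K * E := by positivity
    simp only [hG]
    rcases le_total (r i t) (r (i + 1) t) with h2 | h2
    · have : r (i+1) t ^ (-α) ≤ r i t ^ (-α) :=
        rpow_le_rpow_of_nonpos ((rpow_pos_of_pos hbpos _).trans_le (hr1 i t ht)) h2 (by linarith)
      rw [e1, e2]; linarith
    · have h3 := hK (r i t) (r (i + 1) t) (hr1 i t ht) (hr2 i t ht) (hr1 _ t ht) (hr2 _ t ht)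
      rw [← e1, ← e2] at h3
      have h4 : |r i t - r (i + 1) t| ≤ E := by rw [abs_le]; constructor <;> linarith
      have h5 : K * |r i t - r (i + 1) t| ≤ K * E := by gcongr
      linarith [neg_abs_le ((V i t).z 0 - (V (i + 1) t).z 0)]
  have hGneg : ∀ i t, t ∈ J → r (i + 1) t - r i t ≤ 0 → G i t ≤ 0 := by
    intro i t ht h
    have e1 : (V i t).z 0 = r i t ^ (-α) := (rho_pow hα (S.pos i ht)).symm
    have e2 : (V (i+1) t).z 0 = r (i+1) t ^ (-α) := (rho_pow hα (S.pos (i+1) ht)).symm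
    have : r i t ^ (-α) ≤ r (i+1) t ^ (-α) :=
        rpow_le_rpow_of_nonpos ((rpow_pos_of_pos hbpos _).trans_le (hr1 (i+1) t ht))
          (by linarith) (by linarith)
    simp only [hG]; rw [e1, e2]; linarith
  have main : ∀ ε, 0 < ε → 0 < r (i + 1) t - r i t + ε * exp (Ct * t) := by
    intro ε hε
    refine maxPrin (Finset.range N)
      (v := fun i t => r (i + 1) t - r i t + ε * exp (Ct * t))
      (v' := fun i t => -ev (V (i + 1) t) (RE α 1) + ev (V i t) (RE α 1)
        + Ct * (ε * exp (Ct * t))) (T := t1) ?_ ?_ ?_ i (Finset.mem_range.2 hi) t ht0 ht1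
    · intro k hk s hs0 hs1
      have hsJ := hJ s hs0 hs1
      have d1 := (S.dev (k + 1) hsJ (rhoE α)).sub (S.dev k hsJ (rhoE α))
      have d2 : HasDerivAt (fun s => ε * exp (Ct * s)) (ε * (exp (Ct * s) * Ct)) s := by
        have : HasDerivAt (fun s => Ct * s) Ct s := by
          simpa using (hasDerivAt_id s).const_mul Ct
        exact this.exp.const_mul ε
      refine (d1.add d2).congr_deriv ?_
      rw [ev_dt_rho, ev_dt_rho]; ring
    · intro k hk
      have h1 := h0 k (Finset.mem_range.1 hk)
      have h2 : r k 0 ≤ r (k + 1) 0 :=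
        rpow_le_rpow_of_nonpos (S.pos _ (hJ 0 le_rfl (ht0.trans ht1))) h1 hneg.le
      have : 0 < ε * exp (Ct * 0) := by positivity
      linarith
    · intro k hk s hs0 hs1 hv hall
      have hsJ := hJ s hs0.le hs1
      rw [Finset.mem_range] at hk
      set E := ε * exp (Ct * s) with hE
      have hE0 : 0 < E := by positivity
      have hGk := hGlow k s E hsJ hE0.le (by linarith)
      have hGk' := hGneg k s hsJ (by linarith)
      have hrt : -(K * E) ≤ G (k + 1) s := by
        rcases Nat.lt_or_ge (k + 1) N with h | h
        · have := hall (k + 1) (Finset.mem_range.2 h)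
          push_cast at this
          exact hGlow _ s E hsJ hE0.le (by linarith)
        · have hkN : (k:ℤ) = N - 1 := by omega
          have h2 : G (k + 1) s = - G k s := by
            have := refl_N (S.perz s 0) (S.evnz s 0)
            simp only [hG, hkN]
            rw [show (N:ℤ) - 1 + 1 = N by ring, this]; ring
          have : 0 ≤ K * E := by positivity
          linarith
      have hlt : -(K * E) ≤ G (k - 1) s := by
        rcases Nat.eq_zero_or_pos k with h | h
        · have h2 : G (k - 1) s = - G k s := by
            have := S.evz 1 s 0
            simp only [hG, h]
            simp only [Nat.cast_zero, zero_sub, zero_add, neg_add_cancel]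
            rw [this]; ring
          have : 0 ≤ K * E := by positivity
          linarith
        · have := hall (k - 1) (Finset.mem_range.2 (by omega))
          rw [Nat.cast_sub h] at this
          simp only [Nat.cast_one, sub_add_cancel] at this
          exact hGlow _ s E hsJ hE0.le (by rw [sub_add_cancel]; linarith)
      have e1 := S.eqRE 0 (k + 1) hsJ
      have e2 := S.eqRE 0 k hsJ
      simp only [zero_add] at e1 e2
      have e3 : -ev (V (k + 1) s) (RE α 1) + ev (V k s) (RE α 1)
          = G k s + (G (k + 1) s - 2 * G k s + G (k - 1) s) / δ ^ 2 := by
        rw [e1, e2, S.lind (k+1), S.lind k]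
        simp only [hG, D2, add_sub_cancel_right, sub_add_cancel]
        ring
      rw [e3]
      have e4 : -(2 * K / δ ^ 2 * E) ≤ (G (k + 1) s - 2 * G k s + G (k - 1) s) / δ ^ 2 := by
        rw [show -(2 * K / δ ^ 2 * E) = (-(2 * K * E)) / δ ^ 2 by ring]
        apply div_le_div_of_nonneg_right _ (by positivity)
        linarith
      have e5 : Ct * E = K * E + 2 * K / δ ^ 2 * E + E := by rw [hCt]; ring
      rw [e5]; linarith
  have hfin : r i t ≤ r (i + 1) t := by
    by_contra hneg'
    push Not at hneg'
    have hx := exp_pos (Ct * t)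
    have := main ((r i t - r (i + 1) t) / exp (Ct * t)) (div_pos (by linarith) hx)
    rw [div_mul_cancel₀ _ hx.ne'] at this
    linarith
  have e1 : (V i t).z 0 = r i t ^ (-α) := (rho_pow hα (S.pos i (hJ t ht0 ht1))).symm
  have e2 : (V (i+1) t).z 0 = r (i+1) t ^ (-α) := (rho_pow hα (S.pos (i+1) (hJ t ht0 ht1))).symm
  rw [e1, e2]
  exact rpow_le_rpow_of_nonpos ((rpow_pos_of_pos hbpos _).trans_le (hr1 i t (hJ t ht0 ht1))) hfin
    (by linarith)

end Scheme
end APF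

namespace APF
namespace Scheme
variable {α δ : ℝ} {N : ℕ} {a b : ℝ} {e : ℤ → ℝ} {J : Set ℝ} {V : ℤ → ℝ → Env}

lemma order (S : Scheme α δ N a b e J V) (hα : 0 < α) (hN : 0 < N) {t1 : ℝ}
    (hJ : ∀ t, 0 ≤ t → t ≤ t1 → t ∈ J)
    (h0 : ∀ i : ℕ, i < N → (V (i + 1) 0).z 0 ≤ (V i 0).z 0) (i : ℤ) {t : ℝ} (ht0 : 0 ≤ t)
    (ht1 : t ≤ t1) : (V N t).z 0 ≤ (V i t).z 0 ∧ (V i t).z 0 ≤ (V 0 t).z 0 := by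
  have hm := S.mono hα hJ h0
  have hch : ∀ i : ℕ, i < N → (fun k : ℤ => (V k t).z 0) (i + 1) ≤ (fun k : ℤ => (V k t).z 0) i :=
    fun i hi => hm i hi t ht0 ht1
  have := fold hN (S.perz t 0) (S.evnz t 0) i
  rw [this]
  have h2 := chain_anti (f := fun k : ℤ => (V k t).z 0) hch (Nat.zero_le _) (rf_le N i)
  exact ⟨chain_anti (f := fun k : ℤ => (V k t).z 0) hch (rf_le N i) le_rfl, h2⟩

lemma av_pos (hδ : 0 < δ) (hN : 0 < N) {f : ℤ → ℝ} (h : ∀ i, 0 < f i) : 0 < av δ N f := by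
  unfold av
  apply mul_pos hδ
  apply Finset.sum_pos (f := fun i : ℕ => f (i:ℤ)) (fun i _ => h (i:ℤ))
  exact ⟨0, Finset.mem_range.2 (by omega)⟩

lemma orderl (S : Scheme α δ N a b e J V) (hα : 0 < α) (hN : 0 < N) (hδ : 0 < δ) {t1 : ℝ}
    (hJ : ∀ t, 0 ≤ t → t ≤ t1 → t ∈ J)
    (h0 : ∀ i : ℕ, i < N → (V (i + 1) 0).z 0 ≤ (V i 0).z 0) (i : ℤ) {t : ℝ} (ht0 : 0 ≤ t)
    (ht1 : t ≤ t1) : (V N t).z 0 ≤ (V i t).l 0 ∧ (V i t).l 0 ≤ (V 0 t).z 0 := by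
  have hor := fun i => S.order hα hN hJ h0 i ht0 ht1
  have hs := S.sum t (hJ t ht0 ht1)
  have hrp : ∀ i, 0 < ev (V i t) (rhoE α) := fun i => rpow_pos_of_pos (S.pos i (hJ t ht0 ht1)) _
  rw [S.lind i]
  constructor
  · by_contra hneg
    push Not at hneg
    have : 0 < av δ N (fun i => ev (V i t) (TE α 0)) := by
      apply av_pos hδ hN
      intro i
      have h1 : ev (V i t) (TE α 0) = ev (V i t) (rhoE α) * ((V i t).z 0 - (V 0 t).l 0) := by
        simp only [TE, GG, gE, ev]; rw [S.lind i]; ring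
      rw [h1]
      exact mul_pos (hrp i) (by linarith [(hor i).1])
    linarith
  · by_contra hneg
    push Not at hneg
    have : 0 < av δ N (fun i => (-1) * ev (V i t) (TE α 0)) := by
      apply av_pos hδ hN
      intro i
      have h1 : (-1) * ev (V i t) (TE α 0) = ev (V i t) (rhoE α) * ((V 0 t).l 0 - (V i t).z 0) := by
        simp only [TE, GG, gE, ev]; rw [S.lind i]; ring
      rw [h1]
      exact mul_pos (hrp i) (by linarith [(hor i).2])
    rw [av_mul] at this
    linarith

lemma apriori (S : Scheme α δ N a b e J V) (hα : 0 < α) (hN : 0 < N) (hδ : 0 < δ) {t1 : ℝ}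
    (hJ : ∀ t, 0 ≤ t → t ≤ t1 → t ∈ J)
    (h0 : ∀ i : ℕ, i < N → (V (i + 1) 0).z 0 ≤ (V i 0).z 0)
    {K η ε M0 R0 B : ℝ} (hK : 0 ≤ K) (hη : 0 ≤ η)
    (hbar : ∀ f : ℤ → ℝ, Per N f → Evn f → ∀ η, 0 ≤ η →
      (∀ i : ℕ, i < N → f i + D2 δ f i - η ≤ f (i + 1) + D2 δ f (i + 1)) →
      ∀ i : ℕ, i < N → f (i + 1) ≤ f i + K * η)
    (he1 : ∀ i : ℕ, i < N → e i - η ≤ e (i + 1)) (hNK : N * (K * η) ≤ ε)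
    (he : ∀ i, |e i| ≤ ε / 2) (hε : 0 < ε) (hhN : 4 * ε ≤ (V N 0).h) (hh0 : (V 0 0).h ≤ M0)
    (hR0 : D2 δ (fun k => (V k 0).h) N - e N ≤ R0)
    (hB0 : 0 < B) (hB1 : ∀ i, (V i 0).z 0 < B * ((V i 0).h - ε))
    (hB2 : α + 1 < α * ε / 2 * (B * ε) ^ (1 / α)) (i : ℤ) {t : ℝ} (ht0 : 0 ≤ t) (ht1 : t ≤ t1) :
    (M0 + ε + R0) ^ (-α) ≤ (V i t).z 0 ∧ (V i t).z 0 ≤ B * (M0 + ε) ∧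
      3 * ε ≤ (V i t).h ∧ (V i t).h ≤ M0 + ε := by
  have hor := fun i {t} ht0 ht1 => S.order hα hN hJ h0 i (t := t) ht0 ht1
  have horl := fun i {t} ht0 ht1 => S.orderl hα hN hδ hJ h0 i (t := t) ht0 ht1
  have hrp : ∀ i {t}, 0 ≤ t → t ≤ t1 → 0 < ev (V i t) (rhoE α) :=
    fun i {t} ht0 ht1 => rpow_pos_of_pos (S.pos i (hJ t ht0 ht1)) _
  have hneg : -(1/α) ≤ 0 := by have : 0 < 1/α := by positivity
                               linarith
  -- heights at the two symmetry axes
  have hh0t : ∀ {t}, 0 ≤ t → t ≤ t1 → (V 0 t).h ≤ M0 := by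
    intro t ht0 ht1
    refine le_trans ?_ hh0
    exact anti_of_deriv (fun s hs0 hs1 => S.dh 0 s (hJ s hs0 hs1))
      (fun s hs0 hs1 => by linarith [(horl 0 hs0 hs1).2]) le_rfl ht0 ht1
  have hhNt : ∀ {t}, 0 ≤ t → t ≤ t1 → 4 * ε ≤ (V N t).h := by
    intro t ht0 ht1
    refine le_trans hhN ?_
    have := anti_of_deriv (fun s hs0 hs1 => (S.dh N s (hJ s hs0 hs1)).neg)
      (fun s hs0 hs1 => by linarith [(horl N hs0 hs1).1]) le_rfl ht0 ht1
    simp only [Pi.neg_apply] at this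
    linarith
  -- almost monotonicity of the support function
  have hstep : ∀ {t}, 0 ≤ t → t ≤ t1 → ∀ i : ℕ, i < N → (V (i + 1) t).h ≤ (V i t).h + K * η := by
    intro t ht0 ht1
    refine hbar (fun k => (V k t).h) (S.perh t) (S.evnh t) η hη ?_
    intro i hi
    have htJ := hJ t ht0 ht1
    have h1 := S.rel i t htJ
    have h2 := S.rel (i + 1) t htJ
    have h3 : ev (V i t) (rhoE α) ≤ ev (V (i + 1) t) (rhoE α) :=
      rpow_le_rpow_of_nonpos (S.pos _ htJ) (S.mono hα hJ h0 i hi t ht0 ht1) hneg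
    have h4 := he1 i hi
    linarith
  have hKη : 0 ≤ K * η := by positivity
  have hlow : ∀ i {t}, 0 ≤ t → t ≤ t1 → 3 * ε ≤ (V i t).h := by
    intro i t ht0 ht1
    have h1 := fold hN (S.perh t) (S.evnh t) i
    have h2 := chain_add (f := fun k => (V k t).h) hKη (hstep ht0 ht1) (rf_le N i) le_rfl
    rw [h1]
    linarith [hhNt ht0 ht1]
  have hup : ∀ i {t}, 0 ≤ t → t ≤ t1 → (V i t).h ≤ M0 + ε := by
    intro i t ht0 ht1
    have h1 := fold hN (S.perh t) (S.evnh t) i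
    have h2 := chain_add (f := fun k => (V k t).h) hKη (hstep ht0 ht1) (Nat.zero_le _) (rf_le N i)
    simp only [Nat.cast_zero] at h2
    rw [h1]
    linarith [hh0t ht0 ht1]
  -- upper bound of the curvature radius
  have hD2N : D2 δ (fun k => (V k t).h) N - e N ≤ R0 := by
    refine le_trans ?_ hR0
    have := anti_of_deriv (f := fun s => D2 δ (fun k => (V k s).h) N)
      (fun s hs0 hs1 => dD2 (f := fun k s => (V k s).h)
        (f' := fun k s => (V k s).l 0 - (V k s).z 0) (fun k => S.dh k s (hJ s hs0 hs1)) N)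
      (fun s hs0 hs1 => by
        have h1 := (hor (N + 1) hs0 hs1).1
        have h2 := (hor (N - 1) hs0 hs1).1
        simp only [D2]
        rw [S.lind (N + 1), S.lind (N - 1), S.lind N]
        apply div_nonpos_of_nonpos_of_nonneg _ (by positivity)
        linarith) le_rfl ht0 ht1
    linarith
  have hrN : ev (V N t) (rhoE α) ≤ M0 + ε + R0 := by
    rw [S.rel N t (hJ t ht0 ht1)]
    linarith [hup N ht0 ht1]
  refine ⟨?_, ?_, hlow i ht0 ht1, hup i ht0 ht1⟩
  · refine le_trans ?_ (hor i ht0 ht1).1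
    rw [← rho_pow hα (S.pos N (hJ t ht0 ht1))]
    exact rpow_le_rpow_of_nonpos (hrp N ht0 ht1) hrN (by linarith)
  · -- Tso's estimate
    have hv := maxPrin (Finset.range (N + 1))
      (v := fun i t => B * ((V i t).h - ε) - (V i t).z 0)
      (v' := fun i t => B * ((V i t).l 0 - (V i t).z 0) - (V i t).z 1) (T := t1) ?_ ?_ ?_
    · have h1 := fold hN (S.perz t 0) (S.evnz t 0) i
      have h2 := hv (rf N i) (Finset.mem_range.2 (by have := rf_le N i; omega)) t ht0 ht1
      rw [h1]
      have h3 := hup (rf N i) ht0 ht1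
      have h4 : B * ((V (rf N i) t).h - ε) ≤ B * (M0 + ε) := by gcongr; linarith
      linarith
    · intro k _ s hs0 hs1
      exact (((S.dh k s (hJ s hs0 hs1)).sub_const ε).const_mul B).sub (S.dz k s (hJ s hs0 hs1) 0)
    · intro k _
      linarith [hB1 k]
    · intro k hk s hs0 hs1 hz hall
      have hsJ := hJ s hs0.le hs1
      have hallZ : ∀ l : ℤ, (V l s).z 0 ≤ B * ((V l s).h - ε) := by
        intro l
        have h1 := fold hN (S.perz s 0) (S.evnz s 0) l
        have h2 := fold hN (S.perh s) (S.evnh s) l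
        rw [h1, h2]
        have := hall (rf N l) (Finset.mem_range.2 (by have := rf_le N l; omega))
        linarith
      set F := (V k s).z 0 with hF
      set ρ := ev (V k s) (rhoE α) with hρ
      have hFp : 0 < F := S.pos k hsJ
      have hρp : 0 < ρ := hrp k hs0.le hs1
      have e1 := S.eqRE 0 k hsJ
      have e2 : ev (V k s) (RE α (0 + 1)) = (1/α) * (ρ / F) * (V k s).z 1 := by
        simp only [RE, g1, EE, ev, zero_add, hρ, rhoE]
        rw [rpow_sub_one hFp.ne']; ring
      rw [e2] at e1
      have hD : D2 δ (fun k => (V k s).z 0) k ≤ B * (ρ - (V k s).h + e k) := by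
        have e3 := S.rel k s hsJ
        have e4 : ρ - (V k s).h + e k = D2 δ (fun k => (V k s).h) k := by rw [hρ, e3]; ring
        rw [e4]
        simp only [D2]
        rw [mul_div_assoc', div_le_div_iff_of_pos_right (by positivity)]
        have a1 := hallZ (k + 1)
        have a2 := hallZ (k - 1)
        linarith
      have hlam : 0 < (V k s).l 0 := (S.pos N hsJ).trans_le (horl k hs0.le hs1).1
      have hz1 : (V k s).z 1 = α * (F / ρ) * (D2 δ (fun k => (V k s).z 0) k + F - (V k s).l 0) := by
        rw [← e1]; field_simp
      have hek := (abs_le.1 (he k)).1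
      have hek2 := (abs_le.1 (he k)).2
      have hFB : F = B * ((V k s).h - ε) := by linarith
      have hin : D2 δ (fun k => (V k s).z 0) k + F - (V k s).l 0 ≤ B * (ρ - ε / 2) := by
        have : B * (ρ - (V k s).h + e k) ≤ B * (ρ - (V k s).h + ε / 2) := by gcongr
        nlinarith
      have hz1' : (V k s).z 1 ≤ α * (F / ρ) * (B * (ρ - ε / 2)) := by
        rw [hz1]; gcongr
      have hFlow : B * ε ≤ F := by
        rw [hFB]
        have := hlow k hs0.le hs1
        gcongr; linarith
      have hρinv : (B * ε) ^ (1/α) ≤ 1 / ρ := by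
        have : 1 / ρ = F ^ (1/α) := by
          rw [hρ, rho_eq, rpow_neg hFp.le]; simp
        rw [this]
        exact rpow_le_rpow (by positivity) hFlow (by positivity)
      have hkey : α + 1 < α * ε / 2 * (1 / ρ) := by
        refine hB2.trans_le ?_
        gcongr
      have e6 : α * (F / ρ) * (B * (ρ - ε / 2)) = B * F * (α - α * ε / 2 * (1 / ρ)) := by
        field_simp
      have hBF : 0 < B * F := by positivity
      have e7 : B * F * (α - α * ε / 2 * (1 / ρ)) < B * F * (-1) := by
        apply mul_lt_mul_of_pos_left _ hBF; linarith
      have e8 : 0 < B * (V k s).l 0 := by positivity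
      nlinarith

end Scheme
end APF

namespace APF

/-- Bounded and globally Lipschitz functions. -/
def BLip {E : Type*} [NormedAddCommGroup E] (f : E → ℝ) : Prop :=
  ∃ K : ℝ, 0 ≤ K ∧ (∀ y, |f y| ≤ K) ∧ ∀ y y', |f y - f y'| ≤ K * ‖y - y'‖

def GLip {E : Type*} [NormedAddCommGroup E] (f : E → ℝ) : Prop :=
  ∃ K : ℝ, 0 ≤ K ∧ ∀ y y', |f y - f y'| ≤ K * ‖y - y'‖

section
variable {E : Type*} [NormedAddCommGroup E] {f g : E → ℝ}

lemma GLip.add (hf : GLip f) (hg : GLip g) : GLip (fun y => f y + g y) := by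
  obtain ⟨K, hK, h⟩ := hf
  obtain ⟨K', hK', h'⟩ := hg
  refine ⟨K + K', by positivity, fun y y' => ?_⟩
  calc _ = |(f y - f y') + (g y - g y')| := by congr 1; ring
    _ ≤ _ := abs_add_le _ _
    _ ≤ _ := add_le_add (h y y') (h' y y')
    _ = _ := by ring

lemma GLip.cmul (hf : GLip f) (r : ℝ) : GLip (fun y => r * f y) := by
  obtain ⟨K, hK, h⟩ := hf
  refine ⟨|r| * K, by positivity, fun y y' => ?_⟩
  rw [← mul_sub, abs_mul, mul_assoc]
  gcongr; exact h y y'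

lemma GLip.const (r : ℝ) : GLip (fun _ : E => r) := ⟨0, le_rfl, fun y y' => by simp⟩

lemma BLip.add (hf : BLip f) (hg : BLip g) : BLip (fun y => f y + g y) := by
  obtain ⟨K, hK, h1, h⟩ := hf
  obtain ⟨K', hK', h1', h'⟩ := hg
  refine ⟨K + K', by positivity, fun y => (abs_add_le _ _).trans (add_le_add (h1 y) (h1' y)),
    fun y y' => ?_⟩
  calc _ = |(f y - f y') + (g y - g y')| := by congr 1; ring
    _ ≤ _ := abs_add_le _ _
    _ ≤ _ := add_le_add (h y y') (h' y y')
    _ = _ := by ring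

lemma BLip.mul (hf : BLip f) (hg : BLip g) : BLip (fun y => f y * g y) := by
  obtain ⟨K, hK, h1, h⟩ := hf
  obtain ⟨K', hK', h1', h'⟩ := hg
  refine ⟨2 * (K * K'), by positivity, fun y => ?_, fun y y' => ?_⟩
  · rw [abs_mul]
    have := mul_le_mul (h1 y) (h1' y) (abs_nonneg _) hK
    have : 0 ≤ K * K' := by positivity
    linarith
  · calc _ = |(f y - f y') * g y + f y' * (g y - g y')| := by congr 1; ring
      _ ≤ _ := abs_add_le _ _
      _ ≤ (K * ‖y - y'‖) * K' + K * (K' * ‖y - y'‖) := by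
        rw [abs_mul, abs_mul]
        exact add_le_add (mul_le_mul (h y y') (h1' y) (abs_nonneg _) (by positivity))
          (mul_le_mul (h1 y') (h' y y') (abs_nonneg _) hK)
      _ = _ := by ring

lemma BLip.const (r : ℝ) : BLip (fun _ : E => r) :=
  ⟨|r|, abs_nonneg _, fun y => le_rfl, fun y y' => by simp; positivity⟩

lemma BLip.sum {ι : Type*} (s : Finset ι) {f : ι → E → ℝ} (hf : ∀ i, BLip (f i)) :
    BLip (fun y => ∑ i ∈ s, f i y) := by
  classical
  induction s using Finset.induction_on with
  | empty => simpa using BLip.const (E := E) 0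
  | insert a s ha ih => simp only [Finset.sum_insert ha]; exact (hf a).add ih

/-- Composition with a power on a compact range. -/
lemma BLip.pow {c C : ℝ} (hc : 0 < c) (hf : BLip f) (h1 : ∀ y, c ≤ f y) (h2 : ∀ y, f y ≤ C)
    (s : ℝ) : BLip (fun y => f y ^ s) := by
  obtain ⟨K, hK, h3, h⟩ := hf
  obtain ⟨A, hA, hA'⟩ := rpow_bd (C := C) hc s
  obtain ⟨B, hB, hB'⟩ := rpow_lip (C := C) hc s
  refine ⟨A + B * K, by positivity, fun y => ?_, fun y y' => ?_⟩
  · have := hA' _ (h1 y) (h2 y)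
    have : 0 ≤ B * K := by positivity
    linarith
  · have := hB' _ _ (h1 y) (h2 y) (h1 y') (h2 y')
    have h4 : B * |f y - f y'| ≤ B * (K * ‖y - y'‖) := by gcongr; exact h y y'
    have : 0 ≤ A * ‖y - y'‖ := by positivity
    nlinarith
end

/-- Truncation. -/
noncomputable def cl (a b x : ℝ) : ℝ := max a (min x b)

lemma cl_lo (a b x : ℝ) : a ≤ cl a b x := le_max_left _ _
lemma cl_hi {a b : ℝ} (h : a ≤ b) (x : ℝ) : cl a b x ≤ b := max_le h (min_le_right _ _)
lemma cl_id {a b x : ℝ} (h1 : a ≤ x) (h2 : x ≤ b) : cl a b x = x := by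
  rw [cl, min_eq_left h2, max_eq_right h1]

lemma cl_lip (a b x y : ℝ) : |cl a b x - cl a b y| ≤ |x - y| := by
  unfold cl
  calc _ ≤ |min x b - min y b| := by
        have := abs_max_sub_max_le_max a (min x b) a (min y b)
        simpa using this
    _ ≤ |x - y| := by
        have := abs_min_sub_min_le_max x b y b
        simpa using this

lemma GLip.cl {E : Type*} [NormedAddCommGroup E] {f : E → ℝ} (hf : GLip f) {a b : ℝ} (ha : 0 ≤ a)
    (hab : a ≤ b) : BLip (fun y => cl a b (f y)) := by
  obtain ⟨K, hK, h⟩ := hf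
  refine ⟨K + b, by linarith, fun y => ?_, fun y y' => ?_⟩
  · rw [abs_of_nonneg (ha.trans (cl_lo _ _ _))]
    linarith [cl_hi hab (f y)]
  · have h1 := cl_lip a b (f y) (f y')
    have h2 := h y y'
    have : 0 ≤ b * ‖y - y'‖ := mul_nonneg (by linarith) (norm_nonneg _)
    linarith

/-- Radius of curvature of the discrete curve. -/
noncomputable def rr (δ : ℝ) (e : ℤ → ℝ) (f : ℤ → ℝ) (i : ℤ) : ℝ := f i + D2 δ f i - e i

/-- Nonlocal term of the discrete flow. -/
noncomputable def Lam (α : ℝ) (N : ℕ) (r : ℤ → ℝ) : ℝ :=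
  (∑ i ∈ Finset.range (2 * N), r i ^ (-α) * r i) / ∑ i ∈ Finset.range (2 * N), r i

lemma rr_per {δ : ℝ} {N : ℕ} {e f : ℤ → ℝ} (he : Per N e) (hf : Per N f) : Per N (rr δ e f) :=
  fun i => by simp only [rr, hf i, hf.D2 δ i, he i]

lemma rr_evn {δ : ℝ} {e f : ℤ → ℝ} (he : Evn e) (hf : Evn f) : Evn (rr δ e f) :=
  fun i => by simp only [rr, hf i, hf.D2 δ i, he i]

lemma clip_ode {α δ : ℝ} {N : ℕ} (hN : 0 < N) {a b : ℝ} (ha : 0 < a)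
    (hab : a ≤ b) {e h0 : ℤ → ℝ} (he : Per N e) (he' : Evn e) (hh : Per N h0) (hh' : Evn h0)
    {T : ℝ} (hT : 0 < T) :
    ∃ h : ℤ → ℝ → ℝ, (∀ t, Per N (fun i => h i t)) ∧ (∀ t, Evn (fun i => h i t)) ∧
      (∀ i, h i 0 = h0 i) ∧ ∀ t, t ∈ Set.Ioo (-1) T → ∀ i, HasDerivAt (h i)
        (Lam α N (fun k => cl a b (rr δ e (fun l => h l t) k))
          - cl a b (rr δ e (fun l => h l t) i) ^ (-α)) t := by
  let E := Fin (N + 1) → ℝ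
  let ix : ℤ → Fin (N + 1) := fun i => ⟨rf N i, Nat.lt_succ_of_le (rf_le N i)⟩
  let X : E → ℤ → ℝ := fun y i => y (ix i)
  have hXper : ∀ y, Per N (X y) := fun y i => by
    simp only [X, ix, rf_add]
  have hXev : ∀ y, Evn (X y) := fun y i => by
    simp only [X, ix, rf_neg hN]
  have hXlip : ∀ i, GLip (fun y : E => X y i) := fun i =>
    ⟨1, zero_le_one, fun y y' => by
      rw [one_mul]; exact norm_le_pi_norm (y - y') (ix i)⟩
  have hrlip : ∀ i, GLip (fun y : E => rr δ e (X y) i) := by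
    intro i
    have h1 := ((hXlip i).add (((hXlip (i + 1)).add (((hXlip i).cmul (-2)).add
      (hXlip (i - 1)))).cmul (1 / δ ^ 2))).add (GLip.const (- e i))
    convert h1 using 2 with y
    simp only [rr, D2]; ring
  let r : E → ℤ → ℝ := fun y i => cl a b (rr δ e (X y) i)
  have hr : ∀ i, BLip (fun y : E => r y i) := fun i => (hrlip i).cl ha.le hab
  have hrp : ∀ i, BLip (fun y : E => r y i ^ (-α)) := fun i =>
    (hr i).pow ha (fun y => cl_lo _ _ _) (fun y => cl_hi hab _) (-α)
  have hb : 0 < b := ha.trans_le hab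
  have hcard : (0:ℝ) < 2 * N := by have : (0:ℝ) < N := by exact_mod_cast hN
                                   positivity
  have hLam : BLip (fun y : E => Lam α N (r y)) := by
    have h1 : BLip (fun y : E => ∑ i ∈ Finset.range (2 * N), r y i) :=
      BLip.sum _ (f := fun (i : ℕ) (y : E) => r y i) fun i => hr i
    have h2 : BLip (fun y : E => ∑ i ∈ Finset.range (2 * N), r y i ^ (-α) * r y i) :=
      BLip.sum _ (f := fun (i : ℕ) (y : E) => r y i ^ (-α) * r y i) fun i => (hrp i).mul (hr i)
    have h3 := h1.pow (c := 2 * N * a) (C := 2 * N * b) (by positivity)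
      (fun y => by
        have := Finset.card_nsmul_le_sum (Finset.range (2 * N)) (fun i : ℕ => r y i) a
          (fun i _ => cl_lo _ _ _)
        simpa using this)
      (fun y => by
        have := Finset.sum_le_card_nsmul (Finset.range (2 * N)) (fun i : ℕ => r y i) b
          (fun i _ => cl_hi hab _)
        simpa using this) (-1)
    have h4 := h2.mul h3
    simp only [rpow_neg_one] at h4
    exact h4
  let vf : E → E := fun y k => Lam α N (r y) - r y (k : ℕ) ^ (-α)
  have hvf : ∀ k : Fin (N + 1), BLip (fun y : E => vf y k) := by
    intro k
    have := hLam.add ((BLip.const (E := E) (-1)).mul (hrp ((k : ℕ) : ℤ)))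
    convert this using 2 with y
    simp only [vf]; ring
  choose K hK0 hKb hKl using hvf
  obtain ⟨M, hM⟩ : ∃ M : ℝ, ∀ k, K k ≤ M := by
    obtain ⟨M, hM⟩ := (Set.finite_range K).bddAbove
    exact ⟨M, fun k => hM ⟨k, rfl⟩⟩
  have hM0 : 0 ≤ M := (hK0 0).trans (hM 0)
  let y0 : E := fun k => h0 (k : ℕ)
  have hPL : IsPicardLindelof (fun _ : ℝ => vf) (tmin := -1) (tmax := T) ⟨0, by simp, hT.le⟩ y0
      (⟨M * (T + 1), by positivity⟩) 0 ⟨M, hM0⟩ ⟨M, hM0⟩ := by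
    apply IsPicardLindelof.of_time_independent
    · intro y _
      rw [pi_norm_le_iff_of_nonneg (by exact hM0)]
      exact fun k => (hKb k y).trans (hM k)
    · apply LipschitzWith.lipschitzOnWith
      apply LipschitzWith.of_dist_le_mul
      intro y y'
      rw [dist_eq_norm, dist_eq_norm, pi_norm_le_iff_of_nonneg (by positivity)]
      intro k
      exact (hKl k y y').trans (mul_le_mul_of_nonneg_right (hM k) (norm_nonneg _))
    · simp only [NNReal.coe_mk, NNReal.coe_zero, sub_zero, zero_sub, neg_neg]
      exact mul_le_mul_of_nonneg_left (max_le (by linarith) (by linarith)) hM0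
  obtain ⟨y, hy0, hy⟩ := hPL.exists_eq_forall_mem_Icc_hasDerivWithinAt₀
  refine ⟨fun i t => X (y t) i, fun t => hXper _, fun t => hXev _, fun i => ?_, fun t ht i => ?_⟩
  · simp only [X]
    rw [show y 0 = y0 from hy0, fold hN hh hh' i]
  · have h1 := hy t ⟨ht.1.le, ht.2.le⟩
    have h2 : HasDerivAt y (vf (y t)) t := h1.hasDerivAt (Icc_mem_nhds ht.1 ht.2)
    have h3 := (hasDerivAt_pi.1 h2) (ix i)
    have h4 : vf (y t) (ix i) = Lam α N (fun k => cl a b (rr δ e (fun l => X (y t) l) k))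
          - cl a b (rr δ e (fun l => X (y t) l) i) ^ (-α) := by
      simp only [vf, r]
      rw [show ((ix i : ℕ) : ℤ) = ((rf N i : ℕ) : ℤ) from rfl,
        ← fold hN (rr_per he (hXper (y t))) (rr_evn he' (hXev (y t))) i]
    rw [← h4]
    exact h3

end APF

namespace APF

lemma hasDerivAt_iter {f : ℝ → ℝ} {J : Set ℝ} (hJ : IsOpen J) (hf : ∀ n : ℕ, ContDiffOn ℝ n f J)
    (j : ℕ) {t : ℝ} (ht : t ∈ J) :
    HasDerivAt (iteratedDeriv j f) (iteratedDeriv (j + 1) f t) t := by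
  have key : ∀ j, ∀ n : ℕ, ContDiffOn ℝ n (iteratedDeriv j f) J := by
    intro j
    induction j with
    | zero => simpa using hf
    | succ j ih =>
      intro n
      rw [iteratedDeriv_succ]
      have := (contDiffOn_succ_iff_deriv_of_isOpen hJ (n := n)).1 (by exact_mod_cast ih (n + 1))
      exact this.2.2
  rw [iteratedDeriv_succ]
  have h1 := (key j 1).differentiableOn (by simp)
  exact (h1.differentiableAt (hJ.mem_nhds ht)).hasDerivAt

lemma exists_scheme {α δ : ℝ} {N : ℕ} (hα : 0 < α) (hN : 0 < N) {a b : ℝ} (ha : 0 < a)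
    (hab : a < b) {e h0 : ℤ → ℝ} (he : Per N e) (he' : Evn e) (hh : Per N h0) (hh' : Evn h0)
    {T : ℝ} (hT : 0 < T)
    (hr0 : ∀ i, b ^ (-(1/α)) < rr δ e h0 i ∧ rr δ e h0 i < a ^ (-(1/α))) :
    ∃ (J : Set ℝ) (V : ℤ → ℝ → Env), Scheme α δ N a b e J V ∧ (∀ i, (V i 0).h = h0 i) ∧
      (∀ i, (V i 0).z 0 = rr δ e h0 i ^ (-α)) ∧
      ∀ a' b' : ℝ, a < a' → b' < b → (∀ t1, 0 ≤ t1 → (∀ t, 0 ≤ t → t ≤ t1 → t ∈ J) → ∀ i,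
        a' ≤ (V i t1).z 0 ∧ (V i t1).z 0 ≤ b') → ∀ t, 0 ≤ t → t < T → t ∈ J := by
  have hb : 0 < b := ha.trans hab
  have hiα : 0 < 1 / α := by positivity
  set ra := b ^ (-(1/α)) with hra
  set rb := a ^ (-(1/α)) with hrb
  have hra0 : 0 < ra := rpow_pos_of_pos hb _
  have hrab : ra ≤ rb := rpow_le_rpow_of_nonpos ha hab.le (by linarith)
  obtain ⟨h, hper, hev, h_start, hode⟩ := clip_ode (α := α) (δ := δ) hN hra0 hrab he he' hh hh' hT
  set r : ℤ → ℝ → ℝ := fun i t => rr δ e (fun l => h l t) i with hr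
  have hrper : ∀ i t, r (i + 2 * N) t = r i t := fun i t => rr_per he (hper t) i
  have hrev : ∀ i t, r (-i) t = r i t := fun i t => rr_evn he' (hev t) i
  have hrfold : ∀ i t, r i t = r (rf N i) t := fun i t =>
    fold hN (rr_per he (hper t)) (rr_evn he' (hev t)) i
  have hcont : ∀ i t, t ∈ Set.Ioo (-1) T → ContinuousAt (r i) t := by
    intro i t ht
    have h1 := fun i => (hode t ht i).continuousAt
    simp only [hr, rr, D2]
    exact ((h1 i).add ((((h1 (i + 1)).sub ((h1 i).const_mul 2)).add (h1 (i - 1))).div_const _)).sub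
      continuousAt_const
  set J : Set ℝ := {t | t ∈ Set.Ioo (-1) T ∧ ∀ i, ra < r i t ∧ r i t < rb} with hJ
  have hJo : IsOpen J := by
    rw [isOpen_iff_mem_nhds]
    rintro t ⟨ht, hti⟩
    have h1 : ∀ᶠ s in nhds t, ∀ k ∈ Finset.range (N + 1), ra < r (k : ℕ) s ∧ r (k : ℕ) s < rb := by
      rw [Finset.eventually_all]
      intro k _
      exact ((hcont k t ht).eventually_const_lt (hti k).1).and
        ((hcont k t ht).eventually_lt_const (hti k).2)
    filter_upwards [h1, isOpen_Ioo.mem_nhds ht] with s hs hs2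
    refine ⟨hs2, fun i => ?_⟩
    rw [hrfold i s]
    exact hs _ (Finset.mem_range.2 (Nat.lt_succ_of_le (rf_le N i)))
  set lam : ℝ → ℝ := fun t => Lam α N (fun k => r k t) with hlam
  have hode' : ∀ t ∈ J, ∀ i, HasDerivAt (h i) (lam t - r i t ^ (-α)) t := by
    intro t ht i
    have h1 := hode t ht.1 i
    have h2 : ∀ k, cl ra rb (rr δ e (fun l => h l t) k) = r k t := fun k =>
      cl_id (ht.2 k).1.le (ht.2 k).2.le
    simp only [h2] at h1
    exact h1
  have hrpos : ∀ t ∈ J, ∀ i, 0 < r i t := fun t ht i => hra0.trans (ht.2 i).1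
  have hden : ∀ t ∈ J, 0 < ∑ i ∈ Finset.range (2 * N), r (i : ℕ) t := fun t ht =>
    Finset.sum_pos (fun i _ => hrpos t ht i) ⟨0, by simp; omega⟩
  have rsm : ∀ n : ℕ, (∀ i, ContDiffOn ℝ n (h i) J) → (∀ i, ContDiffOn ℝ n (r i) J) ∧
      (∀ i, ContDiffOn ℝ n (fun t => r i t ^ (-α)) J) ∧ ContDiffOn ℝ n lam J := by
    intro n ih
    have h1 : ∀ i, ContDiffOn ℝ n (r i) J := by
      intro i
      simp only [hr, rr, D2]
      exact ((ih i).add ((((ih (i + 1)).sub (contDiffOn_const.mul (ih i))).add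
        (ih (i - 1))).div_const _)).sub contDiffOn_const
    have h2 : ∀ i, ContDiffOn ℝ n (fun t => r i t ^ (-α)) J := fun i =>
      (h1 i).rpow_const_of_ne (fun t ht => (hrpos t ht i).ne')
    refine ⟨h1, h2, ?_⟩
    simp only [hlam, Lam]
    exact ContDiffOn.div (ContDiffOn.sum fun (i : ℕ) _ => (h2 i).mul (h1 i))
      (ContDiffOn.sum fun (i : ℕ) _ => h1 i) fun t ht => (hden t ht).ne'
  have hsm : ∀ n : ℕ, ∀ i, ContDiffOn ℝ n (h i) J := by
    intro n
    induction n with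
    | zero =>
      intro i
      rw [Nat.cast_zero, contDiffOn_zero]
      exact fun t ht => (hode' t ht i).continuousAt.continuousWithinAt
    | succ n ih =>
      intro i
      obtain ⟨-, h2, h3⟩ := rsm n ih
      push_cast
      rw [contDiffOn_succ_iff_deriv_of_isOpen hJo]
      refine ⟨fun t ht => (hode' t ht i).differentiableAt.differentiableWithinAt, by simp, ?_⟩
      exact (h3.sub (h2 i)).congr fun t ht => (hode' t ht i).deriv
  set F : ℤ → ℝ → ℝ := fun i t => r i t ^ (-α) with hF
  have hFs : ∀ i, ∀ n : ℕ, ContDiffOn ℝ n (F i) J := fun i n => (rsm n (hsm n)).2.1 i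
  have hls : ∀ n : ℕ, ContDiffOn ℝ n lam J := fun n => (rsm n (hsm n)).2.2
  have hFper : ∀ i, F (i + 2 * N) = F i := fun i => by funext t; simp only [hF, hrper]
  have hFev : ∀ i, F (-i) = F i := fun i => by funext t; simp only [hF, hrev]
  have hrho : ∀ t ∈ J, ∀ i, F i t ^ (-(1/α)) = r i t := by
    intro t ht i
    simp only [hF]
    rw [← rpow_mul (hrpos t ht i).le]
    have : -α * -(1/α) = 1 := by field_simp
    rw [this, rpow_one]
  refine ⟨J, fun i t => Env.mk (fun j => iteratedDeriv j (F i) t) (fun j => iteratedDeriv j lam t)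
      (fun j => Dp δ (fun k => iteratedDeriv j (F k) t) i) (h i t) (Dp δ (fun k => h k t) i),
      ?_, ?_, ?_, ?_⟩
  · refine ⟨hJo, ha, ?_, ?_, ?_, ?_, ?_, ?_, ?_, ?_, ?_, ?_, ?_, ?_, ?_⟩
    · intro i t ht
      simp only [iteratedDeriv_zero]
      have h1 := rpow_le_rpow_of_nonpos (hrpos t ht i) (ht.2 i).2.le (by linarith : -α ≤ 0)
      refine le_trans (le_of_eq ?_) h1
      rw [hrb, ← rpow_mul ha.le, show -(1/α) * -α = 1 by field_simp, rpow_one]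
    · intro i t ht
      simp only [iteratedDeriv_zero]
      have h1 := rpow_le_rpow_of_nonpos hra0 (ht.2 i).1.le (by linarith : -α ≤ 0)
      refine le_trans h1 (le_of_eq ?_)
      rw [hra, ← rpow_mul hb.le, show -(1/α) * -α = 1 by field_simp, rpow_one]
    · exact fun i t ht j => hasDerivAt_iter hJo (hFs i) j ht
    · exact fun i t ht j => hasDerivAt_iter hJo hls j ht
    · intro i t ht
      simpa using hode' t ht i
    · intros; rfl
    · intros; rfl
    · intros; rfl
    · intro i t
      have h1 := hper t i
      have h2 := hper t (i + 1)
      simp only at h1 h2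
      have h3 := hFper (i + 1)
      rw [show i + 1 + 2 * (N:ℤ) = i + 2 * N + 1 by ring] at h2 h3
      simp only [hFper i, Dp, h1, h2, h3]
    · intro i t j
      simp only [hFev]
    · exact fun i t => hev t i
    · intro i t ht
      simp only [rhoE, ev, iteratedDeriv_zero, hrho t ht i]
      rfl
    · intro t ht
      simp only [TE, gE, GG, rhoE, ev, iteratedDeriv_zero, hrho t ht, av]
      rw [Finset.sum_add_distrib]
      simp only [mul_assoc]
      rw [← Finset.mul_sum, ← Finset.sum_mul]
      have h1 : lam t = _ / _ := rfl
      rw [h1, mul_div_cancel₀ _ (hden t ht).ne']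
      have : ∀ k : ℤ, F k t * r k t = r k t * F k t := fun k => mul_comm _ _
      simp only [hF] at this ⊢
      simp only [this]
      ring
  · exact h_start
  · intro i
    simp only [iteratedDeriv_zero, hF, hr, h_start]
  · intro a' b' haa hbb H t ht0 htT
    by_contra hcon
    have h0J : (0:ℝ) ∈ J := ⟨⟨by norm_num, hT⟩, fun i => by simpa only [hr, h_start] using hr0 i⟩
    have hcl : IsClosed {s : ℝ | s ∈ Set.Icc 0 t ∧ s ∉ J} := isClosed_Icc.inter hJo.isClosed_compl
    have hcomp := isCompact_Icc.of_isClosed_subset hcl fun s hs => hs.1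
    obtain ⟨τ, hτ, hmin⟩ := hcomp.exists_isLeast ⟨t, ⟨ht0, le_rfl⟩, hcon⟩
    obtain ⟨⟨hτ0, hτt⟩, hτJ⟩ := hτ
    have hτpos : 0 < τ := hτ0.lt_of_ne fun h => hτJ (h ▸ h0J)
    have hbef : ∀ s, 0 ≤ s → s < τ → s ∈ J := by
      intro s hs0 hs
      by_contra hn
      have := hmin (show s ∈ {s : ℝ | s ∈ Set.Icc 0 t ∧ s ∉ J} from ⟨⟨hs0, by linarith⟩, hn⟩)
      linarith
    have ha' : 0 < a' := ha.trans haa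
    have hzz : ∀ s, 0 ≤ s → s < τ → ∀ i, a' ≤ F i s ∧ F i s ≤ b' := by
      intro s hs0 hs i
      have := H s hs0 (fun t h1 h2 => hbef t h1 (by linarith)) i
      simpa only [iteratedDeriv_zero] using this
    have hb' : 0 < b' := by
      have := hzz 0 le_rfl hτpos 0
      linarith [this.1, this.2]
    have hτI : τ ∈ Set.Ioo (-1) T := ⟨by linarith, by linarith⟩
    refine hτJ ⟨hτI, fun i => ?_⟩
    have h1 : ∀ᶠ s in nhdsWithin τ (Set.Iio τ), b' ^ (-(1/α)) ≤ r i s ∧ r i s ≤ a' ^ (-(1/α)) := by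
      filter_upwards [Ioo_mem_nhdsLT hτpos] with s hs
      have h2 := hzz s hs.1.le hs.2 i
      rw [← hrho s (hbef s hs.1.le hs.2) i]
      exact ⟨rpow_le_rpow_of_nonpos (by linarith) h2.2 (by linarith),
        rpow_le_rpow_of_nonpos ha' h2.1 (by linarith)⟩
    have h3 : Tendsto (r i) (nhdsWithin τ (Set.Iio τ)) (nhds (r i τ)) :=
      (hcont i τ hτI).continuousWithinAt
    have h4 := ge_of_tendsto h3 (h1.mono fun _ h => h.1)
    have h5 := le_of_tendsto h3 (h1.mono fun _ h => h.2)
    exact ⟨(rpow_lt_rpow_of_neg hb' hbb (by linarith)).trans_le h4,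
      h5.trans_lt (rpow_lt_rpow_of_neg ha haa (by linarith))⟩

end APF

namespace APF

lemma mvt_pow {g g' : ℝ → ℝ} {A : ℝ} (k : ℕ) {r : ℝ} (h0 : g 0 = 0)
    (hd : ∀ s, HasDerivAt g (g' s) s) (hb : ∀ s, 0 ≤ s → s ≤ r → |g' s| ≤ A * s ^ k) :
    ∀ s, 0 ≤ s → s ≤ r → |g s| ≤ A * s ^ (k + 1) := by
  intro s hs0 hsr
  rcases hs0.eq_or_lt with h | h
  · rw [← h, h0]; simp
  have hA : 0 ≤ A := by
    have := (abs_nonneg _).trans (hb s hs0 hsr)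
    exact nonneg_of_mul_nonneg_left this (by positivity)
  have := Convex.norm_image_sub_le_of_norm_hasDerivWithin_le (f := g) (f' := g') (C := A * s ^ k)
    (s := Set.Icc 0 s) (fun x _ => (hd x).hasDerivWithinAt)
    (fun x hx => (hb x hx.1 (hx.2.trans hsr)).trans
      (mul_le_mul_of_nonneg_left (pow_le_pow_left₀ hx.1 hx.2 k) hA))
    (convex_Icc 0 s) (Set.left_mem_Icc.2 hs0) (Set.right_mem_Icc.2 hs0)
  rw [h0, sub_zero, sub_zero, Real.norm_eq_abs, Real.norm_eq_abs, abs_of_nonneg hs0] at this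
  rw [pow_succ, ← mul_assoc]
  exact this

/-- Symmetric second difference. -/
lemma second_diff {f f1 f2 : ℝ → ℝ} {M : ℝ} (h1 : ∀ x, HasDerivAt f (f1 x) x)
    (h2 : ∀ x, HasDerivAt f1 (f2 x) x) (hM : ∀ x, |f2 x| ≤ M) (x s : ℝ) (hs : 0 ≤ s) :
    |f (x + s) - 2 * f x + f (x - s)| ≤ 2 * M * s ^ 2 := by
  have e1 := mvt_pow (g := fun s => f1 (x + s) - f1 (x - s))
    (g' := fun s => f2 (x + s) + f2 (x - s)) (A := 2 * M) 0 (r := s) (by simp)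
    (fun s => (((h2 (x + s)).comp_const_add x s).sub ((h2 (x - s)).comp_const_sub x s)).congr_deriv
      (by simp))
    (fun s _ _ => by
      have := abs_add_le (f2 (x + s)) (f2 (x - s))
      linarith [hM (x + s), hM (x - s)])
  have e2 := mvt_pow (g := fun s => f (x + s) - 2 * f x + f (x - s))
    (g' := fun s => f1 (x + s) - f1 (x - s)) (A := 2 * M) 1 (r := s) (by simp; ring)
    (fun s => (((((h1 (x + s)).comp_const_add x s)).sub_const (2 * f x)).add
      ((h1 (x - s)).comp_const_sub x s)).congr_deriv (by ring))
    (fun s hs hs' => by simpa using e1 s hs hs')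
  exact e2 s hs le_rfl

lemma second_diff' {f f1 f2 f3 f4 : ℝ → ℝ} {M : ℝ} (h1 : ∀ x, HasDerivAt f (f1 x) x)
    (h2 : ∀ x, HasDerivAt f1 (f2 x) x) (h3 : ∀ x, HasDerivAt f2 (f3 x) x)
    (h4 : ∀ x, HasDerivAt f3 (f4 x) x) (hM : ∀ x, |f4 x| ≤ M) (x s : ℝ) (hs : 0 < s) :
    |(f (x + s) - 2 * f x + f (x - s)) / s ^ 2 - f2 x| ≤ 2 * M * s ^ 2 := by
  have e0 : ∀ r, 0 ≤ r → r ≤ s → |f2 (x + r) - 2 * f2 x + f2 (x - r)| ≤ 2 * M * r ^ 2 :=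
    fun r hr _ => second_diff h3 h4 hM x r hr
  have e1 := mvt_pow (g := fun s => f1 (x + s) - f1 (x - s) - 2 * f2 x * s)
    (g' := fun s => f2 (x + s) - 2 * f2 x + f2 (x - s)) (A := 2 * M) 2 (r := s) (by simp)
    (fun s => ((((h2 (x + s)).comp_const_add x s).sub ((h2 (x - s)).comp_const_sub x s)).sub
      ((hasDerivAt_id s).const_mul (2 * f2 x))).congr_deriv (by ring)) e0
  have e2 := mvt_pow (g := fun s => f (x + s) - 2 * f x + f (x - s) - f2 x * s ^ 2)
    (g' := fun s => f1 (x + s) - f1 (x - s) - 2 * f2 x * s) (A := 2 * M) 3 (r := s)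
    (by simp; ring)
    (fun s => ((((((h1 (x + s)).comp_const_add x s)).sub_const (2 * f x)).add
      ((h1 (x - s)).comp_const_sub x s)).sub
      (((hasDerivAt_id s).pow 2).const_mul (f2 x))).congr_deriv (by simp; ring)) e1
  have e3 := e2 s hs.le le_rfl
  have h5 : (f (x + s) - 2 * f x + f (x - s)) / s ^ 2 - f2 x
      = (f (x + s) - 2 * f x + f (x - s) - f2 x * s ^ 2) / s ^ 2 := by field_simp
  rw [h5, abs_div, abs_of_pos (by positivity : 0 < s ^ 2), div_le_iff₀ (by positivity)]
  calc _ ≤ _ := e3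
    _ = _ := by ring

/-- Admissible initial data. -/
structure Init (L : ℝ) (h0 : ℝ → ℝ) : Prop where
  hL : 0 < L
  hLpi : L < π
  sm : ContDiff ℝ (⊤ : ℕ∞) h0
  per : ∀ x, h0 (x + 2 * L) = h0 x
  evn : ∀ x, h0 (-x) = h0 x
  pos : ∀ x, 0 < h0 x + iteratedDeriv 2 h0 x
  mono : MonotoneOn (fun x => h0 x + iteratedDeriv 2 h0 x) (Set.Icc 0 L)
  anti : AntitoneOn h0 (Set.Icc 0 L)
  posL : 0 < h0 L

lemma smi {h0 : ℝ → ℝ} (sm : ContDiff ℝ (⊤ : ℕ∞) h0) (k : ℕ) :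
    ContDiff ℝ (⊤ : ℕ∞) (iteratedDeriv k h0) := by
  rw [iteratedDeriv_eq_iterate]
  exact ContDiff.iterate_deriv k sm

lemma smd {h0 : ℝ → ℝ} (sm : ContDiff ℝ (⊤ : ℕ∞) h0) (k : ℕ) (x : ℝ) :
    HasDerivAt (iteratedDeriv k h0) (iteratedDeriv (k + 1) h0 x) x := by
  rw [iteratedDeriv_succ]
  exact ((smi sm k).differentiable (by simp) x).hasDerivAt

lemma peri {h0 : ℝ → ℝ} {P : ℝ} (per : ∀ x, h0 (x + P) = h0 x) (k : ℕ) (x : ℝ) :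
    iteratedDeriv k h0 (x + P) = iteratedDeriv k h0 x := by
  have h1 : (fun x => h0 (x + P)) = h0 := funext per
  have h2 := congrFun (iteratedDeriv_comp_add_const k h0 P) x
  rw [h1] at h2
  exact h2.symm

lemma pbd {h0 : ℝ → ℝ} {P : ℝ} (hP : 0 < P) (sm : ContDiff ℝ (⊤ : ℕ∞) h0)
    (per : ∀ x, h0 (x + P) = h0 x) (k : ℕ) : ∃ M, 0 ≤ M ∧ ∀ x, |iteratedDeriv k h0 x| ≤ M := by
  have h1 : Function.Periodic (iteratedDeriv k h0) P := peri per k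
  have h2 := h1.isBounded_of_continuous hP.ne' (smi sm k).continuous
  obtain ⟨M, hM⟩ := h2.exists_norm_le
  exact ⟨M, (norm_nonneg _).trans (hM _ ⟨0, rfl⟩), fun x => hM _ ⟨x, rfl⟩⟩

/-- A discrete solution with `N` intervals that exists up to time `N`. -/
structure Fam (α L a b C : ℝ) (h0 : ℝ → ℝ) (N : ℕ) (e : ℤ → ℝ) (J : Set ℝ) (V : ℤ → ℝ → Env) :
    Prop where
  S : Scheme α (L / N) N a b e J V
  hN : 0 < N
  dom : ∀ t : ℝ, 0 ≤ t → t < N → t ∈ J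
  ih : ∀ i : ℤ, (V i 0).h = h0 (i * (L / N))
  iz : ∀ i : ℤ, (V i 0).z 0
    = (h0 (i * (L / N)) + iteratedDeriv 2 h0 (i * (L / N))) ^ (-α)
  eb : ∀ i, |e i| ≤ C / N
  hb : ∀ i (t : ℝ), 0 ≤ t → t < N → |(V i t).h| ≤ C
  ord : ∀ i (t : ℝ), 0 ≤ t → t < N → (V N t).z 0 ≤ (V i t).z 0 ∧ (V i t).z 0 ≤ (V 0 t).z 0
  ordl : ∀ i (t : ℝ), 0 ≤ t → t < N → (V N t).z 0 ≤ (V i t).l 0 ∧ (V i t).l 0 ≤ (V 0 t).z 0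

lemma exists_fam {α L : ℝ} {h0 : ℝ → ℝ} (hα : 0 < α) (I : Init L h0) : ∃ (a b C : ℝ) (N0 : ℕ),
    0 < a ∧ ∀ N : ℕ, N0 ≤ N → ∃ e J V, Fam α L a b C h0 N e J V := by
  have hL := I.hL
  set ρ : ℝ → ℝ := fun x => h0 x + iteratedDeriv 2 h0 x with hρ
  have hiα : 0 < 1 / α := by positivity
  have hρper : ∀ x, ρ (x + 2 * L) = ρ x := fun x => by
    simp only [hρ, I.per, peri I.per 2 x]
  have hρcont : Continuous ρ := I.sm.continuous.add (smi I.sm 2).continuous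
  have evn2 : ∀ x, iteratedDeriv 2 h0 (-x) = iteratedDeriv 2 h0 x := by
    intro x
    have h1 := iteratedDeriv_comp_neg 2 h0 x
    have h2 : (fun x => h0 (-x)) = h0 := funext I.evn
    rw [h2] at h1
    simpa using h1.symm
  have hρevn : ∀ x, ρ (-x) = ρ x := fun x => by simp only [hρ, I.evn, evn2]
  -- reduction to the fundamental domain
  have red : ∀ x, ∃ y ∈ Set.Icc 0 L, h0 x = h0 y ∧ ρ x = ρ y := by
    intro x
    obtain ⟨k, hk⟩ : ∃ k : ℤ, -L ≤ x + k * (2 * L) ∧ x + k * (2 * L) ≤ L := by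
      obtain ⟨k, hk, -⟩ := existsUnique_add_zsmul_mem_Ico (by positivity : 0 < 2 * L) x (-L)
      refine ⟨k, ?_⟩
      simp only [zsmul_eq_mul, Set.mem_Ico] at hk
      exact ⟨hk.1, by linarith [hk.2]⟩
    have e1 : h0 (x + k * (2 * L)) = h0 x := by
      have := (show Function.Periodic h0 (2 * L) from I.per).int_mul k x
      simpa using this
    have e2 : ρ (x + k * (2 * L)) = ρ x := by
      have := (show Function.Periodic ρ (2 * L) from hρper).int_mul k x
      simpa using this
    rcases le_total 0 (x + k * (2 * L)) with h | h
    · exact ⟨_, ⟨h, hk.2⟩, e1.symm, e2.symm⟩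
    · exact ⟨-(x + k * (2 * L)), ⟨by linarith, by linarith [hk.1]⟩, by rw [I.evn, e1],
        by rw [hρevn, e2]⟩
  have h0le : ∀ x, h0 x ≤ h0 0 := fun x => by
    obtain ⟨y, hy, h1, -⟩ := red x
    rw [h1]; exact I.anti (Set.left_mem_Icc.2 hL.le) hy hy.1
  have h0ge : ∀ x, h0 L ≤ h0 x := fun x => by
    obtain ⟨y, hy, h1, -⟩ := red x
    rw [h1]; exact I.anti hy (Set.right_mem_Icc.2 hL.le) hy.2
  have ρle : ∀ x, ρ x ≤ ρ L := fun x => by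
    obtain ⟨y, hy, -, h1⟩ := red x
    rw [h1]; exact I.mono hy (Set.right_mem_Icc.2 hL.le) hy.2
  have ρge : ∀ x, ρ 0 ≤ ρ x := fun x => by
    obtain ⟨y, hy, -, h1⟩ := red x
    rw [h1]; exact I.mono (Set.left_mem_Icc.2 hL.le) hy hy.1
  have ρ0pos : 0 < ρ 0 := I.pos 0
  obtain ⟨M, hM0, hM⟩ := pbd (by positivity : 0 < 2 * L) I.sm I.per 4
  obtain ⟨K, δ0, hK, hδ0, hbar⟩ := barrier hL I.hLpi
  set ε := h0 L / 4 with hε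
  have hεp : 0 < ε := by have := I.posL; positivity
  set M0 := h0 0 with hM0'
  have hM0ge : h0 L ≤ M0 := h0le L
  set R0 := iteratedDeriv 2 h0 L with hR0'
  have hRL : ρ L = h0 L + R0 := rfl
  obtain ⟨B, hBp, hB1, hB2⟩ : ∃ B : ℝ, 0 < B ∧ (ρ 0) ^ (-α) < B * (3 * ε) ∧
      α + 1 < α * ε / 2 * (B * ε) ^ (1 / α) := by
    have t1 : Tendsto (fun B : ℝ => B * (3 * ε)) atTop atTop :=
      tendsto_id.atTop_mul_const (by positivity)
    have t2 : Tendsto (fun B : ℝ => α * ε / 2 * (B * ε) ^ (1 / α)) atTop atTop :=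
      ((tendsto_rpow_atTop hiα).comp (tendsto_id.atTop_mul_const hεp)).const_mul_atTop
        (by positivity)
    exact ((eventually_gt_atTop 0).and ((t1.eventually_gt_atTop _).and
      (t2.eventually_gt_atTop _))).exists
  set cL := (M0 + ε + R0) ^ (-α) with hcL
  set cU := B * (M0 + ε) with hcU
  have hMpos : 0 < M0 := by have := I.posL; linarith
  have hsum : ρ L < M0 + ε + R0 := by linarith
  have hsum0 : 0 < M0 + ε + R0 := by linarith [ρge L]
  have hcLp : 0 < cL := rpow_pos_of_pos hsum0 _
  have hcUp : 0 < cU := by positivity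
  have hFle : ∀ x, ρ x ^ (-α) ≤ ρ 0 ^ (-α) := fun x =>
    rpow_le_rpow_of_nonpos ρ0pos (ρge x) (by linarith)
  have hFB : ∀ x, ρ x ^ (-α) < B * (h0 x - ε) := fun x => by
    refine (hFle x).trans_lt (hB1.trans_le ?_)
    apply mul_le_mul_of_nonneg_left _ hBp.le
    have := h0ge x
    linarith
  have hFcU : ∀ x, ρ x ^ (-α) < cU := fun x => (hFB x).trans_le
    (mul_le_mul_of_nonneg_left (by linarith [h0le x]) hBp.le)
  have hcLF : ∀ x, cL < ρ x ^ (-α) := fun x => rpow_lt_rpow_of_neg (by linarith [ρge x])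
    (by linarith [ρle x]) (by linarith)
  have hab : cL < cU := (hcLF 0).trans (hFcU 0)
  -- largeness of `N`
  have hten : ∀ A : ℝ, Tendsto (fun N : ℕ => A * (L / N)) atTop (nhds 0) := fun A => by
    have := (tendsto_const_div_atTop_nhds_zero_nat L).const_mul A
    simpa using this
  obtain ⟨N0, hN0⟩ : ∃ N0 : ℕ, ∀ N : ℕ, N0 ≤ N → 0 < N ∧ 1 * (L / N) ≤ δ0 ∧ 1 * (L / N) ≤ 1 ∧
      2 * M * (L / N) ≤ ε / 2 ∧ K * (4 * M) * L * (L / N) ≤ ε := by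
    refine eventually_atTop.1 ?_
    exact (eventually_gt_atTop 0).and (((hten _).eventually_le_const hδ0).and
      (((hten _).eventually_le_const one_pos).and (((hten _).eventually_le_const (by positivity)).and
      ((hten _).eventually_le_const hεp))))
  refine ⟨cL / 2, 2 * cU, 2 * M * L + (M0 + ε), N0, by positivity, fun N hNN => ?_⟩
  obtain ⟨hN, hd1, hd2, hd3, hd4⟩ := hN0 N hNN
  have hNR : (0:ℝ) < N := by exact_mod_cast hN
  set δ := L / N with hδ
  have hδp : 0 < δ := by positivity
  have hδN : δ * N = L := by rw [hδ]; field_simp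
  rw [one_mul] at hd1 hd2
  set hg : ℤ → ℝ := fun i => h0 (i * δ) with hhg
  set e : ℤ → ℝ := fun i => D2 δ hg i - iteratedDeriv 2 h0 (i * δ) with he
  have hgper : Per N hg := fun i => by
    simp only [hhg]
    rw [← I.per (i * δ)]; congr 1; push_cast; rw [← hδN]; ring
  have hgevn : Evn hg := fun i => by
    simp only [hhg]
    rw [← I.evn]; congr 1; push_cast; ring
  have heper : Per N e := fun i => by
    simp only [he, hgper.D2 δ i]
    rw [← peri I.per 2 (i * δ)]; congr 2; push_cast; rw [← hδN]; ring
  have heevn : Evn e := fun i => by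
    simp only [he, hgevn.D2 δ i]
    rw [← evn2 (i * δ)]; congr 2; push_cast; ring
  have heb : ∀ i, |e i| ≤ 2 * M * δ ^ 2 := by
    intro i
    have h1 := second_diff' (smd I.sm 0) (smd I.sm 1) (smd I.sm 2) (smd I.sm 3) hM (i * δ) δ hδp
    rw [iteratedDeriv_zero] at h1
    simp only [he, D2, hhg]
    convert h1 using 7
    · push_cast; ring
    · push_cast; ring
  have heb1 : ∀ i, |e i| ≤ 2 * M * δ := fun i => (heb i).trans (by
    rw [pow_two, ← mul_assoc]
    exact mul_le_of_le_one_right (by positivity) hd2)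
  have hrr : ∀ i : ℤ, rr δ e hg i = ρ (i * δ) := fun i => by
    simp only [rr, he, hρ, hhg]; ring
  have hb2 : 0 < 2 * cU := by positivity
  obtain ⟨J, V, S, hV0, hVz, hboot⟩ := exists_scheme (α := α) (δ := δ) hα hN (a := cL / 2)
    (b := 2 * cU) (by positivity) (by linarith) heper heevn hgper hgevn hNR (fun i => by
      rw [hrr]
      have hp : 0 < ρ (i * δ) := I.pos _
      have hinv : (ρ (i * δ) ^ (-α)) ^ (-(1/α)) = ρ (i * δ) := by
        rw [← rpow_mul hp.le, show -α * -(1/α) = 1 by field_simp, rpow_one]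
      constructor
      · have := rpow_lt_rpow_of_neg (rpow_pos_of_pos hp (-α))
          ((hFcU (i * δ)).trans (by linarith : cU < 2 * cU)) (by linarith : -(1/α) < 0)
        rwa [hinv] at this
      · have := rpow_lt_rpow_of_neg (by positivity)
          ((by linarith : cL / 2 < cL).trans (hcLF (i * δ))) (by linarith : -(1/α) < 0)
        rwa [hinv] at this)
  have hz0 : ∀ i : ℤ, (V i 0).z 0 = ρ (i * δ) ^ (-α) := fun i => by rw [hVz, hrr]
  have hmono : ∀ i : ℕ, i < N → (V (i + 1) 0).z 0 ≤ (V i 0).z 0 := by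
    intro i hi
    rw [hz0, hz0]
    apply rpow_le_rpow_of_nonpos (I.pos _) _ (by linarith)
    have hi' : ((i:ℝ) + 1) ≤ N := by exact_mod_cast hi
    apply I.mono
    · refine ⟨by push_cast; positivity, ?_⟩
      push_cast; rw [← hδN]; nlinarith
    · refine ⟨by push_cast; positivity, ?_⟩
      push_cast; rw [← hδN]; nlinarith
    · push_cast; nlinarith
  have hVf : (fun k => (V k 0).h) = hg := funext hV0
  have hNδ : ((N:ℤ):ℝ) * δ = L := by push_cast; rw [mul_comm]; exact hδN
  have hap : ∀ t1, (∀ t, 0 ≤ t → t ≤ t1 → t ∈ J) → ∀ (i : ℤ) {t : ℝ}, 0 ≤ t → t ≤ t1 →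
      cL ≤ (V i t).z 0 ∧ (V i t).z 0 ≤ cU ∧ 3 * ε ≤ (V i t).h ∧ (V i t).h ≤ M0 + ε := by
    intro t1 hJ1 i t ht0 ht1
    refine S.apriori hα hN hδp hJ1 hmono (η := 4 * M * δ ^ 2) hK (by positivity)
      (hbar N δ hδp hd1 hδN) (fun i _ => ?_) ?_ (fun i => (heb1 i).trans hd3) hεp ?_ ?_ ?_ hBp
      (fun i => ?_) hB2 i ht0 ht1
    · have h1 := abs_le.1 (heb i)
      have h2 := abs_le.1 (heb (i + 1))
      linarith [h1.2, h2.1]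
    · calc (N:ℝ) * (K * (4 * M * δ ^ 2)) = K * (4 * M) * (δ * N) * δ := by ring
        _ = K * (4 * M) * L * δ := by rw [hδN]
        _ ≤ ε := hd4
    · rw [hV0, hhg]; simp only; rw [hNδ]; linarith
    · rw [hV0, hhg]; simp [hM0']
    · rw [hVf]; simp only [he]; rw [hNδ]; linarith
    · rw [hz0, hV0]; exact hFB _
  have hdom : ∀ t : ℝ, 0 ≤ t → t < N → t ∈ J :=
    hboot cL cU (by linarith) (by linarith) fun t1 ht1 hJ1 i =>
      ⟨(hap t1 hJ1 i ht1 le_rfl).1, (hap t1 hJ1 i ht1 le_rfl).2.1⟩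
  have hdom' : ∀ {t}, t < (N:ℝ) → ∀ s, 0 ≤ s → s ≤ t → s ∈ J := fun ht s hs hst =>
    hdom s hs (by linarith)
  refine ⟨e, J, V, S, hN, hdom, hV0, hz0, fun i => ?_, fun i t ht0 ht1 => ?_,
    fun i t ht0 ht1 => S.order hα hN (hdom' ht1) hmono i ht0 le_rfl,
    fun i t ht0 ht1 => S.orderl hα hN hδp (hdom' ht1) hmono i ht0 le_rfl⟩
  · refine (heb1 i).trans ?_
    rw [hδ, ← mul_div_assoc]
    gcongr
    linarith
  · have := hap t (hdom' ht1) i ht0 le_rfl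
    rw [abs_of_nonneg (by linarith [this.2.2.1])]
    have : 0 ≤ 2 * M * L := by positivity
    linarith [(hap t (hdom' ht1) i ht0 le_rfl).2.2.2]

end APF

namespace APF

lemma Scheme.l_eq {α δ : ℝ} {N : ℕ} {a b : ℝ} {e : ℤ → ℝ} {J : Set ℝ} {V : ℤ → ℝ → Env}
    (S : Scheme α δ N a b e J V) (j : ℕ) {t : ℝ} (ht : t ∈ J) :
    (V 0 t).l j * av δ N (fun i => ev (V i t) (rhoE α)) = av δ N (fun i => ev (V i t) (GG α j)) := by
  have h := S.sumTE j ht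
  have h2 : av δ N (fun i => ev (V i t) (TE α j)) = av δ N (fun i => ev (V i t) (GG α j))
      - av δ N (fun i => (V 0 t).l j * ev (V i t) (rhoE α)) := by
    rw [← av_sub]
    apply av_congr
    intro i
    simp only [TE, gE, ev, S.lind i t j]; ring
  rw [av_mul] at h2
  linarith

/-- Bound for the nonlocal term. -/
lemma Scheme.l_abs {α δ : ℝ} {N : ℕ} {a b : ℝ} {e : ℤ → ℝ} {J : Set ℝ} {V : ℤ → ℝ → Env}
    (S : Scheme α δ N a b e J V) (hα : 0 < α) (hδ : 0 ≤ δ) (j : ℕ) {t : ℝ} (ht : t ∈ J) :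
    |(V 0 t).l j| * (2 * (δ * N) * b ^ (-(1/α))) ≤ av δ N (fun i => |ev (V i t) (GG α j)|) := by
  have h := S.l_eq j ht
  have hr : ∀ i, b ^ (-(1/α)) ≤ ev (V i t) (rhoE α) := fun i => by
    have : 0 < 1 / α := by positivity
    exact rpow_le_rpow_of_nonpos (S.pos i ht) (S.hi i t ht) (by linarith)
  have h1 := av_mono hδ (N := N) hr
  rw [av_const] at h1
  have h2 : 0 ≤ av δ N (fun i => ev (V i t) (rhoE α)) := av_nonneg hδ fun i =>
    (rpow_pos_of_pos (S.pos i ht) _).le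
  calc _ ≤ |(V 0 t).l j| * av δ N (fun i => ev (V i t) (rhoE α)) := by gcongr
    _ = |av δ N (fun i => ev (V i t) (GG α j))| := by rw [← h, abs_mul, abs_of_nonneg h2]
    _ ≤ _ := abs_av_le hδ fun i => le_rfl

/-- Families of functions with uniformly bounded derivatives up to order `k`. -/
def Sb : ℕ → (ℕ → ℝ → ℝ) → Prop
  | 0, f => ∃ C, ∀ n x, |f n x| ≤ C
  | k + 1, f => (∃ C, ∀ n x, |f n x| ≤ C) ∧
      ∃ f' : ℕ → ℝ → ℝ, (∀ n x, HasDerivAt (f n) (f' n x) x) ∧ Sb k f'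

lemma Sb.bd {k : ℕ} {f : ℕ → ℝ → ℝ} (h : Sb k f) : ∃ C, ∀ n x, |f n x| ≤ C := by
  cases k with
  | zero => exact h
  | succ k => exact h.1

lemma Sb.pred {k : ℕ} {f : ℕ → ℝ → ℝ} (h : Sb (k + 1) f) : Sb k f := by
  induction k generalizing f with
  | zero => exact h.1
  | succ k ih =>
    obtain ⟨h1, f', h2, h3⟩ := h
    exact ⟨h1, f', h2, ih h3⟩

lemma Sb.add {k : ℕ} {f g : ℕ → ℝ → ℝ} (hf : Sb k f) (hg : Sb k g) :
    Sb k (fun n x => f n x + g n x) := by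
  have hb : ∃ C, ∀ n x, |f n x + g n x| ≤ C := by
    obtain ⟨C, hC⟩ := hf.bd
    obtain ⟨C', hC'⟩ := hg.bd
    exact ⟨C + C', fun n x => (abs_add_le _ _).trans (add_le_add (hC n x) (hC' n x))⟩
  induction k generalizing f g with
  | zero => exact hb
  | succ k ih =>
    obtain ⟨-, f', h2, h3⟩ := hf
    obtain ⟨-, g', h2', h3'⟩ := hg
    refine ⟨hb, fun n x => f' n x + g' n x, fun n x => (h2 n x).add (h2' n x), ih h3 h3' ?_⟩
    obtain ⟨C, hC⟩ := h3.bd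
    obtain ⟨C', hC'⟩ := h3'.bd
    exact ⟨C + C', fun n x => (abs_add_le _ _).trans (add_le_add (hC n x) (hC' n x))⟩

lemma Sb.mul {k : ℕ} {f g : ℕ → ℝ → ℝ} (hf : Sb k f) (hg : Sb k g) :
    Sb k (fun n x => f n x * g n x) := by
  have hb : ∀ {f g : ℕ → ℝ → ℝ}, Sb k f → Sb k g → ∃ C, ∀ n x, |f n x * g n x| ≤ C := by
    intro f g hf hg
    obtain ⟨C, hC⟩ := hf.bd
    obtain ⟨C', hC'⟩ := hg.bd
    refine ⟨C * C', fun n x => ?_⟩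
    rw [abs_mul]
    exact mul_le_mul (hC n x) (hC' n x) (abs_nonneg _) ((abs_nonneg _).trans (hC n x))
  induction k generalizing f g with
  | zero => exact hb hf hg
  | succ k ih =>
    have hf0 := hf.pred
    have hg0 := hg.pred
    have h0 := hb hf hg
    obtain ⟨-, f', h2, h3⟩ := hf
    obtain ⟨-, g', h2', h3'⟩ := hg
    have hb' : ∀ {f g : ℕ → ℝ → ℝ}, Sb k f → Sb k g → ∃ C, ∀ n x, |f n x * g n x| ≤ C := by
      intro f g hf hg
      obtain ⟨C, hC⟩ := hf.bd
      obtain ⟨C', hC'⟩ := hg.bd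
      refine ⟨C * C', fun n x => ?_⟩
      rw [abs_mul]
      exact mul_le_mul (hC n x) (hC' n x) (abs_nonneg _) ((abs_nonneg _).trans (hC n x))
    exact ⟨h0, fun n x => f' n x * g n x + f n x * g' n x, fun n x => (h2 n x).mul (h2' n x),
      (ih h3 hg0 hb').add (ih hf0 h3' hb')⟩

lemma Sb.const {r : ℕ → ℝ} {C : ℝ} (h : ∀ n, |r n| ≤ C) (k : ℕ) : Sb k (fun n _ => r n) := by
  induction k generalizing r C with
  | zero => exact ⟨C, fun n _ => h n⟩
  | succ k ih =>
    exact ⟨⟨C, fun n _ => h n⟩, fun _ _ => 0, fun n x => hasDerivAt_const x _,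
      ih (r := fun _ => 0) (C := 0) (by simp)⟩

lemma Sb.D2 {k : ℕ} {f : ℕ → ℝ → ℝ} {δ : ℕ → ℝ} (hδ : ∀ n, 0 < δ n) (hf : Sb (k + 2) f) :
    Sb k (fun n x => (f n (x + δ n) - 2 * f n x + f n (x - δ n)) / δ n ^ 2) := by
  have hb : ∀ {k} {f : ℕ → ℝ → ℝ}, Sb (k + 2) f →
      ∃ C, ∀ n x, |(f n (x + δ n) - 2 * f n x + f n (x - δ n)) / δ n ^ 2| ≤ C := by
    rintro k f ⟨-, f1, h1, -, f2, h2, h3⟩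
    obtain ⟨C, hC⟩ := h3.bd
    refine ⟨2 * C, fun n x => ?_⟩
    have hp : 0 < δ n ^ 2 := pow_pos (hδ n) 2
    rw [abs_div, abs_of_pos hp, div_le_iff₀ hp]
    exact second_diff (h1 n) (h2 n) (hC n) x (δ n) (hδ n).le
  induction k generalizing f with
  | zero => exact hb hf
  | succ k ih =>
    have h0 := hb hf
    obtain ⟨-, f1, h1, h2⟩ := hf
    refine ⟨h0, _, fun n x => ?_, ih h2⟩
    exact ((((h1 n (x + δ n)).comp_add_const x (δ n)).sub ((h1 n x).const_mul 2)).add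
      ((h1 n (x - δ n)).comp_sub_const x (δ n))).div_const _

lemma Sb.smooth {g : ℝ → ℝ} {P : ℝ} (hP : 0 < P) (sm : ContDiff ℝ (⊤ : ℕ∞) g)
    (per : ∀ x, g (x + P) = g x) (k : ℕ) : Sb k (fun _ x => g x) := by
  have key : ∀ k j, Sb k (fun _ x => iteratedDeriv j g x) := by
    intro k
    induction k with
    | zero =>
      intro j
      obtain ⟨M, -, hM⟩ := pbd hP sm per j
      exact ⟨M, fun _ x => hM x⟩
    | succ k ih =>
      intro j
      obtain ⟨M, -, hM⟩ := pbd hP sm per j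
      exact ⟨⟨M, fun _ x => hM x⟩, _, fun n x => smd sm j x, ih (j + 1)⟩
  simpa using key k 0

section
variable {α L a b C : ℝ} {h0 : ℝ → ℝ} {Nn : ℕ → ℕ} {e : ℕ → ℤ → ℝ} {J : ℕ → Set ℝ}
  {V : ℕ → ℤ → ℝ → Env}

/-- Initial values given by grid values of a smooth family. -/
def Rep (L : ℝ) (Nn : ℕ → ℕ) (g : ℕ → ℤ → ℝ) : Prop :=
  ∃ f : ℕ → ℝ → ℝ, (∀ k, Sb k f) ∧ ∀ n i, g n i = f n (i * (L / Nn n))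

lemma Rep.add {f g : ℕ → ℤ → ℝ} (hf : Rep L Nn f) (hg : Rep L Nn g) :
    Rep L Nn (fun n i => f n i + g n i) := by
  obtain ⟨f1, h1, h2⟩ := hf
  obtain ⟨f1', h1', h2'⟩ := hg
  exact ⟨_, fun k => (h1 k).add (h1' k), fun n i => by simp only [h2, h2']⟩

lemma Rep.mul {f g : ℕ → ℤ → ℝ} (hf : Rep L Nn f) (hg : Rep L Nn g) :
    Rep L Nn (fun n i => f n i * g n i) := by
  obtain ⟨f1, h1, h2⟩ := hf
  obtain ⟨f1', h1', h2'⟩ := hg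
  exact ⟨_, fun k => (h1 k).mul (h1' k), fun n i => by simp only [h2, h2']⟩

lemma Rep.const {r : ℕ → ℝ} {C : ℝ} (h : ∀ n, |r n| ≤ C) : Rep L Nn (fun n _ => r n) :=
  ⟨_, fun k => Sb.const h k, fun _ _ => rfl⟩

lemma Rep.D2 (hL : 0 < L) (hN : ∀ n, 0 < Nn n) {f : ℕ → ℤ → ℝ} (hf : Rep L Nn f) :
    Rep L Nn (fun n i => D2 (L / Nn n) (f n) i) := by
  obtain ⟨f1, h1, h2⟩ := hf
  have hδ : ∀ n, 0 < L / (Nn n : ℝ) := fun n => by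
    have : (0:ℝ) < Nn n := by exact_mod_cast hN n
    positivity
  refine ⟨_, fun k => (h1 (k + 2)).D2 hδ, fun n i => ?_⟩
  simp only [APF.D2, h2]
  congr 4
  · push_cast; ring
  · push_cast; ring

lemma rep_low (hrho : ∀ s : ℝ, Rep L Nn (fun n i => (V n i 0).z 0 ^ s)) (hl : ∀ n i j, (V n i 0).l j = (V n 0 0).l j)
    {k : ℕ} (hz : ∀ j ≤ k, Rep L Nn (fun n i => (V n i 0).z j))
    (hlb : ∀ j < k, ∃ C, ∀ n, |(V n 0 0).l j| ≤ C) (x : Ex) (hx : low x k) :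
    Rep L Nn (fun n i => ev (V n i 0) x) := by
  induction x with
  | c r => exact Rep.const (r := fun _ => r) (C := |r|) fun _ => le_rfl
  | pw s => exact hrho s
  | z j => exact hz j hx
  | l j =>
    obtain ⟨C, hC⟩ := hlb j hx
    simp only [ev, hl]
    exact Rep.const hC
  | p => exact hx.elim
  | h => exact hx.elim
  | q => exact hx.elim
  | add a b iha ihb => exact (iha hx.1).add (ihb hx.2)
  | mul a b iha ihb => exact (iha hx.1).mul (ihb hx.2)

lemma initial_bd (hα : 0 < α) (I : Init L h0)
    (F : ∀ n, Fam α L a b C h0 (Nn n) (e n) (J n) (V n)) (j : ℕ) :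
    ∃ K, ∀ n i, |(V n i 0).z j| ≤ K ∧ |(V n i 0).p j| ≤ K := by
  have hL := I.hL
  have hN := fun n => (F n).hN
  have hδ : ∀ n, 0 < L / (Nn n : ℝ) := fun n => by
    have : (0:ℝ) < Nn n := by exact_mod_cast hN n
    positivity
  have h0J : ∀ n, (0:ℝ) ∈ J n := fun n => (F n).dom 0 le_rfl (by exact_mod_cast hN n)
  have hrho : ∀ s : ℝ, Rep L Nn (fun n i => (V n i 0).z 0 ^ s) := by
    intro s
    refine ⟨fun _ x => (h0 x + iteratedDeriv 2 h0 x) ^ (-α * s), fun k => ?_, fun n i => ?_⟩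
    · apply Sb.smooth (g := fun x => (h0 x + iteratedDeriv 2 h0 x) ^ (-α * s))
        (by positivity : 0 < 2 * L)
      · exact (I.sm.add (smi I.sm 2)).rpow_const_of_ne fun x => (I.pos x).ne'
      · intro x
        simp only [I.per, peri I.per 2 x]
    · simp only [(F n).iz i]
      rw [← rpow_mul (I.pos _).le]
  have hl : ∀ n i j, (V n i 0).l j = (V n 0 0).l j := fun n i j => (F n).S.lind i 0 j
  have main : ∀ k, (∀ j ≤ k, Rep L Nn (fun n i => (V n i 0).z j)) ∧
      (∀ j < k, ∃ C, ∀ n, |(V n 0 0).l j| ≤ C) := by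
    intro k
    induction k with
    | zero =>
      refine ⟨fun j hj => ?_, fun j hj => by omega⟩
      obtain rfl : j = 0 := by omega
      simpa using hrho 1
    | succ k ih =>
      obtain ⟨hz, hlb⟩ := ih
      have hlow := rep_low hrho hl hz hlb
      have hlk : ∃ C, ∀ n, |(V n 0 0).l k| ≤ C := by
        obtain ⟨f, hf1, hf2⟩ := hlow (GG α k) (low_GG α k)
        obtain ⟨M, hM⟩ := (hf1 0).bd
        have hb0 : 0 < b := (F 0).S.pos 0 (h0J 0) |>.trans_le ((F 0).S.hi 0 0 (h0J 0))
        have hbp : 0 < b ^ (-(1/α)) := rpow_pos_of_pos hb0 _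
        refine ⟨M / b ^ (-(1/α)), fun n => ?_⟩
        have h1 := (F n).S.l_abs hα (hδ n).le k (h0J n)
        have h2 : av (L / Nn n) (Nn n) (fun i => |ev (V n i 0) (GG α k)|) ≤ _ :=
          av_mono (hδ n).le (g := fun _ => M) fun i => by
            have := hf2 n i
            simp only at this
            rw [this]; exact hM n _
        rw [av_const] at h2
        rw [le_div_iff₀ hbp]
        have hp : 0 < 2 * (L / (Nn n : ℝ) * Nn n) := by
          have : (0:ℝ) < Nn n := by exact_mod_cast hN n
          have := hδ n
          positivity
        have h3 : 2 * (L / (Nn n : ℝ) * Nn n) * (|(V n 0 0).l k| * b ^ (-(1/α)))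
            ≤ 2 * (L / (Nn n : ℝ) * Nn n) * M := by
          calc _ = |(V n 0 0).l k| * (2 * (L / (Nn n : ℝ) * Nn n) * b ^ (-(1/α))) := by ring
            _ ≤ _ := h1.trans h2
        exact le_of_mul_le_mul_left h3 hp
      have hlb' : ∀ j < k + 1, ∃ C, ∀ n, |(V n 0 0).l j| ≤ C := by
        intro j hj
        rcases Nat.lt_succ_iff_lt_or_eq.1 hj with h | h
        · exact hlb j h
        · rw [h]; exact hlk
      refine ⟨fun j hj => ?_, hlb'⟩
      rcases Nat.le_succ_iff.1 hj with h | h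
      · exact hz j h
      subst h
      obtain ⟨Cl, hCl⟩ := hlk
      have r1 := ((((hz k le_rfl).D2 hL hN).add (hz k le_rfl)).add
        (Rep.const (r := fun n => -(V n 0 0).l k) (C := Cl) (by simpa using hCl))).add
        ((Rep.const (L := L) (Nn := Nn) (r := fun _ => (-1:ℝ)) (C := 1) (by simp)).mul
          (hlow (EE α k) (low_EE α k)))
      have r2 := (r1.mul (Rep.const (r := fun _ => α) (C := |α|) fun _ => le_rfl)).mul
        (hrho (1/α + 1))
      convert r2 using 3 with n i
      have h1 := (F n).S.eqRE k i (h0J n)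
      have hp := (F n).S.pos i (h0J n)
      simp only [RE, g1, ev, hl n i k] at h1
      have h2 : (V n i 0).z 0 ^ (-(1/α) - 1) * (V n i 0).z 0 ^ (1/α + 1) = 1 := by
        rw [← rpow_add hp]; simp
      have h3 : APF.D2 (L / Nn n) (fun i => (V n i 0).z k) i + (V n i 0).z k + -(V n 0 0).l k
          + -1 * ev (V n i 0) (EE α k) = 1 / α * (V n i 0).z 0 ^ (-(1/α) - 1) * (V n i 0).z (k + 1) := by
        linarith
      rw [h3]
      have h4 : 1 / α * α = 1 := by field_simp
      linear_combination (-(V n i 0).z (k + 1)) * h2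
        - (V n i 0).z (k + 1) * ((V n i 0).z 0 ^ (-(1/α) - 1) * (V n i 0).z 0 ^ (1/α + 1)) * h4
  obtain ⟨f, hf1, hf2⟩ := (main j).1 j le_rfl
  obtain ⟨⟨K, hK⟩, f', hd, hf'⟩ := hf1 1
  obtain ⟨K', hK'⟩ := hf'.bd
  refine ⟨max K K', fun n i => ⟨?_, ?_⟩⟩
  · have := hf2 n i
    simp only at this
    rw [this]; exact (hK n _).trans (le_max_left _ _)
  · refine le_trans ?_ (le_max_right _ _)
    simp only [(F n).S.pdef, Dp]
    have e1 := hf2 n i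
    have e2 := hf2 n (i + 1)
    simp only at e1 e2
    rw [e1, e2, abs_div, abs_of_pos (hδ n), div_le_iff₀ (hδ n)]
    have := (convex_univ).norm_image_sub_le_of_norm_hasDerivWithin_le (f := f n) (f' := f' n)
      (C := K') (s := Set.univ) (x := i * (L / Nn n)) (y := ((i + 1 : ℤ) : ℝ) * (L / Nn n))
      (fun x _ => (hd n x).hasDerivWithinAt) (fun x _ => hK' n x) trivial trivial
    have e3 : ((i + 1 : ℤ) : ℝ) * (L / Nn n) - i * (L / Nn n) = L / Nn n := by push_cast; ring
    rw [e3, Real.norm_eq_abs, Real.norm_eq_abs, abs_of_pos (hδ n)] at this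
    exact this
end

end APF

namespace APF

lemma av_sq_le {δ : ℝ} (hδ : 0 ≤ δ) (N : ℕ) (f : ℤ → ℝ) :
    av δ N f ^ 2 ≤ 2 * (δ * N) * av δ N (fun i => f i ^ 2) := by
  have h := sq_sum_le_card_mul_sum_sq (s := Finset.range (2 * N)) (f := fun i : ℕ => f i)
  rw [Finset.card_range] at h
  push_cast at h
  unfold av
  calc (δ * ∑ i ∈ Finset.range (2 * N), f i) ^ 2
      = δ ^ 2 * (∑ i ∈ Finset.range (2 * N), f i) ^ 2 := by ring
    _ ≤ δ ^ 2 * (2 * N * ∑ i ∈ Finset.range (2 * N), f i ^ 2) := by gcongr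
    _ = _ := by ring

lemma av_sum {ι : Type*} (δ : ℝ) (N : ℕ) (s : Finset ι) (f : ι → ℤ → ℝ) :
    av δ N (fun i => ∑ k ∈ s, f k i) = ∑ k ∈ s, av δ N (f k) := by
  simp only [av, Finset.mul_sum]
  exact Finset.sum_comm

lemma VV_sq (k : ℕ) (v : Env) : VV k v ^ 2 ≤ 2 * (k + 1) *
    (∑ l ∈ Finset.range (k + 1), v.z (l + 1) ^ 2 + ∑ l ∈ Finset.range k, v.l (l + 1) ^ 2) := by
  have h1 := sq_sum_le_card_mul_sum_sq (s := Finset.range (k + 1)) (f := fun l => |v.z (l + 1)|)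
  have h2 := sq_sum_le_card_mul_sum_sq (s := Finset.range k) (f := fun l => |v.l (l + 1)|)
  simp only [sq_abs, Finset.card_range] at h1 h2
  push_cast at h1
  have h3 : 0 ≤ ∑ l ∈ Finset.range k, v.l (l + 1) ^ 2 := Finset.sum_nonneg fun _ _ => sq_nonneg _
  unfold VV
  nlinarith [sq_nonneg (∑ l ∈ Finset.range (k + 1), |v.z (l + 1)| - ∑ l ∈ Finset.range k, |v.l (l + 1)|)]

section scheme
variable {α δ : ℝ} {N : ℕ} {a b : ℝ} {e : ℤ → ℝ} {J : Set ℝ} {V : ℤ → ℝ → Env}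

noncomputable def c1 (α b : ℝ) : ℝ := 1 / α * b ^ (-(1/α) - 1)

lemma Scheme.bpos (S : Scheme α δ N a b e J V) {t : ℝ} (ht : t ∈ J) : 0 < b :=
  (S.pos 0 ht).trans_le (S.hi 0 t ht)

lemma Scheme.g1_ge (S : Scheme α δ N a b e J V) (hα : 0 < α) {t : ℝ} (ht : t ∈ J) (i : ℤ) :
    c1 α b ≤ ev (V i t) (g1 α) := by
  have : 0 < 1 / α := by positivity
  simp only [c1, g1, ev]
  exact mul_le_mul_of_nonneg_left (rpow_le_rpow_of_nonpos (S.pos i ht) (S.hi i t ht) (by linarith))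
    this.le

/-- The source term of the energy identity. -/
noncomputable def src (α : ℝ) (j : ℕ) (v : Env) : ℝ := v.z j - v.l j - ev v (EE α j)

lemma Scheme.test (S : Scheme α δ N a b e J V) (hα : 0 < α) (hδ : 0 < δ) (j : ℕ) {t : ℝ}
    (ht : t ∈ J) : c1 α b * av δ N (fun i => (V i t).z (j + 1) ^ 2)
      + 2 * av δ N (fun i => (V i t).p j * (V i t).p (j + 1))
      ≤ 1 / c1 α b * av δ N (fun i => src α j (V i t) ^ 2) := by
  have hc : 0 < c1 α b := mul_pos (by positivity) (rpow_pos_of_pos (S.bpos ht) _)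
  have h1 := sbp hδ.ne' (S.perz t j) (S.perz t (j + 1))
  have h2 : av δ N (fun i => (V i t).p j * (V i t).p (j + 1))
      = - av δ N (fun i => D2 δ (fun k => (V k t).z j) i * (V i t).z (j + 1)) := by
    rw [h1, neg_neg]; apply av_congr; intro i; rw [S.pdef, S.pdef]
  rw [h2, ← av_mul, ← av_mul, mul_neg, ← av_mul, ← sub_eq_add_neg, ← av_sub]
  apply av_mono hδ.le
  intro i
  have h3 := S.eqRE j i ht
  have h4 := S.g1_ge hα ht i
  simp only [RE, ev] at h3
  have h5 : D2 δ (fun k => (V k t).z j) i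
      = ev (V i t) (g1 α) * (V i t).z (j + 1) - src α j (V i t) := by
    unfold src; linarith
  rw [h5]
  have h6 : 0 ≤ (ev (V i t) (g1 α) - c1 α b) * (V i t).z (j + 1) ^ 2 :=
    mul_nonneg (by linarith) (sq_nonneg _)
  have h7 : 0 ≤ 1 / c1 α b * (c1 α b * (V i t).z (j + 1) - src α j (V i t)) ^ 2 := by positivity
  have h8 : 1 / c1 α b * (c1 α b * (V i t).z (j + 1) - src α j (V i t)) ^ 2
      = c1 α b * (V i t).z (j + 1) ^ 2 - 2 * (V i t).z (j + 1) * src α j (V i t)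
        + 1 / c1 α b * src α j (V i t) ^ 2 := by field_simp; ring
  nlinarith

lemma Scheme.dX (S : Scheme α δ N a b e J V) (j : ℕ) {t : ℝ} (ht : t ∈ J) :
    HasDerivAt (fun s => av δ N (fun i => (V i s).p j ^ 2))
      (2 * av δ N (fun i => (V i t).p j * (V i t).p (j + 1))) t := by
  have h := Scheme.dav (δ := δ) (N := N) (f := fun i s => (V i s).p j ^ 2)
    (f' := fun i s => 2 * ((V i s).p j * (V i s).p (j + 1))) (t := t)
    (fun i => ((S.dp i ht j).pow 2).congr_deriv (by simp; ring))
  rw [av_mul] at h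
  exact h

lemma Scheme.Ybd (S : Scheme α δ N a b e J V) (hα : 0 < α) (hδ : 0 < δ) (j : ℕ) {t : ℝ}
    (ht : t ∈ J) : c1 α b * av δ N (fun i => (V i t).z (j + 1) ^ 2)
      ≤ av δ N (fun i => (V i t).p j ^ 2) + av δ N (fun i => (V i t).p (j + 1) ^ 2)
      + 1 / c1 α b * av δ N (fun i => src α j (V i t) ^ 2) := by
  have h1 := S.test hα hδ j ht
  have h2 : -(av δ N (fun i => (V i t).p j ^ 2) + av δ N (fun i => (V i t).p (j + 1) ^ 2))
      ≤ 2 * av δ N (fun i => (V i t).p j * (V i t).p (j + 1)) := by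
    rw [← av_add, ← av_mul, ← neg_one_mul, ← av_mul]
    apply av_mono hδ.le
    intro i
    nlinarith [sq_nonneg ((V i t).p j + (V i t).p (j + 1))]
  linarith

end scheme

/-- Quantities dominated by the derivative of a bounded function. -/
def Pot (Nn : ℕ → ℕ) (g : ℕ → ℝ → ℝ) : Prop :=
  ∃ (C : ℝ) (Φ Φ' : ℕ → ℝ → ℝ), ∀ n t, 0 ≤ t → t < (Nn n : ℝ) →
    HasDerivAt (Φ n) (Φ' n t) t ∧ |Φ n t| ≤ C ∧ g n t ≤ -Φ' n t

lemma Pot.add {Nn : ℕ → ℕ} {f g : ℕ → ℝ → ℝ} (hf : Pot Nn f) (hg : Pot Nn g) :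
    Pot Nn (fun n t => f n t + g n t) := by
  obtain ⟨C, Φ, Φ', h⟩ := hf
  obtain ⟨D, Ψ, Ψ', h'⟩ := hg
  refine ⟨C + D, fun n t => Φ n t + Ψ n t, fun n t => Φ' n t + Ψ' n t, fun n t h0 h1 => ?_⟩
  obtain ⟨a1, a2, a3⟩ := h n t h0 h1
  obtain ⟨b1, b2, b3⟩ := h' n t h0 h1
  exact ⟨a1.add b1, (abs_add_le _ _).trans (add_le_add a2 b2), by linarith⟩

lemma pot_gron {Nn : ℕ → ℕ} {X X' g w : ℕ → ℝ → ℝ} {K C0 c : ℝ} (hK : 0 ≤ K) (hc : 0 < c)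
    (hX : ∀ n t, 0 ≤ t → t < (Nn n : ℝ) → HasDerivAt (X n) (X' n t) t)
    (hX0 : ∀ n t, 0 ≤ t → t < (Nn n : ℝ) → 0 ≤ X n t) (hi : ∀ n, X n 0 ≤ C0)
    (hg : ∀ n t, 0 ≤ t → t < (Nn n : ℝ) → 0 ≤ g n t)
    (hineq : ∀ n t, 0 ≤ t → t < (Nn n : ℝ) → X' n t + c * g n t ≤ K * (1 + X n t) * w n t)
    (hw0 : ∀ n t, 0 ≤ t → t < (Nn n : ℝ) → 0 ≤ w n t)
    (hw : Pot Nn w) :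
    (∃ M, ∀ n t, 0 ≤ t → t < (Nn n : ℝ) → X n t ≤ M) ∧ Pot Nn g := by
  obtain ⟨C, Φ, Φ', h⟩ := hw
  have hbd : ∃ M, ∀ n t, 0 ≤ t → t < (Nn n : ℝ) → X n t ≤ M := by
    refine ⟨exp (log (1 + |C0|) + 2 * (K * C)), fun n t ht0 ht1 => ?_⟩
    have hlt : ∀ s, s ≤ t → s < (Nn n : ℝ) := fun s hs => by linarith
    have hanti := anti_of_deriv (f := fun s => log (1 + X n s) + K * Φ n s)
      (f' := fun s => X' n s / (1 + X n s) + K * Φ' n s) (T := t)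
      (fun s h0 h1 => by
        have hp := hX0 n s h0 (hlt s h1)
        exact ((((hX n s h0 (hlt s h1)).const_add 1).log (by positivity)).add
          ((h n s h0 (hlt s h1)).1.const_mul K)))
      (fun s h0 h1 => by
        have hp := hX0 n s h0 (hlt s h1)
        have e1 := hineq n s h0 (hlt s h1)
        have e2 := (h n s h0 (hlt s h1)).2.2
        have e3 : 0 ≤ c * g n s := mul_nonneg hc.le (hg n s h0 (hlt s h1))
        have e4 : X' n s / (1 + X n s) ≤ K * w n s := by
          rw [div_le_iff₀ (by positivity)]; linarith
        have e5 := mul_le_mul_of_nonneg_left e2 hK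
        linarith) le_rfl ht0 le_rfl
    have e1 := (h n t ht0 ht1).2.1
    have e2 := (h n 0 le_rfl (hlt 0 ht0)).2.1
    have e3 : log (1 + X n 0) ≤ log (1 + |C0|) :=
      log_le_log (by linarith [hX0 n 0 le_rfl (hlt 0 ht0)]) (by linarith [hi n, le_abs_self C0])
    have e4 : K * Φ n 0 ≤ K * C := mul_le_mul_of_nonneg_left (abs_le.1 e2).2 hK
    have e5 : K * (-C) ≤ K * Φ n t := mul_le_mul_of_nonneg_left (abs_le.1 e1).1 hK
    have e6 : log (1 + X n t) ≤ log (1 + |C0|) + 2 * (K * C) := by linarith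
    have e7 := hX0 n t ht0 ht1
    have e8 := (log_le_iff_le_exp (by positivity : 0 < 1 + X n t)).1 e6
    linarith
  refine ⟨hbd, ?_⟩
  obtain ⟨M, hM⟩ := hbd
  refine ⟨(|M| + K * (1 + |M|) * C) / c, fun n t => (X n t + K * (1 + |M|) * Φ n t) / c,
    fun n t => (X' n t + K * (1 + |M|) * Φ' n t) / c, fun n t h0 h1 => ⟨?_, ?_, ?_⟩⟩
  · exact ((hX n t h0 h1).add ((h n t h0 h1).1.const_mul _)).div_const _
  · rw [abs_div, abs_of_pos hc]
    gcongr
    refine (abs_add_le _ _).trans (add_le_add ?_ ?_)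
    · rw [abs_of_nonneg (hX0 n t h0 h1)]; exact (hM n t h0 h1).trans (le_abs_self _)
    · rw [abs_mul, abs_of_nonneg (by positivity : 0 ≤ K * (1 + |M|))]
      gcongr; exact (h n t h0 h1).2.1
  · rw [← neg_div, le_div_iff₀ hc]
    have e1 := hineq n t h0 h1
    have e2 := (h n t h0 h1).2.2
    have e3 : K * (1 + X n t) * w n t ≤ K * (1 + |M|) * w n t := by
      have := hw0 n t h0 h1
      gcongr
      exact (hM n t h0 h1).trans (le_abs_self _)
    have e4 : K * (1 + |M|) * w n t ≤ K * (1 + |M|) * (-Φ' n t) := by gcongr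
    linarith

end APF

namespace APF

section seq
variable {α L a b C : ℝ} {h0 : ℝ → ℝ} {Nn : ℕ → ℕ} {e : ℕ → ℤ → ℝ} {J : ℕ → Set ℝ}
  {V : ℕ → ℤ → ℝ → Env}

noncomputable def Yq (L : ℝ) (Nn : ℕ → ℕ) (V : ℕ → ℤ → ℝ → Env) (l n : ℕ) (t : ℝ) : ℝ :=
  av (L / Nn n) (Nn n) (fun i => (V n i t).z l ^ 2)
noncomputable def Xq (L : ℝ) (Nn : ℕ → ℕ) (V : ℕ → ℤ → ℝ → Env) (l n : ℕ) (t : ℝ) : ℝ :=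
  av (L / Nn n) (Nn n) (fun i => (V n i t).p l ^ 2)
noncomputable def Wq (L : ℝ) (Nn : ℕ → ℕ) (V : ℕ → ℤ → ℝ → Env) (j n : ℕ) (t : ℝ) : ℝ :=
  ∑ l ∈ Finset.range j, Yq L Nn V (l + 1) n t

lemma delta_pos (hL : 0 < L) {N : ℕ} (hN : 0 < N) : 0 < L / (N : ℝ) := by
  have : (0:ℝ) < N := by exact_mod_cast hN
  positivity

lemma delta_mul {N : ℕ} (hN : 0 < N) : L / (N : ℝ) * N = L := by
  have : (0:ℝ) < N := by exact_mod_cast hN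
  field_simp

lemma Yq_nonneg (hL : 0 < L) (l n : ℕ) (t : ℝ) : 0 ≤ Yq L Nn V l n t :=
  av_nonneg (by positivity) fun _ => sq_nonneg _
lemma Xq_nonneg (hL : 0 < L) (l n : ℕ) (t : ℝ) : 0 ≤ Xq L Nn V l n t :=
  av_nonneg (by positivity) fun _ => sq_nonneg _
lemma Wq_nonneg (hL : 0 < L) (l n : ℕ) (t : ℝ) : 0 ≤ Wq L Nn V l n t :=
  Finset.sum_nonneg fun _ _ => Yq_nonneg hL _ _ _
lemma Wq_mono (hL : 0 < L) {k l : ℕ} (h : k ≤ l) (n : ℕ) (t : ℝ) :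
    Wq L Nn V k n t ≤ Wq L Nn V l n t :=
  Finset.sum_le_sum_of_subset_of_nonneg (Finset.range_mono h) fun _ _ _ => Yq_nonneg hL _ _ _
lemma Yq_le_Wq (hL : 0 < L) {k l : ℕ} (h : k < l) (n : ℕ) (t : ℝ) :
    Yq L Nn V (k + 1) n t ≤ Wq L Nn V l n t :=
  Finset.single_le_sum (f := fun k => Yq L Nn V (k + 1) n t) (fun _ _ => Yq_nonneg hL _ _ _)
    (Finset.mem_range.2 h)

lemma avVV (hL : 0 < L) (F : ∀ n, Fam α L a b C h0 (Nn n) (e n) (J n) (V n)) (l : ℕ)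
    (hlam : ∀ k, k < l → ∃ K, 0 ≤ K ∧ ∀ n t, 0 ≤ t → t < (Nn n : ℝ) →
      (V n 0 t).l (k + 1) ^ 2 ≤ K * Wq L Nn V (k + 1) n t) :
    ∃ K, 0 ≤ K ∧ ∀ n t, 0 ≤ t → t < (Nn n : ℝ) →
      av (L / Nn n) (Nn n) (fun i => VV l (V n i t) ^ 2) ≤ K * Wq L Nn V (l + 1) n t := by
  choose! K hK0 hK using hlam
  refine ⟨2 * (l + 1) * (1 + ∑ k ∈ Finset.range l, 2 * L * K k), ?_, fun n t t0 t1 => ?_⟩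
  · have : 0 ≤ ∑ k ∈ Finset.range l, 2 * L * K k := Finset.sum_nonneg fun k hk => by
      have := hK0 k (Finset.mem_range.1 hk); positivity
    positivity
  have hδ := delta_pos hL (F n).hN
  have h1 := av_mono hδ.le (N := Nn n) (fun i => VV_sq l (V n i t))
  rw [av_mul, av_add, av_sum, av_sum] at h1
  refine h1.trans ?_
  rw [mul_assoc (2 * ((l:ℝ) + 1)) _ (Wq L Nn V (l + 1) n t)]
  refine mul_le_mul_of_nonneg_left ?_ (by positivity)
  rw [add_mul, one_mul]
  refine add_le_add le_rfl ?_
  rw [Finset.sum_mul]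
  refine Finset.sum_le_sum fun k hk => ?_
  have hk' := Finset.mem_range.1 hk
  have h2 : (fun i => (V n i t).l (k + 1) ^ 2) = fun _ => (V n 0 t).l (k + 1) ^ 2 :=
    funext fun i => by rw [(F n).S.lind]
  rw [h2, av_const, delta_mul (F n).hN, mul_assoc (2 * L)]
  have h3 := hK k hk' n t t0 t1
  have h4 := mul_le_mul_of_nonneg_left (Wq_mono (Nn := Nn) (V := V) hL (by omega : k + 1 ≤ l + 1) n t)
    (hK0 k hk')
  exact mul_le_mul_of_nonneg_left (h3.trans h4) (by positivity)

/-- bounds for the lower-order quantities -/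
def LowB (Nn : ℕ → ℕ) (V : ℕ → ℤ → ℝ → Env) (j : ℕ) (M : ℝ) : Prop :=
  ∀ l, l < j → ∀ n i t, 0 ≤ t → t < (Nn n : ℝ) → |(V n i t).z l| ≤ M ∧ |(V n i t).l l| ≤ M

lemma LowB.lb (F : ∀ n, Fam α L a b C h0 (Nn n) (e n) (J n) (V n)) {j : ℕ} {M : ℝ}
    (H : LowB Nn V j M) {l : ℕ} (hl : l < j) (n : ℕ) (i : ℤ) (t : ℝ) (t0 : 0 ≤ t)
    (t1 : t < (Nn n : ℝ)) : LB a b M l (V n i t) :=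
  ⟨(F n).S.lo i t ((F n).dom t t0 t1), (F n).S.hi i t ((F n).dom t t0 t1),
    fun k hk => (H k (by omega) n i t t0 t1).1, fun k hk => (H k (by omega) n i t t0 t1).2⟩

lemma lam_sq (hα : 0 < α) (hL : 0 < L) (F : ∀ n, Fam α L a b C h0 (Nn n) (e n) (J n) (V n))
    {j : ℕ} {M : ℝ} (H : LowB Nn V j M) : ∀ l, l < j → ∃ K, 0 ≤ K ∧ ∀ n t, 0 ≤ t →
      t < (Nn n : ℝ) → (V n 0 t).l (l + 1) ^ 2 ≤ K * Wq L Nn V (l + 1) n t := by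
  have ha : 0 < a := (F 0).S.apos
  have hb : 0 < b := (F 0).S.bpos ((F 0).dom 0 le_rfl (by exact_mod_cast (F 0).hN))
  intro l
  induction l using Nat.strong_induction_on with
  | _ l ih =>
  intro hl
  obtain ⟨K, hK0, hK⟩ := avVV hL F l (fun k hk => ih k hk (by omega))
  obtain ⟨K1, hK10, hK1⟩ := dt_bd (C := b) ha M l (gE α) (low_mono (Nat.zero_le l) ⟨trivial, trivial⟩)
  obtain ⟨K2, hK20, hK2⟩ := dt_bd (C := b) ha M l (GG α l) (low_GG α l)
  set K3 := K1 * |M| + K2 with hK3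
  have hK30 : 0 ≤ K3 := by positivity
  set D := 2 * L * b ^ (-(1/α)) with hD
  have hDp : 0 < D := by have := rpow_pos_of_pos hb (-(1/α)); positivity
  refine ⟨K3 ^ 2 * (2 * L * K) / D ^ 2, by positivity, fun n t t0 t1 => ?_⟩
  have hδ := delta_pos hL (F n).hN
  have h1 := (F n).S.l_abs hα hδ.le (l + 1) ((F n).dom t t0 t1)
  rw [delta_mul (F n).hN] at h1
  have h2 : av (L / Nn n) (Nn n) (fun i => |ev (V n i t) (GG α (l + 1))|)
      ≤ K3 * av (L / Nn n) (Nn n) (fun i => VV l (V n i t)) := by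
    rw [← av_mul]
    refine av_mono hδ.le fun i => ?_
    have hlb := H.lb F hl n i t t0 t1
    simp only [GG, ev]
    refine (abs_add_le _ _).trans ?_
    rw [abs_mul, hK3, add_mul]
    refine add_le_add ?_ (hK2 _ hlb)
    have e1 := hK1 _ hlb
    have e2 := ((H l hl n i t t0 t1).2).trans (le_abs_self M)
    calc _ ≤ (K1 * VV l (V n i t)) * |M| := mul_le_mul e1 e2 (abs_nonneg _)
            (mul_nonneg hK10 (VV_nonneg _ _))
      _ = _ := by ring
  have h3 := av_sq_le hδ.le (Nn n) (fun i => VV l (V n i t))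
  rw [delta_mul (F n).hN] at h3
  have h4 := hK n t t0 t1
  have h5 : (|(V n 0 t).l (l + 1)| * D) ^ 2
      ≤ (K3 * av (L / Nn n) (Nn n) (fun i => VV l (V n i t))) ^ 2 :=
    pow_le_pow_left₀ (by positivity) (h1.trans h2) 2
  rw [mul_pow _ D, sq_abs, mul_pow K3] at h5
  rw [div_mul_eq_mul_div, le_div_iff₀ (by positivity)]
  refine h5.trans ?_
  rw [mul_assoc]
  refine mul_le_mul_of_nonneg_left (h3.trans ?_) (by positivity)
  rw [mul_assoc (2 * L) K]
  exact mul_le_mul_of_nonneg_left h4 (by positivity)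

/-- Induction hypothesis of the energy argument. -/
def HypE (L : ℝ) (Nn : ℕ → ℕ) (V : ℕ → ℤ → ℝ → Env) (j : ℕ) : Prop :=
  (∃ M, LowB Nn V (j + 1) M) ∧
  (∃ M, ∀ n t, 0 ≤ t → t < (Nn n : ℝ) → Xq L Nn V j n t ≤ M) ∧
  Pot Nn (Wq L Nn V (j + 1))

lemma Xq_start (hα : 0 < α) (I : Init L h0)
    (F : ∀ n, Fam α L a b C h0 (Nn n) (e n) (J n) (V n)) (j : ℕ) :
    ∃ C0, ∀ n, Xq L Nn V j n 0 ≤ C0 := by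
  obtain ⟨K, hK⟩ := initial_bd hα I F j
  refine ⟨2 * L * K ^ 2, fun n => ?_⟩
  have hδ := delta_pos I.hL (F n).hN
  have h1 := av_mono hδ.le (N := Nn n) (f := fun i => (V n i 0).p j ^ 2) (g := fun _ => K ^ 2)
    (fun i => sq_le_sq.2 ((hK n i).2.trans (le_abs_self _)))
  rwa [av_const, delta_mul (F n).hN] at h1

lemma energy_zero (hα : 0 < α) (I : Init L h0)
    (F : ∀ n, Fam α L a b C h0 (Nn n) (e n) (J n) (V n)) : HypE L Nn V 0 := by
  have hL := I.hL
  have hb : 0 < b := (F 0).S.bpos ((F 0).dom 0 le_rfl (by exact_mod_cast (F 0).hN))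
  have hc : 0 < c1 α b := mul_pos (by positivity) (rpow_pos_of_pos hb _)
  obtain ⟨C0, hC0⟩ := Xq_start hα I F 0
  have hlow : LowB Nn V 1 b := by
    intro l hl n i t t0 t1
    obtain rfl : l = 0 := by omega
    have hJ := (F n).dom t t0 t1
    have h1 := (F n).S.pos i hJ
    have h2 := (F n).S.pos (Nn n) hJ
    have h3 := (F n).S.hi 0 t hJ
    have h4 := (F n).ordl i t t0 t1
    rw [abs_of_pos h1, abs_of_pos (by linarith)]
    exact ⟨(F n).S.hi i t hJ, by linarith⟩
  have hw : Pot Nn (fun n t => (V n 0 t).z 0 - (V n (Nn n) t).z 0) := by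
    refine ⟨2 * C, fun n t => (V n 0 t).h - (V n (Nn n) t).h,
      fun n t => -((V n 0 t).z 0 - (V n (Nn n) t).z 0), fun n t t0 t1 => ⟨?_, ?_, by simp⟩⟩
    · have hJ := (F n).dom t t0 t1
      refine (((F n).S.dh 0 t hJ).sub ((F n).S.dh (Nn n) t hJ)).congr_deriv ?_
      rw [(F n).S.lind (Nn n)]; ring
    · have h1 := abs_le.1 ((F n).hb 0 t t0 t1)
      have h2 := abs_le.1 ((F n).hb (Nn n) t t0 t1)
      rw [abs_le]; constructor <;> linarith
  have key := pot_gron (Nn := Nn) (X := Xq L Nn V 0) (g := Yq L Nn V 1)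
    (X' := fun n t => 2 * av (L / Nn n) (Nn n) (fun i => (V n i t).p 0 * (V n i t).p 1))
    (w := fun n t => (V n 0 t).z 0 - (V n (Nn n) t).z 0) (K := 1 / c1 α b * (2 * L * b)) (c := c1 α b)
    (C0 := C0) (by positivity) hc
    (fun n t t0 t1 => (F n).S.dX 0 ((F n).dom t t0 t1))
    (fun n t _ _ => Xq_nonneg hL _ _ _) hC0 (fun n t _ _ => Yq_nonneg hL _ _ _)
    (fun n t t0 t1 => by
      have hJ := (F n).dom t t0 t1
      have hδ := delta_pos hL (F n).hN
      have h1 := (F n).S.test hα hδ 0 hJ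
      set w := (V n 0 t).z 0 - (V n (Nn n) t).z 0 with hwd
      have hw0 : 0 ≤ w := by linarith [((F n).ord 0 t t0 t1).1]
      have hwb : w ≤ b := by linarith [(F n).S.hi 0 t hJ, (F n).S.pos (Nn n) hJ]
      have h2 : av (L / Nn n) (Nn n) (fun i => src α 0 (V n i t) ^ 2) ≤ 2 * L * (b * w) := by
        have h3 := av_mono hδ.le (N := Nn n) (f := fun i => src α 0 (V n i t) ^ 2)
          (g := fun _ => b * w) (fun i => by
            have e1 := (F n).ord i t t0 t1
            have e2 := (F n).ordl i t t0 t1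
            simp only [src, EE, ev, sub_zero]
            have e3 : |(V n i t).z 0 - (V n i t).l 0| ≤ w := by
              rw [abs_le]; constructor <;> linarith
            calc _ = |(V n i t).z 0 - (V n i t).l 0| ^ 2 := (sq_abs _).symm
              _ ≤ w ^ 2 := pow_le_pow_left₀ (abs_nonneg _) e3 2
              _ ≤ b * w := by nlinarith)
        rwa [av_const, delta_mul (F n).hN] at h3
      have h4 : 1 / c1 α b * av (L / Nn n) (Nn n) (fun i => src α 0 (V n i t) ^ 2)
          ≤ 1 / c1 α b * (2 * L * (b * w)) := mul_le_mul_of_nonneg_left h2 (by positivity)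
      have h5 : 0 ≤ 1 / c1 α b * (2 * L * b) * Xq L Nn V 0 n t * w :=
        mul_nonneg (mul_nonneg (by positivity) (Xq_nonneg hL _ _ _)) hw0
      have h6 : 1 / c1 α b * (2 * L * b) * (1 + Xq L Nn V 0 n t) * w
          = 1 / c1 α b * (2 * L * (b * w)) + 1 / c1 α b * (2 * L * b) * Xq L Nn V 0 n t * w := by ring
      rw [h6]
      unfold Yq
      simp only [zero_add] at h1
      linarith)
    (fun n t t0 t1 => by linarith [((F n).ord 0 t t0 t1).1]) hw
  refine ⟨⟨b, hlow⟩, key.1, ?_⟩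
  have : Wq L Nn V (0 + 1) = Yq L Nn V 1 := by funext n t; simp [Wq]
  rw [this]; exact key.2

set_option maxHeartbeats 1000000 in
lemma energy_step (hα : 0 < α) (I : Init L h0)
    (F : ∀ n, Fam α L a b C h0 (Nn n) (e n) (J n) (V n)) (i : ℕ) (H : HypE L Nn V i) :
    HypE L Nn V (i + 1) := by
  have hL := I.hL
  have ha : 0 < a := (F 0).S.apos
  have hb : 0 < b := (F 0).S.bpos ((F 0).dom 0 le_rfl (by exact_mod_cast (F 0).hN))
  have hc : 0 < c1 α b := mul_pos (by positivity) (rpow_pos_of_pos hb _)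
  obtain ⟨⟨M, hM⟩, ⟨MX, hMX⟩, hPot⟩ := H
  obtain ⟨C0, hC0⟩ := Xq_start hα I F (i + 1)
  have hM0 : 0 ≤ M := (abs_nonneg _).trans (hM 0 (by omega) 0 0 0 le_rfl (by exact_mod_cast (F 0).hN)).1
  obtain ⟨Kl, hKl0, hKl⟩ := lam_sq hα hL F hM i (by omega)
  obtain ⟨KV, hKV0, hKV⟩ := avVV hL F i (fun k hk => lam_sq hα hL F hM k (by omega))
  obtain ⟨K1, hK10, hK1⟩ := dt_bd (C := b) ha M 0 (g1 α) ⟨trivial, trivial⟩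
  obtain ⟨K2, hK20, hK2⟩ := dt_bd (C := b) ha M i (EE α i) (low_EE α i)
  obtain ⟨K3, hK30, hK3⟩ := ev_bd (C := b) ha M i (EE α i) (low_EE α i)
  -- bound for `Y_j`
  have hY : ∃ K, 0 ≤ K ∧ ∀ n t, 0 ≤ t → t < (Nn n : ℝ) →
      Yq L Nn V (i + 1) n t ≤ K * (1 + Xq L Nn V (i + 1) n t) := by
    refine ⟨(1 + |MX| + 1 / c1 α b * (2 * L * (2 * M + K3) ^ 2)) / c1 α b, by positivity,
      fun n t t0 t1 => ?_⟩
    have hJ := (F n).dom t t0 t1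
    have hδ := delta_pos hL (F n).hN
    have h1 := (F n).S.Ybd hα hδ i hJ
    have h2 : av (L / Nn n) (Nn n) (fun k => src α i (V n k t) ^ 2) ≤ 2 * L * (2 * M + K3) ^ 2 := by
      have h3 := av_mono hδ.le (N := Nn n) (f := fun k => src α i (V n k t) ^ 2)
        (g := fun _ => (2 * M + K3) ^ 2) (fun k => by
          have e1 := hM i (by omega) n k t t0 t1
          have e2 := hK3 _ (hM.lb F (by omega) n k t t0 t1)
          rw [sq_le_sq, abs_of_nonneg (by positivity : 0 ≤ 2 * M + K3)]
          unfold src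
          have e3 := abs_le.1 e1.1
          have e4 := abs_le.1 e1.2
          have e5 := abs_le.1 e2
          rw [abs_le]; constructor <;> linarith)
      rwa [av_const, delta_mul (F n).hN] at h3
    have h4 := mul_le_mul_of_nonneg_left h2 (by positivity : 0 ≤ 1 / c1 α b)
    have h5 := (hMX n t t0 t1).trans (le_abs_self MX)
    have h6 := Xq_nonneg (Nn := Nn) (V := V) hL (i + 1) n t
    unfold Yq
    rw [div_mul_eq_mul_div, le_div_iff₀ hc, mul_comm]
    have h7 : 0 ≤ (|MX| + 1 / c1 α b * (2 * L * (2 * M + K3) ^ 2)) * Xq L Nn V (i + 1) n t := by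
      positivity
    unfold Xq at h5 h6 h7 ⊢
    nlinarith
  obtain ⟨KY, hKY0, hKY⟩ := hY
  -- sup bound for `z_j`
  have hsup : ∀ n t, 0 ≤ t → t < (Nn n : ℝ) → ∀ k,
      (V n k t).z (i + 1) ^ 2 ≤ (1 / L * KY + 4 * L) * (1 + Xq L Nn V (i + 1) n t) := by
    intro n t t0 t1 k
    have h1 := sobolev (F n).hN hL (delta_mul (F n).hN) ((F n).S.perz t (i + 1)) k
    have h2 := mul_le_mul_of_nonneg_left (hKY n t t0 t1) (by positivity : 0 ≤ 1 / L)
    have h3 : av (L / Nn n) (Nn n) (fun k => Dp (L / Nn n) (fun k => (V n k t).z (i + 1)) k ^ 2)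
        = Xq L Nn V (i + 1) n t := by
      unfold Xq; apply av_congr; intro k; rw [(F n).S.pdef]
    rw [h3] at h1
    unfold Yq at h2
    nlinarith
  set KS := 1 / L * KY + 4 * L with hKS
  have hKS0 : 0 ≤ KS := by positivity
  set KK := 3 * (1 + 2 * L * Kl + 2 * (K1 ^ 2 * KS + K2 ^ 2 * KV)) with hKK
  have hKK0 : 0 ≤ KK := by positivity
  have hsrc : ∀ n t, 0 ≤ t → t < (Nn n : ℝ) →
      av (L / Nn n) (Nn n) (fun k => src α (i + 1) (V n k t) ^ 2)
        ≤ KK * (1 + Xq L Nn V (i + 1) n t) * Wq L Nn V (i + 1) n t := by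
    intro n t t0 t1
    have hδ := delta_pos hL (F n).hN
    have hX := Xq_nonneg (Nn := Nn) (V := V) hL (i + 1) n t
    have hW := Wq_nonneg (Nn := Nn) (V := V) hL (i + 1) n t
    set X := Xq L Nn V (i + 1) n t
    set W := Wq L Nn V (i + 1) n t
    have h1 : av (L / Nn n) (Nn n) (fun k => src α (i + 1) (V n k t) ^ 2)
        ≤ av (L / Nn n) (Nn n) (fun k => 3 * ((V n k t).z (i + 1) ^ 2 + ((V n 0 t).l (i + 1) ^ 2
          + (2 * (K1 ^ 2 * (KS * (1 + X))) * (V n k t).z 1 ^ 2 + 2 * K2 ^ 2 * VV i (V n k t) ^ 2)))) := by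
      refine av_mono hδ.le fun k => ?_
      have e1 := hK1 _ (hM.lb F (by omega : 0 < i + 1) n k t t0 t1)
      have e2 := hK2 _ (hM.lb F (by omega : i < i + 1) n k t t0 t1)
      have e3 : VV 0 (V n k t) = |(V n k t).z 1| := by simp [VV]
      rw [e3] at e1
      have e4 := hsup n t t0 t1 k
      unfold src
      simp only [EE, ev]
      rw [(F n).S.lind k]
      set z := (V n k t).z (i + 1)
      set l := (V n 0 t).l (i + 1)
      set u := ev (V n k t) (dt (g1 α))
      set w := ev (V n k t) (dt (EE α i))
      have e5 : u ^ 2 ≤ K1 ^ 2 * (V n k t).z 1 ^ 2 := by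
        rw [← sq_abs, ← sq_abs ((V n k t).z 1), ← mul_pow]
        exact pow_le_pow_left₀ (abs_nonneg _) e1 2
      have e6 : w ^ 2 ≤ K2 ^ 2 * VV i (V n k t) ^ 2 := by
        rw [← sq_abs, ← mul_pow]
        exact pow_le_pow_left₀ (abs_nonneg _) e2 2
      have e7 : (u * z) ^ 2 ≤ (K1 ^ 2 * (V n k t).z 1 ^ 2) * (KS * (1 + X)) := by
        rw [mul_pow]; exact mul_le_mul e5 e4 (sq_nonneg _) (by positivity)
      have e8 : (z - l - (u * z + w)) ^ 2 ≤ 3 * (z ^ 2 + (l ^ 2 + (2 * (u * z) ^ 2 + 2 * w ^ 2))) := by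
        nlinarith [sq_nonneg (z + l), sq_nonneg (z + (u * z + w)), sq_nonneg (l - (u * z + w)),
          sq_nonneg (u * z - w)]
      nlinarith
    refine h1.trans ?_
    rw [av_mul, av_add, av_add, av_add, av_mul, av_mul, av_const, delta_mul (F n).hN]
    have f1 : av (L / Nn n) (Nn n) (fun k => (V n k t).z (i + 1) ^ 2) ≤ W :=
      Yq_le_Wq hL (by omega : i < i + 1) n t
    have f2 : av (L / Nn n) (Nn n) (fun k => (V n k t).z 1 ^ 2) ≤ W :=
      Yq_le_Wq hL (by omega : 0 < i + 1) n t
    have f3 := hKl n t t0 t1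
    have f4 := hKV n t t0 t1
    have g2 := mul_le_mul_of_nonneg_left f2 (by positivity : 0 ≤ 2 * (K1 ^ 2 * (KS * (1 + X))))
    have g3 := mul_le_mul_of_nonneg_left f3 (by positivity : 0 ≤ 2 * L)
    have g4 := mul_le_mul_of_nonneg_left f4 (by positivity : 0 ≤ 2 * K2 ^ 2)
    have g5 : 0 ≤ (1 + 2 * L * Kl + 2 * (K2 ^ 2 * KV)) * X * W := by positivity
    rw [hKK]
    nlinarith
  have key := pot_gron (Nn := Nn) (X := Xq L Nn V (i + 1)) (g := Yq L Nn V (i + 1 + 1))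
    (X' := fun n t => 2 * av (L / Nn n) (Nn n) (fun k => (V n k t).p (i + 1) * (V n k t).p (i + 1 + 1)))
    (w := Wq L Nn V (i + 1)) (K := 1 / c1 α b * KK) (c := c1 α b)
    (C0 := C0) (by positivity) hc
    (fun n t t0 t1 => (F n).S.dX (i + 1) ((F n).dom t t0 t1))
    (fun n t _ _ => Xq_nonneg hL _ _ _) hC0 (fun n t _ _ => Yq_nonneg hL _ _ _)
    (fun n t t0 t1 => by
      have hJ := (F n).dom t t0 t1
      have h1 := (F n).S.test hα (delta_pos hL (F n).hN) (i + 1) hJ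
      have h2 := mul_le_mul_of_nonneg_left (hsrc n t t0 t1) (by positivity : 0 ≤ 1 / c1 α b)
      unfold Yq
      linarith)
    (fun n t t0 t1 => Wq_nonneg hL _ _ _) hPot
  obtain ⟨⟨MX', hMX'⟩, hP'⟩ := key
  have hPW : Pot Nn (Wq L Nn V (i + 1 + 1)) := by
    have h1 : Wq L Nn V (i + 1 + 1)
        = fun n t => Wq L Nn V (i + 1) n t + Yq L Nn V (i + 1 + 1) n t := by
      funext n t
      exact Finset.sum_range_succ _ _
    rw [h1]
    exact hPot.add hP'
  refine ⟨?_, ⟨MX', hMX'⟩, hPW⟩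
  refine ⟨M + sqrt (KS * (1 + |MX'|)) + sqrt (Kl * ((i + 1) * (M ^ 2 * (2 * L) + KY * (1 + |MX'|)))), ?_⟩
  have hWb : ∀ n t, 0 ≤ t → t < (Nn n : ℝ) →
      Wq L Nn V (i + 1) n t ≤ (i + 1) * (M ^ 2 * (2 * L) + KY * (1 + |MX'|)) := by
    intro n t t0 t1
    have hterm : ∀ l ∈ Finset.range (i + 1),
        Yq L Nn V (l + 1) n t ≤ M ^ 2 * (2 * L) + KY * (1 + |MX'|) := by
      intro l hl
      have hl' := Finset.mem_range.1 hl
      by_cases hli : l = i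
      · subst hli
        have h1 := hKY n t t0 t1
        have h2 := (hMX' n t t0 t1).trans (le_abs_self _)
        have h3 : KY * (1 + Xq L Nn V (l + 1) n t) ≤ KY * (1 + |MX'|) := by gcongr
        have : 0 ≤ M ^ 2 * (2 * L) := by positivity
        linarith
      · have h3 := av_mono (delta_pos hL (F n).hN).le (N := Nn n)
          (f := fun k => (V n k t).z (l + 1) ^ 2)
          (g := fun _ => M ^ 2) (fun k => by
            rw [sq_le_sq, abs_of_nonneg hM0]
            exact (hM (l + 1) (by omega) n k t t0 t1).1)
        rw [av_const, delta_mul (F n).hN] at h3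
        have : 0 ≤ KY * (1 + |MX'|) := by positivity
        unfold Yq; linarith
    have := Finset.sum_le_card_nsmul _ _ _ hterm
    rw [Finset.card_range, nsmul_eq_mul] at this
    push_cast at this
    exact this
  intro l hl n k t t0 t1
  have s1 := sqrt_nonneg (KS * (1 + |MX'|))
  have s2 := sqrt_nonneg (Kl * ((i + 1) * (M ^ 2 * (2 * L) + KY * (1 + |MX'|))))
  by_cases hli : l = i + 1
  · subst hli
    constructor
    · have h1 := hsup n t t0 t1 k
      have h2 : KS * (1 + Xq L Nn V (i + 1) n t) ≤ KS * (1 + |MX'|) := by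
        gcongr; exact (hMX' n t t0 t1).trans (le_abs_self _)
      have h3 := Real.abs_le_sqrt (h1.trans h2)
      linarith
    · rw [(F n).S.lind k]
      have h1 := hKl n t t0 t1
      have h2 := mul_le_mul_of_nonneg_left (hWb n t t0 t1) hKl0
      have h3 := Real.abs_le_sqrt (h1.trans h2)
      linarith
  · have := hM l (by omega) n k t t0 t1
    exact ⟨by linarith [this.1], by linarith [this.2]⟩

/-- Uniform bounds for all time derivatives. -/
lemma unif_bd (hα : 0 < α) (I : Init L h0)
    (F : ∀ n, Fam α L a b C h0 (Nn n) (e n) (J n) (V n)) (j : ℕ) :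
    ∃ M, ∀ n i t, 0 ≤ t → t < (Nn n : ℝ) → |(V n i t).z j| ≤ M ∧ |(V n i t).l j| ≤ M := by
  have : ∀ j, HypE L Nn V j := fun j => by
    induction j with
    | zero => exact energy_zero hα I F
    | succ j ih => exact energy_step hα I F j ih
  obtain ⟨⟨M, hM⟩, -, -⟩ := this j
  exact ⟨M, fun n i t t0 t1 => hM j (by omega) n i t t0 t1⟩

end seq
end APF

namespace APF

lemma step_lip {f : ℤ → ℝ} {c : ℝ} (h : ∀ i, |f (i + 1) - f i| ≤ c) (i : ℤ) (m : ℕ) :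
    |f (i + m) - f i| ≤ m * c := by
  induction m with
  | zero => simp
  | succ m ih =>
    have h1 := h (i + m)
    have h2 : f (i + ((m + 1 : ℕ) : ℤ)) = f (i + m + 1) := by push_cast; rw [add_assoc]
    rw [h2]
    calc |f (i + m + 1) - f i| = |(f (i + m + 1) - f (i + m)) + (f (i + m) - f i)| := by ring_nf
      _ ≤ c + m * c := (abs_add_le _ _).trans (add_le_add h1 ih)
      _ = _ := by push_cast; ring

lemma step_taylor {f : ℤ → ℝ} {i : ℤ} {g δ K ε : ℝ} (hδ : 0 ≤ δ) (hK : 0 ≤ K)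
    (h : ∀ m : ℕ, |f (i + m + 1) - f (i + m) - δ * g| ≤ δ * (K * (δ * (m + 1)) + ε)) (m : ℕ) :
    |f (i + m) - f i - δ * m * g| ≤ δ * m * (K * (δ * m) + ε) := by
  induction m with
  | zero => simp
  | succ m ih =>
    have h1 := h m
    have h2 : f (i + ((m + 1 : ℕ) : ℤ)) = f (i + m + 1) := by push_cast; rw [add_assoc]
    rw [h2]
    push_cast
    calc |f (i + m + 1) - f i - δ * (m + 1) * g|
        = |(f (i + m + 1) - f (i + m) - δ * g) + (f (i + m) - f i - δ * m * g)| := by ring_nf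
      _ ≤ δ * (K * (δ * (m + 1)) + ε) + δ * m * (K * (δ * m) + ε) :=
        (abs_add_le _ _).trans (add_le_add h1 ih)
      _ ≤ _ := by
        have : 0 ≤ δ * m * (K * δ) := by positivity
        nlinarith

/-- Slope bound for even periodic lattice functions. -/
lemma slope_bd {N : ℕ} (hN : 0 < N) {δ L M : ℝ} (hδ : 0 < δ) (hL : δ * N = L) {f : ℤ → ℝ}
    (hf : Per N f) (he : Evn f) (hM : ∀ i, |D2 δ f i| ≤ M) (i : ℤ) : |Dp δ f i| ≤ 3 * L * M := by
  have hM0 : 0 ≤ M := (abs_nonneg _).trans (hM 0)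
  have hN1 : (1:ℝ) ≤ N := by exact_mod_cast hN
  have hs : ∀ i, Dp δ f (i + 1) - Dp δ f i = δ * D2 δ f (i + 1) := fun i => by
    simp only [Dp, D2, add_sub_cancel_right]; field_simp; ring
  have h0 : Dp δ f 0 = δ / 2 * D2 δ f 0 := by
    have := he 1
    simp only [Dp, D2, zero_add, zero_sub, this]; field_simp; ring
  obtain ⟨k, hk, hik⟩ := (hf.Dp δ).rep hN i
  have h1 := step_lip (f := Dp δ f) (c := δ * M) (fun i => by
    rw [hs, abs_mul, abs_of_pos hδ]; exact mul_le_mul_of_nonneg_left (hM _) hδ.le) 0 k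
  rw [zero_add] at h1
  rw [hik]
  have h2 : |Dp δ f 0| ≤ δ / 2 * M := by
    rw [h0, abs_mul, abs_of_pos (by positivity)]
    exact mul_le_mul_of_nonneg_left (hM _) (by positivity)
  have h3 : (k:ℝ) ≤ 2 * N := by exact_mod_cast hk.le
  have h4 : k * (δ * M) ≤ 2 * N * (δ * M) := by gcongr
  have h5 : δ * M ≤ L * M := by
    rw [← hL]; nlinarith [mul_nonneg hδ.le hM0]
  have h6 : 2 * N * (δ * M) = 2 * (L * M) := by rw [← hL]; ring
  have h7 : |Dp δ f k| ≤ |Dp δ f k - Dp δ f 0| + |Dp δ f 0| := by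
    calc _ = |(Dp δ f k - Dp δ f 0) + Dp δ f 0| := by ring_nf
      _ ≤ _ := abs_add_le _ _
  nlinarith

section seq
variable {α L a b C : ℝ} {h0 : ℝ → ℝ} {Nn : ℕ → ℕ} {e : ℕ → ℤ → ℝ} {J : ℕ → Set ℝ}
  {V : ℕ → ℤ → ℝ → Env}

lemma exists_Bd (hα : 0 < α) (I : Init L h0)
    (F : ∀ n, Fam α L a b C h0 (Nn n) (e n) (J n) (V n)) :
    ∃ B : ℕ → ℝ, ∀ n i t, 0 ≤ t → t < (Nn n : ℝ) → Bd a b B (V n i t) := by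
  have hL := I.hL
  have ha : 0 < a := (F 0).S.apos
  choose M hM using unif_bd hα I F
  have hC : ∀ n, C / (Nn n : ℝ) ≤ |C| := fun n => by
    have : (1:ℝ) ≤ Nn n := by exact_mod_cast (F n).hN
    calc _ ≤ |C| / (Nn n : ℝ) := by gcongr; exact le_abs_self _
      _ ≤ _ := div_le_self (abs_nonneg _) this
  have hp : ∀ j, ∃ P, ∀ n i t, 0 ≤ t → t < (Nn n : ℝ) → |(V n i t).p j| ≤ P := by
    intro j
    set M' := ∑ k ∈ Finset.range (j + 2), |M k| with hM'
    have hMle : ∀ k, k ≤ j + 1 → M k ≤ M' := fun k hk => (le_abs_self _).trans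
      (Finset.single_le_sum (f := fun k => |M k|) (fun _ _ => abs_nonneg _)
        (Finset.mem_range.2 (by omega)))
    obtain ⟨K, hK0, hK⟩ := ev_bd (C := b) ha M' (j + 1) (RE α (j + 1)) (low_RE α (j + 1))
    refine ⟨3 * L * (K + 2 * M'), fun n i t t0 t1 => ?_⟩
    rw [(F n).S.pdef]
    refine slope_bd (F n).hN (delta_pos hL (F n).hN) (delta_mul (F n).hN) ((F n).S.perz t j)
      ((F n).S.evnz t j) (fun k => ?_) i
    have hJ := (F n).dom t t0 t1
    have h1 := (F n).S.eqRE j k hJ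
    have h2 := abs_le.1 (hK (V n k t) ⟨(F n).S.lo k t hJ, (F n).S.hi k t hJ,
      fun l hl => (hM l n k t t0 t1).1.trans (hMle l hl),
      fun l hl => (hM l n k t t0 t1).2.trans (hMle l (by omega))⟩)
    have h3 := abs_le.1 ((hM j n k t t0 t1).1.trans (hMle j (by omega)))
    have h4 := abs_le.1 ((hM j n k t t0 t1).2.trans (hMle j (by omega)))
    rw [abs_le]; constructor <;> linarith
  have hq : ∃ P, ∀ n i t, 0 ≤ t → t < (Nn n : ℝ) → |(V n i t).q| ≤ P := by
    obtain ⟨K, hK0, hK⟩ := rpow_bd (C := b) ha (-(1/α))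
    refine ⟨3 * L * (K + C + |C|), fun n i t t0 t1 => ?_⟩
    rw [(F n).S.qdef]
    refine slope_bd (F n).hN (delta_pos hL (F n).hN) (delta_mul (F n).hN) ((F n).S.perh t)
      ((F n).S.evnh t) (fun k => ?_) i
    have hJ := (F n).dom t t0 t1
    have h1 := (F n).S.rel k t hJ
    simp only [rhoE, ev] at h1
    have h2 := abs_le.1 (hK _ ((F n).S.lo k t hJ) ((F n).S.hi k t hJ))
    have h3 := abs_le.1 ((F n).hb k t t0 t1)
    have h4 := abs_le.1 (((F n).eb k).trans (hC n))
    rw [abs_le]; constructor <;> linarith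
  choose P hP using hp
  obtain ⟨Q, hQ⟩ := hq
  have l1 : ∀ j, M j ≤ |M j| + |P j| + |C| + |Q| := fun j => by
    linarith [le_abs_self (M j), abs_nonneg (P j), abs_nonneg C, abs_nonneg Q]
  have l2 : ∀ j, P j ≤ |M j| + |P j| + |C| + |Q| := fun j => by
    linarith [le_abs_self (P j), abs_nonneg (M j), abs_nonneg C, abs_nonneg Q]
  refine ⟨fun j => |M j| + |P j| + |C| + |Q|, fun n i t t0 t1 => ?_⟩
  have hJ := (F n).dom t t0 t1
  refine ⟨(F n).S.lo i t hJ, (F n).S.hi i t hJ, fun j => (hM j n i t t0 t1).1.trans (l1 j),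
    fun j => (hM j n i t t0 t1).2.trans (l1 j), fun j => (hP j n i t t0 t1).trans (l2 j), ?_, ?_⟩
  · refine ((F n).hb i t t0 t1).trans ?_
    linarith [le_abs_self C, abs_nonneg (M 0), abs_nonneg (P 0), abs_nonneg Q]
  · refine (hQ n i t t0 t1).trans ?_
    linarith [le_abs_self Q, abs_nonneg (M 0), abs_nonneg (P 0), abs_nonneg C]

/-- The space-difference identities. -/
lemma Fam.dxs {N : ℕ} {e : ℤ → ℝ} {J : Set ℝ} {V : ℤ → ℝ → Env} (hL : 0 < L)
    (F : Fam α L a b C h0 N e J V) {t : ℝ} (t0 : 0 ≤ t) (t1 : t < (N : ℝ)) (i : ℤ) :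
    (∀ j, (V (i + 1) t).z j - (V i t).z j = L / N * (V i t).p j) ∧
    (∀ j, (V (i + 1) t).p j - (V i t).p j = L / N * ev (V (i + 1) t) (dx α (.p j))) ∧
    ((V (i + 1) t).h - (V i t).h = L / N * (V i t).q) ∧
    ((V (i + 1) t).q - (V i t).q
      = L / N * (ev (V (i + 1) t) (dx α .q) + e (i + 1))) := by
  have hJ := F.dom t t0 t1
  have hδ := (delta_pos hL F.hN).ne'
  refine ⟨fun j => ?_, fun j => ?_, ?_, ?_⟩
  · rw [F.S.pdef, Dp]; exact (mul_div_cancel₀ _ hδ).symm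
  · have h1 := F.S.eqRE j (i + 1) hJ
    simp only [dx, ev, h1]
    rw [F.S.pdef, F.S.pdef]
    simp only [Dp, D2, add_sub_cancel_right]
    generalize L / (N:ℝ) = δ at hδ ⊢
    field_simp; ring
  · rw [F.S.qdef, Dp]; exact (mul_div_cancel₀ _ hδ).symm
  · have h1 := F.S.rel (i + 1) t hJ
    simp only [dx, ev, h1]
    rw [F.S.qdef, F.S.qdef]
    simp only [Dp, D2, add_sub_cancel_right]
    generalize L / (N:ℝ) = δ at hδ ⊢
    field_simp; ring

/-- Lipschitz dependence on the lattice variable. -/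
lemma exists_Df (I : Init L h0) (F : ∀ n, Fam α L a b C h0 (Nn n) (e n) (J n) (V n))
    {B : ℕ → ℝ} (hB : ∀ n i t, 0 ≤ t → t < (Nn n : ℝ) → Bd a b B (V n i t)) :
    ∃ B' : ℕ → ℝ, ∀ n i (m : ℕ) t, 0 ≤ t → t < (Nn n : ℝ) →
      Df B' (L / Nn n * m) (V n (i + m) t) (V n i t) := by
  have hL := I.hL
  have ha : 0 < a := (F 0).S.apos
  have hC : ∀ n, C / (Nn n : ℝ) ≤ |C| := fun n => by
    have : (1:ℝ) ≤ Nn n := by exact_mod_cast (F n).hN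
    calc _ ≤ |C| / (Nn n : ℝ) := by gcongr; exact le_abs_self _
      _ ≤ _ := div_le_self (abs_nonneg _) this
  choose K hK0 hK using fun j => ev_bdall (C := b) ha B (dx α (.p j))
  obtain ⟨Kq, hKq0, hKq⟩ := ev_bdall (C := b) ha B (dx α .q)
  have hB0 : ∀ j, 0 ≤ B j := fun j =>
    (abs_nonneg _).trans ((hB 0 0 0 le_rfl (by exact_mod_cast (F 0).hN)).2.2.1 j)
  have aux : ∀ (n : ℕ) (f g : ℤ → ℝ) (c c' : ℝ), c ≤ c' → (∀ i, f (i + 1) - f i = L / Nn n * g i) →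
      (∀ i, |g i| ≤ c) → ∀ (i : ℤ) (m : ℕ), |f (i + m) - f i| ≤ c' * (L / Nn n * m) := by
    intro n f g c c' hcc hfg hg i m
    have hδ := delta_pos hL (F n).hN
    have := step_lip (f := f) (c := L / Nn n * c') (fun i => by
      rw [hfg, abs_mul, abs_of_pos hδ]
      exact mul_le_mul_of_nonneg_left ((hg i).trans hcc) hδ.le) i m
    linarith
  refine ⟨fun j => B j + K j + Kq + |C|, fun n i m t t0 t1 => ⟨fun j => ?_, fun j => ?_, fun j => ?_,
    ?_, ?_⟩⟩
  · exact aux n (fun i => (V n i t).z j) (fun i => (V n i t).p j) (B j) _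
      (by linarith [hK0 j, abs_nonneg C])
      (fun i => ((F n).dxs hL t0 t1 i).1 j) (fun i => (hB n i t t0 t1).2.2.2.2.1 j) i m
  · rw [(F n).S.lind (i + m), (F n).S.lind i, sub_self, abs_zero]
    have := hB0 j
    have := hK0 j
    positivity
  · exact aux n (fun i => (V n i t).p j) (fun i => ev (V n (i + 1) t) (dx α (.p j))) (K j) _
      (by linarith [hB0 j, abs_nonneg C])
      (fun i => ((F n).dxs hL t0 t1 i).2.1 j) (fun i => hK j _ (hB n (i + 1) t t0 t1)) i m
  · exact aux n (fun i => (V n i t).h) (fun i => (V n i t).q) (B 0) _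
      (by linarith [hK0 0, abs_nonneg C])
      (fun i => ((F n).dxs hL t0 t1 i).2.2.1) (fun i => (hB n i t t0 t1).2.2.2.2.2.2) i m
  · exact aux n (fun i => (V n i t).q) (fun i => ev (V n (i + 1) t) (dx α .q) + e n (i + 1))
      (Kq + |C|) _ (by linarith [hB0 0, hK0 0])
      (fun i => ((F n).dxs hL t0 t1 i).2.2.2)
      (fun i => (abs_add_le _ _).trans (add_le_add (hKq _ (hB n (i + 1) t t0 t1))
        (((F n).eb _).trans (hC n)))) i m

/-- Expressions for which we check the discrete Taylor formula by hand. -/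
def IsAtom : Ex → Prop
  | .z _ => True
  | .l _ => True
  | .p _ => True
  | .h => True
  | .q => True
  | _ => False

lemma space_taylor (I : Init L h0) (F : ∀ n, Fam α L a b C h0 (Nn n) (e n) (J n) (V n))
    {B B' : ℕ → ℝ} (hB : ∀ n i t, 0 ≤ t → t < (Nn n : ℝ) → Bd a b B (V n i t))
    (hD : ∀ n i (m : ℕ) t, 0 ≤ t → t < (Nn n : ℝ) →
      Df B' (L / Nn n * m) (V n (i + m) t) (V n i t)) (x : Ex) (hx : IsAtom x) :
    ∃ K, 0 ≤ K ∧ ∀ n i (m : ℕ) t, 0 ≤ t → t < (Nn n : ℝ) →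
      |ev (V n (i + m) t) x - ev (V n i t) x - L / Nn n * m * ev (V n i t) (dx α x)|
        ≤ L / Nn n * m * (K * (L / Nn n * m) + C / Nn n) := by
  have hL := I.hL
  have ha : 0 < a := (F 0).S.apos
  obtain ⟨K, hK0, hK⟩ := ev_lip (C := b) ha B B' (dx α x)
  refine ⟨K, hK0, fun n i m t t0 t1 => ?_⟩
  have hδ := delta_pos hL (F n).hN
  have hCN : 0 ≤ C / Nn n := (abs_nonneg _).trans ((F n).eb 0)
  refine step_taylor (f := fun i => ev (V n i t) x) hδ.le hK0 (fun r => ?_) m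
  have e1 := hK _ _ (L / Nn n * r) (by positivity) (hB n (i + r) t t0 t1) (hB n i t t0 t1)
    (hD n i r t t0 t1)
  have e2 := hK _ _ (L / Nn n * (r + 1 : ℕ)) (by positivity) (hB n (i + (r + 1 : ℕ)) t t0 t1)
    (hB n i t t0 t1) (hD n i (r + 1) t t0 t1)
  have e3 : i + ((r + 1 : ℕ) : ℤ) = i + r + 1 := by push_cast; ring
  rw [e3] at e2
  push_cast at e2
  obtain ⟨d1, d2, d3, d4⟩ := (F n).dxs hL t0 t1 (i + r)
  have hle : K * (L / Nn n * r) ≤ K * (L / Nn n * (r + 1)) := by gcongr; linarith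
  have fin : ∀ y w : ℝ, |y - ev (V n i t) (dx α x)| ≤ K * (L / Nn n * (r + 1)) → |w| ≤ C / Nn n →
      |L / Nn n * (y + w) - L / Nn n * ev (V n i t) (dx α x)|
        ≤ L / Nn n * (K * (L / Nn n * (r + 1)) + C / Nn n) := by
    intro y w hy hw
    rw [← mul_sub, abs_mul, abs_of_pos hδ]
    refine mul_le_mul_of_nonneg_left ?_ hδ.le
    calc _ = |(y - ev (V n i t) (dx α x)) + w| := by ring_nf
      _ ≤ _ := (abs_add_le _ _).trans (add_le_add hy hw)
  have hz : |(0:ℝ)| ≤ C / Nn n := by simpa using hCN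
  cases x with
  | z j =>
    have := fin _ 0 (e1.trans hle) hz
    simp only [dx, ev, add_zero] at this ⊢
    rw [d1]; exact this
  | l j =>
    simp only [dx, ev, mul_zero, sub_zero]
    rw [(F n).S.lind (i + r + 1), (F n).S.lind (i + r), sub_self, abs_zero]
    positivity
  | p j =>
    have := fin _ 0 e2 hz
    rw [add_zero] at this
    have e4 := d2 j
    simp only [ev] at e4 ⊢
    rw [e4]; exact this
  | h =>
    have := fin _ 0 (e1.trans hle) hz
    simp only [dx, ev, add_zero] at this ⊢
    rw [d3]; exact this
  | q =>
    have := fin _ _ e2 ((F n).eb (i + r + 1))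
    have e4 := d4
    simp only [ev] at e4 ⊢
    rw [e4]; exact this
  | c => exact hx.elim
  | pw => exact hx.elim
  | add => exact hx.elim
  | mul => exact hx.elim

lemma time_taylor (F : ∀ n, Fam α L a b C h0 (Nn n) (e n) (J n) (V n))
    {B : ℕ → ℝ} (hB : ∀ n i t, 0 ≤ t → t < (Nn n : ℝ) → Bd a b B (V n i t)) (x : Ex) :
    ∃ K, 0 ≤ K ∧ ∀ n i t s, 0 ≤ t → t < (Nn n : ℝ) → 0 ≤ s → s < (Nn n : ℝ) →
      |ev (V n i s) x - ev (V n i t) x - (s - t) * ev (V n i t) (dt x)| ≤ K * |s - t| ^ 2 := by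
  have ha : 0 < a := (F 0).S.apos
  obtain ⟨K, hK0, hK⟩ := ev_bdall (C := b) ha B (dt (dt x))
  refine ⟨K, hK0, fun n i t s t0 t1 s0 s1 => ?_⟩
  have hsub : ∀ r ∈ Set.uIcc t s, 0 ≤ r ∧ r < (Nn n : ℝ) := fun r hr => by
    rcases Set.mem_uIcc.1 hr with h | h <;> constructor <;> linarith [h.1, h.2]
  have hlip : ∀ r ∈ Set.uIcc t s, |ev (V n i r) (dt x) - ev (V n i t) (dt x)| ≤ K * |r - t| := by
    intro r hr
    have := Convex.norm_image_sub_le_of_norm_hasDerivWithin_le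
      (f := fun r => ev (V n i r) (dt x)) (f' := fun r => ev (V n i r) (dt (dt x)))
      (s := Set.uIcc t s) (C := K) (x := t) (y := r)
      (fun r hr => ((F n).S.dev i ((F n).dom r (hsub r hr).1 (hsub r hr).2) _).hasDerivWithinAt)
      (fun r hr => hK _ (hB n i r (hsub r hr).1 (hsub r hr).2)) (convex_uIcc _ _)
      Set.left_mem_uIcc hr
    simpa using this
  have := Convex.norm_image_sub_le_of_norm_hasDerivWithin_le
      (f := fun r => ev (V n i r) x - r * ev (V n i t) (dt x))
      (f' := fun r => ev (V n i r) (dt x) - 1 * ev (V n i t) (dt x))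
      (s := Set.uIcc t s) (C := K * |s - t|) (x := t) (y := s)
      (fun r hr => (((F n).S.dev i ((F n).dom r (hsub r hr).1 (hsub r hr).2) _).sub
        ((hasDerivAt_id r).mul_const _)).hasDerivWithinAt)
      (fun r hr => by
        rw [one_mul]
        refine (hlip r hr).trans ?_
        have : |r - t| ≤ |s - t| := Set.abs_sub_left_of_mem_uIcc hr
        gcongr) (convex_uIcc _ _) Set.left_mem_uIcc Set.right_mem_uIcc
  simp only [norm_eq_abs] at this
  calc _ = |ev (V n i s) x - s * ev (V n i t) (dt x) - (ev (V n i t) x - t * ev (V n i t) (dt x))| := by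
        ring_nf
    _ ≤ _ := this
    _ = _ := by ring

end seq
end APF

namespace APF

lemma ulim_tendsto (φ : Ultrafilter ℕ) {u : ℕ → ℝ} {B : ℝ} (h : ∀ᶠ n in (φ : Filter ℕ), |u n| ≤ B) :
    Tendsto u φ (nhds (limUnder (φ : Filter ℕ) u)) := by
  apply tendsto_nhds_limUnder
  have h1 : Set.Icc (-B) B ∈ φ.map u := by
    rw [Ultrafilter.mem_map]
    filter_upwards [h] with n hn using abs_le.1 hn
  obtain ⟨x, -, hx⟩ := isCompact_Icc.ultrafilter_le_nhds' (φ.map u) h1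
  exact ⟨x, hx⟩

/-- Lattice index of a point. -/
noncomputable def ix (L : ℝ) (N : ℕ) (x : ℝ) : ℤ := ⌊x * N / L⌋

lemma ix_add {L : ℝ} (hL : 0 < L) (N : ℕ) (x : ℝ) : ix L N (x + 2 * L) = ix L N x + 2 * N := by
  have h1 : (x + 2 * L) * N / L = x * N / L + ((2 * N : ℤ) : ℝ) := by push_cast; field_simp
  unfold ix
  rw [h1, Int.floor_add_intCast]

lemma ix_zero (L : ℝ) (N : ℕ) : ix L N 0 = 0 := by simp [ix]

lemma ix_L {L : ℝ} (hL : 0 < L) (N : ℕ) : ix L N L = N := by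
  have h1 : L * N / L = ((N : ℤ) : ℝ) := by push_cast; field_simp
  unfold ix
  rw [h1, Int.floor_intCast]

lemma ix_mono {L : ℝ} (hL : 0 < L) (N : ℕ) {x y : ℝ} (h : x ≤ y) : ix L N x ≤ ix L N y := by
  apply Int.floor_mono; gcongr

lemma ix_near {L : ℝ} (hL : 0 < L) {N : ℕ} (hN : 0 < N) (x : ℝ) :
    |L / N * ix L N x - x| ≤ L / N := by
  have hN' : (0:ℝ) < N := by exact_mod_cast hN
  have h1 := Int.floor_le (x * N / L)
  have h2 := Int.lt_floor_add_one (x * N / L)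
  have h3 : L / N * (x * N / L) = x := by field_simp
  have hδ := delta_pos hL hN
  have h4 := mul_le_mul_of_nonneg_left h1 hδ.le
  have h5 := mul_le_mul_of_nonneg_left h2.le hδ.le
  rw [h3] at h4 h5
  unfold ix
  rw [abs_le]; constructor <;> linarith

section seq
variable {α L a b C : ℝ} {h0 : ℝ → ℝ} {Nn : ℕ → ℕ} {e : ℕ → ℤ → ℝ} {J : ℕ → Set ℝ}
  {V : ℕ → ℤ → ℝ → Env} {B B' : ℕ → ℝ} {φ : Ultrafilter ℕ}

structure Lim (α L a b C : ℝ) (h0 : ℝ → ℝ) (Nn : ℕ → ℕ) (e : ℕ → ℤ → ℝ) (J : ℕ → Set ℝ)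
    (V : ℕ → ℤ → ℝ → Env) (B B' : ℕ → ℝ) (φ : Ultrafilter ℕ) : Prop where
  hα : 0 < α
  I : Init L h0
  F : ∀ n, Fam α L a b C h0 (Nn n) (e n) (J n) (V n)
  hB : ∀ n i t, 0 ≤ t → t < (Nn n : ℝ) → Bd a b B (V n i t)
  hD : ∀ n i (m : ℕ) t, 0 ≤ t → t < (Nn n : ℝ) →
      Df B' (L / Nn n * m) (V n (i + m) t) (V n i t)
  hNn : Tendsto Nn φ atTop

noncomputable def UU (L : ℝ) (Nn : ℕ → ℕ) (V : ℕ → ℤ → ℝ → Env) (φ : Ultrafilter ℕ) (x t : ℝ) : Env where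
  z j := limUnder (φ : Filter ℕ) (fun n => (V n (ix L (Nn n) x) t).z j)
  l j := limUnder (φ : Filter ℕ) (fun n => (V n (ix L (Nn n) x) t).l j)
  p j := limUnder (φ : Filter ℕ) (fun n => (V n (ix L (Nn n) x) t).p j)
  h := limUnder (φ : Filter ℕ) (fun n => (V n (ix L (Nn n) x) t).h)
  q := limUnder (φ : Filter ℕ) (fun n => (V n (ix L (Nn n) x) t).q)

namespace Lim

lemma hNr (H : Lim α L a b C h0 Nn e J V B B' φ) : Tendsto (fun n => (Nn n : ℝ)) φ atTop :=
  tendsto_natCast_atTop_atTop.comp H.hNn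

lemma evt (H : Lim α L a b C h0 Nn e J V B B' φ) (t : ℝ) : ∀ᶠ n in (φ : Filter ℕ), t < (Nn n : ℝ) := H.hNr.eventually_gt_atTop t

lemma evBd (H : Lim α L a b C h0 Nn e J V B B' φ) {t : ℝ} (t0 : 0 ≤ t) (x : ℝ) :
    ∀ᶠ n in (φ : Filter ℕ), Bd a b B (V n (ix L (Nn n) x) t) := by
  filter_upwards [H.evt t] with n hn using H.hB n _ t t0 hn

lemma tz (H : Lim α L a b C h0 Nn e J V B B' φ) {t : ℝ} (t0 : 0 ≤ t) (x : ℝ) (j : ℕ) :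
    Tendsto (fun n => (V n (ix L (Nn n) x) t).z j) φ (nhds ((UU L Nn V φ x t).z j)) :=
  ulim_tendsto φ (B := B j) ((H.evBd t0 x).mono fun n hn => hn.2.2.1 j)
lemma tl (H : Lim α L a b C h0 Nn e J V B B' φ) {t : ℝ} (t0 : 0 ≤ t) (x : ℝ) (j : ℕ) :
    Tendsto (fun n => (V n (ix L (Nn n) x) t).l j) φ (nhds ((UU L Nn V φ x t).l j)) :=
  ulim_tendsto φ (B := B j) ((H.evBd t0 x).mono fun n hn => hn.2.2.2.1 j)
lemma tp (H : Lim α L a b C h0 Nn e J V B B' φ) {t : ℝ} (t0 : 0 ≤ t) (x : ℝ) (j : ℕ) :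
    Tendsto (fun n => (V n (ix L (Nn n) x) t).p j) φ (nhds ((UU L Nn V φ x t).p j)) :=
  ulim_tendsto φ (B := B j) ((H.evBd t0 x).mono fun n hn => hn.2.2.2.2.1 j)
lemma th (H : Lim α L a b C h0 Nn e J V B B' φ) {t : ℝ} (t0 : 0 ≤ t) (x : ℝ) :
    Tendsto (fun n => (V n (ix L (Nn n) x) t).h) φ (nhds ((UU L Nn V φ x t).h)) :=
  ulim_tendsto φ (B := B 0) ((H.evBd t0 x).mono fun n hn => hn.2.2.2.2.2.1)
lemma tq (H : Lim α L a b C h0 Nn e J V B B' φ) {t : ℝ} (t0 : 0 ≤ t) (x : ℝ) :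
    Tendsto (fun n => (V n (ix L (Nn n) x) t).q) φ (nhds ((UU L Nn V φ x t).q)) :=
  ulim_tendsto φ (B := B 0) ((H.evBd t0 x).mono fun n hn => hn.2.2.2.2.2.2)

lemma apos (H : Lim α L a b C h0 Nn e J V B B' φ) : 0 < a := (H.F 0).S.apos

lemma bd (H : Lim α L a b C h0 Nn e J V B B' φ) {t : ℝ} (t0 : 0 ≤ t) (x : ℝ) : Bd a b B (UU L Nn V φ x t) :=
  ⟨ge_of_tendsto (H.tz t0 x 0) ((H.evBd t0 x).mono fun n hn => hn.1),
   le_of_tendsto (H.tz t0 x 0) ((H.evBd t0 x).mono fun n hn => hn.2.1),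
   fun j => le_of_tendsto (H.tz t0 x j).abs ((H.evBd t0 x).mono fun n hn => hn.2.2.1 j),
   fun j => le_of_tendsto (H.tl t0 x j).abs ((H.evBd t0 x).mono fun n hn => hn.2.2.2.1 j),
   fun j => le_of_tendsto (H.tp t0 x j).abs ((H.evBd t0 x).mono fun n hn => hn.2.2.2.2.1 j),
   le_of_tendsto (H.th t0 x).abs ((H.evBd t0 x).mono fun n hn => hn.2.2.2.2.2.1),
   le_of_tendsto (H.tq t0 x).abs ((H.evBd t0 x).mono fun n hn => hn.2.2.2.2.2.2)⟩

lemma tev (H : Lim α L a b C h0 Nn e J V B B' φ) {t : ℝ} (t0 : 0 ≤ t) (x : ℝ) (y : Ex) :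
    Tendsto (fun n => ev (V n (ix L (Nn n) x) t) y) φ (nhds (ev (UU L Nn V φ x t) y)) :=
  ev_tendsto (H.apos.trans_le (H.bd t0 x).1) (H.tz t0 x) (H.tl t0 x) (H.tp t0 x) (H.th t0 x)
    (H.tq t0 x) y

lemma tdelta (H : Lim α L a b C h0 Nn e J V B B' φ) : Tendsto (fun n => L / (Nn n : ℝ)) φ (nhds 0) :=
  H.hNr.const_div_atTop L

lemma tC (H : Lim α L a b C h0 Nn e J V B B' φ) : Tendsto (fun n => C / (Nn n : ℝ)) φ (nhds 0) :=
  H.hNr.const_div_atTop C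

lemma tix (H : Lim α L a b C h0 Nn e J V B B' φ) (x : ℝ) : Tendsto (fun n => L / Nn n * (ix L (Nn n) x : ℝ)) φ (nhds x) := by
  have h1 : Tendsto (fun n => L / Nn n * (ix L (Nn n) x : ℝ) - x) φ (nhds 0) :=
    squeeze_zero_norm (fun n => ix_near H.I.hL (H.F n).hN x) H.tdelta
  simpa using h1.add_const x

/-- number of lattice steps between two points -/
lemma tm (H : Lim α L a b C h0 Nn e J V B B' φ) {x y : ℝ} (hxy : x ≤ y) :
    Tendsto (fun n => L / Nn n * ((ix L (Nn n) y - ix L (Nn n) x).toNat : ℝ)) φ (nhds (y - x)) := by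
  refine ((H.tix y).sub (H.tix x)).congr fun n => ?_
  have h1 := ix_mono H.I.hL (Nn n) hxy
  have h2 : ((ix L (Nn n) y - ix L (Nn n) x).toNat : ℤ) = ix L (Nn n) y - ix L (Nn n) x :=
    Int.toNat_of_nonneg (by omega)
  have h3 : ((ix L (Nn n) y - ix L (Nn n) x).toNat : ℝ) = ix L (Nn n) y - ix L (Nn n) x := by
    exact_mod_cast h2
  rw [h3]; ring

lemma ixm (H : Lim α L a b C h0 Nn e J V B B' φ) {x y : ℝ} (hxy : x ≤ y) (n : ℕ) :
    ix L (Nn n) x + ((ix L (Nn n) y - ix L (Nn n) x).toNat : ℤ) = ix L (Nn n) y := by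
  have h1 := ix_mono H.I.hL (Nn n) hxy
  omega

lemma df (H : Lim α L a b C h0 Nn e J V B B' φ) {t : ℝ} (t0 : 0 ≤ t) {x y : ℝ} (hxy : x ≤ y) :
    Df B' (y - x) (UU L Nn V φ y t) (UU L Nn V φ x t) := by
  have key : ∀ᶠ n in (φ : Filter ℕ), Df B' (L / Nn n * ((ix L (Nn n) y - ix L (Nn n) x).toNat : ℝ))
      (V n (ix L (Nn n) y) t) (V n (ix L (Nn n) x) t) := by
    filter_upwards [H.evt t] with n hn
    have := H.hD n (ix L (Nn n) x) (ix L (Nn n) y - ix L (Nn n) x).toNat t t0 hn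
    rwa [H.ixm hxy] at this
  refine ⟨fun j => ?_, fun j => ?_, fun j => ?_, ?_, ?_⟩
  · exact le_of_tendsto_of_tendsto ((H.tz t0 y j).sub (H.tz t0 x j)).abs ((H.tm hxy).const_mul _)
      (key.mono fun n hn => hn.1 j)
  · exact le_of_tendsto_of_tendsto ((H.tl t0 y j).sub (H.tl t0 x j)).abs ((H.tm hxy).const_mul _)
      (key.mono fun n hn => hn.2.1 j)
  · exact le_of_tendsto_of_tendsto ((H.tp t0 y j).sub (H.tp t0 x j)).abs ((H.tm hxy).const_mul _)
      (key.mono fun n hn => hn.2.2.1 j)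
  · exact le_of_tendsto_of_tendsto ((H.th t0 y).sub (H.th t0 x)).abs ((H.tm hxy).const_mul _)
      (key.mono fun n hn => hn.2.2.2.1)
  · exact le_of_tendsto_of_tendsto ((H.tq t0 y).sub (H.tq t0 x)).abs ((H.tm hxy).const_mul _)
      (key.mono fun n hn => hn.2.2.2.2)

lemma lipx (H : Lim α L a b C h0 Nn e J V B B' φ) (y : Ex) : ∃ K, 0 ≤ K ∧ ∀ x x' t, 0 ≤ t →
    |ev (UU L Nn V φ x' t) y - ev (UU L Nn V φ x t) y| ≤ K * |x' - x| := by
  obtain ⟨K, hK0, hK⟩ := ev_lip (C := b) H.apos B B' y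
  refine ⟨K, hK0, fun x x' t t0 => ?_⟩
  rcases le_total x x' with h | h
  · rw [abs_of_nonneg (by linarith : 0 ≤ x' - x)]
    exact hK _ _ _ (by linarith) (H.bd t0 x') (H.bd t0 x) (H.df t0 h)
  · rw [abs_sub_comm, abs_sub_comm x', abs_of_nonneg (by linarith : 0 ≤ x - x')]
    exact hK _ _ _ (by linarith) (H.bd t0 x) (H.bd t0 x') (H.df t0 h)

lemma tayx (H : Lim α L a b C h0 Nn e J V B B' φ) (y : Ex) (hy : IsAtom y) : ∃ K, 0 ≤ K ∧ ∀ x x' t, 0 ≤ t →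
    |ev (UU L Nn V φ x' t) y - ev (UU L Nn V φ x t) y
      - (x' - x) * ev (UU L Nn V φ x t) (dx α y)| ≤ K * |x' - x| ^ 2 := by
  obtain ⟨K, hK0, hK⟩ := space_taylor H.I H.F H.hB H.hD y hy
  obtain ⟨K', hK0', hK'⟩ := H.lipx (dx α y)
  have main : ∀ x x' t, 0 ≤ t → x ≤ x' →
    |ev (UU L Nn V φ x' t) y - ev (UU L Nn V φ x t) y
      - (x' - x) * ev (UU L Nn V φ x t) (dx α y)| ≤ (x' - x) * (K * (x' - x) + 0) := by
    intro x x' t t0 h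
    refine le_of_tendsto_of_tendsto (((H.tev t0 x' y).sub (H.tev t0 x y)).sub
      ((H.tm h).mul (H.tev t0 x (dx α y)))).abs
      ((H.tm h).mul (((H.tm h).const_mul K).add H.tC)) ?_
    filter_upwards [H.evt t] with n hn
    have := hK n (ix L (Nn n) x) (ix L (Nn n) x' - ix L (Nn n) x).toNat t t0 hn
    rwa [H.ixm h] at this
  refine ⟨K + K', by positivity, fun x x' t t0 => ?_⟩
  rcases le_total x x' with h | h
  · have := main x x' t t0 h
    rw [sq_abs]
    nlinarith [mul_nonneg hK0' (sq_nonneg (x' - x))]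
  · have h1 := main x' x t t0 h
    have h2 := hK' x x' t t0
    have h3 : |(x - x') * (ev (UU L Nn V φ x' t) (dx α y) - ev (UU L Nn V φ x t) (dx α y))|
        ≤ (x - x') * (K' * (x - x')) := by
      rw [abs_mul, abs_of_nonneg (by linarith : 0 ≤ x - x')]
      rw [abs_sub_comm x', abs_of_nonneg (by linarith : 0 ≤ x - x')] at h2
      exact mul_le_mul_of_nonneg_left h2 (by linarith)
    rw [sq_abs]
    calc _ = |-(ev (UU L Nn V φ x t) y - ev (UU L Nn V φ x' t) y
            - (x - x') * ev (UU L Nn V φ x' t) (dx α y))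
          + -((x - x') * (ev (UU L Nn V φ x' t) (dx α y) - ev (UU L Nn V φ x t) (dx α y)))| := by
          ring_nf
      _ ≤ (x - x') * (K * (x - x') + 0) + (x - x') * (K' * (x - x')) := by
          refine (abs_add_le _ _).trans ?_
          rw [abs_neg, abs_neg]
          exact add_le_add h1 h3
      _ = _ := by ring

lemma tayt (H : Lim α L a b C h0 Nn e J V B B' φ) (y : Ex) : ∃ K, 0 ≤ K ∧ ∀ x t s, 0 ≤ t → 0 ≤ s →
    |ev (UU L Nn V φ x s) y - ev (UU L Nn V φ x t) y
      - (s - t) * ev (UU L Nn V φ x t) (dt y)| ≤ K * |s - t| ^ 2 := by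
  obtain ⟨K, hK0, hK⟩ := time_taylor H.F H.hB y
  refine ⟨K, hK0, fun x t s t0 s0 => ?_⟩
  refine le_of_tendsto (((H.tev s0 x y).sub (H.tev t0 x y)).sub
      ((H.tev t0 x (dt y)).const_mul (s - t))).abs ?_
  filter_upwards [H.evt t, H.evt s] with n hn hs
  exact hK n _ t s t0 hn s0 hs

/-- The formal differential. -/
noncomputable def dF (A B : ℝ) : ℝ × ℝ →L[ℝ] ℝ :=
  A • ContinuousLinearMap.fst ℝ ℝ ℝ + B • ContinuousLinearMap.snd ℝ ℝ ℝ

lemma fd_atom (H : Lim α L a b C h0 Nn e J V B B' φ) (y : Ex) (hy : IsAtom y) (x t : ℝ) (t0 : 0 ≤ t) :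
    HasFDerivWithinAt (fun w : ℝ × ℝ => ev (UU L Nn V φ w.1 w.2) y)
      (dF (ev (UU L Nn V φ x t) (dx α y)) (ev (UU L Nn V φ x t) (dt y)))
      (Set.univ ×ˢ Set.Ici (0:ℝ)) (x, t) := by
  obtain ⟨K1, hK10, hK1⟩ := H.tayx y hy
  obtain ⟨K2, hK20, hK2⟩ := H.tayt y
  obtain ⟨K3, hK30, hK3⟩ := H.lipx (dt y)
  rw [hasFDerivWithinAt_iff_isLittleO]
  have hO : (fun w : ℝ × ℝ => ev (UU L Nn V φ w.1 w.2) y - ev (UU L Nn V φ x t) y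
      - (dF (ev (UU L Nn V φ x t) (dx α y)) (ev (UU L Nn V φ x t) (dt y))) (w - (x, t)))
      =O[nhdsWithin (x, t) (Set.univ ×ˢ Set.Ici (0:ℝ))] fun w => ‖w - (x, t)‖ ^ 2 := by
    refine Asymptotics.IsBigO.of_bound (K1 + K2 + K3) ?_
    filter_upwards [self_mem_nhdsWithin] with w hw
    have hw2 : 0 ≤ w.2 := hw.2
    have e1 := hK1 x w.1 t t0
    have e2 := hK2 w.1 t w.2 t0 hw2
    have e3 := hK3 x w.1 t t0
    have n1 : |w.1 - x| ≤ ‖w - (x, t)‖ := norm_fst_le (w - (x, t))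
    have n2 : |w.2 - t| ≤ ‖w - (x, t)‖ := norm_snd_le (w - (x, t))
    set r := ‖w - (x, t)‖ with hr
    have hr0 : 0 ≤ r := norm_nonneg _
    rw [norm_eq_abs, norm_eq_abs, abs_of_nonneg (by positivity : 0 ≤ r ^ 2)]
    have e4 : |(w.2 - t) * (ev (UU L Nn V φ w.1 t) (dt y) - ev (UU L Nn V φ x t) (dt y))|
        ≤ r * (K3 * r) := by
      rw [abs_mul]
      refine mul_le_mul n2 (e3.trans (by gcongr)) (abs_nonneg _) hr0
    have e1' : K1 * |w.1 - x| ^ 2 ≤ K1 * r ^ 2 := by gcongr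
    have e2' : K2 * |w.2 - t| ^ 2 ≤ K2 * r ^ 2 := by gcongr
    have e5 : ev (UU L Nn V φ w.1 w.2) y - ev (UU L Nn V φ x t) y
        - (dF (ev (UU L Nn V φ x t) (dx α y)) (ev (UU L Nn V φ x t) (dt y))) (w - (x, t))
        = (ev (UU L Nn V φ w.1 t) y - ev (UU L Nn V φ x t) y
            - (w.1 - x) * ev (UU L Nn V φ x t) (dx α y))
          + (ev (UU L Nn V φ w.1 w.2) y - ev (UU L Nn V φ w.1 t) y
            - (w.2 - t) * ev (UU L Nn V φ w.1 t) (dt y))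
          + (w.2 - t) * (ev (UU L Nn V φ w.1 t) (dt y) - ev (UU L Nn V φ x t) (dt y)) := by
      simp only [dF, add_apply, ContinuousLinearMap.smul_apply, ContinuousLinearMap.coe_fst',
        ContinuousLinearMap.coe_snd', Prod.fst_sub, Prod.snd_sub, smul_eq_mul,
        ContinuousLinearMap.add_apply]
      ring
    rw [e5]
    refine (abs_add_le _ _).trans ((add_le_add (abs_add_le _ _) le_rfl).trans ?_)
    nlinarith
  refine hO.trans_isLittleO ?_
  have hl : (fun w : ℝ × ℝ => ‖w - (x, t)‖ ^ 2) =o[nhds (x, t)] fun w => w - (x, t) := by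
    have := (Asymptotics.isLittleO_pow_id (𝕜 := ℝ) (n := 2) one_lt_two).comp_tendsto
      (k := fun w : ℝ × ℝ => ‖w - (x, t)‖) (l' := nhds (x, t))
      (by
        have : Continuous fun w : ℝ × ℝ => ‖w - (x, t)‖ := by fun_prop
        simpa using this.tendsto (x, t))
    exact (Asymptotics.isLittleO_norm_right.1 this)
  exact hl.mono nhdsWithin_le_nhds

lemma fd (H : Lim α L a b C h0 Nn e J V B B' φ) (y : Ex) (x t : ℝ) (t0 : 0 ≤ t) :
    HasFDerivWithinAt (fun w : ℝ × ℝ => ev (UU L Nn V φ w.1 w.2) y)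
      (dF (ev (UU L Nn V φ x t) (dx α y)) (ev (UU L Nn V φ x t) (dt y)))
      (Set.univ ×ˢ Set.Ici (0:ℝ)) (x, t) := by
  induction y with
  | c r =>
    refine (hasFDerivWithinAt_const r _ _).congr_fderiv ?_
    ext <;> simp [dF, dx, dt, ev]
  | pw s =>
    have h1 := H.fd_atom (.z 0) trivial x t t0
    have hp : (UU L Nn V φ x t).z 0 ≠ 0 := (H.apos.trans_le (H.bd t0 x).1).ne'
    have h2 := (Real.hasDerivAt_rpow_const (p := s) (Or.inl hp)).comp_hasFDerivWithinAt (x, t) h1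
    refine h2.congr_fderiv ?_
    ext <;> simp [dF, dx, dt, ev] <;> ring
  | z j => exact H.fd_atom (.z j) trivial x t t0
  | l j => exact H.fd_atom (.l j) trivial x t t0
  | p j => exact H.fd_atom (.p j) trivial x t t0
  | h => exact H.fd_atom .h trivial x t t0
  | q => exact H.fd_atom .q trivial x t t0
  | add u v ihu ihv =>
    refine (ihu.add ihv).congr_fderiv ?_
    ext <;> simp [dF, dx, dt, ev]
  | mul u v ihu ihv =>
    refine (ihu.mul ihv).congr_fderiv ?_
    ext <;> simp [dF, dx, dt, ev] <;> ring

end Lim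
end seq
end APF

namespace APF
section seq
variable {α L a b C : ℝ} {h0 : ℝ → ℝ} {Nn : ℕ → ℕ} {e : ℕ → ℤ → ℝ} {J : ℕ → Set ℝ}
  {V : ℕ → ℤ → ℝ → Env} {B B' : ℕ → ℝ} {φ : Ultrafilter ℕ}

lemma uniq_half : UniqueDiffOn ℝ ((Set.univ : Set ℝ) ×ˢ Set.Ici (0:ℝ)) :=
  uniqueDiffOn_univ.prod (uniqueDiffOn_Ici 0)

lemma Lim.smooth_nat (H : Lim α L a b C h0 Nn e J V B B' φ) (n : ℕ) : ∀ y : Ex,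
    ContDiffOn ℝ n (fun w : ℝ × ℝ => ev (UU L Nn V φ w.1 w.2) y) (Set.univ ×ˢ Set.Ici (0:ℝ)) := by
  induction n with
  | zero =>
    intro y
    rw [Nat.cast_zero, contDiffOn_zero]
    rintro ⟨x, t⟩ hw
    exact (H.fd y x t hw.2).continuousWithinAt
  | succ n ih =>
    intro y
    rw [Nat.cast_succ, contDiffOn_succ_iff_hasFDerivWithinAt_of_uniqueDiffOn uniq_half]
    refine ⟨by simp, fun w => Lim.dF (ev (UU L Nn V φ w.1 w.2) (dx α y)) (ev (UU L Nn V φ w.1 w.2) (dt y)), ?_, ?_⟩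
    · unfold Lim.dF
      exact ((ih (dx α y)).smul contDiffOn_const).add ((ih (dt y)).smul contDiffOn_const)
    · rintro ⟨x, t⟩ hw
      exact H.fd y x t hw.2

lemma Lim.smooth (H : Lim α L a b C h0 Nn e J V B B' φ) (y : Ex) :
    ContDiffOn ℝ (⊤ : ℕ∞) (fun w : ℝ × ℝ => ev (UU L Nn V φ w.1 w.2) y)
      (Set.univ ×ˢ Set.Ici (0:ℝ)) :=
  contDiffOn_infty.2 fun n => H.smooth_nat n y

lemma Lim.hdx (H : Lim α L a b C h0 Nn e J V B B' φ) (y : Ex) (x : ℝ) {t : ℝ} (t0 : 0 ≤ t) :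
    HasDerivAt (fun x => ev (UU L Nn V φ x t) y) (ev (UU L Nn V φ x t) (dx α y)) x := by
  have h1 := H.fd y x t t0
  have h2 : HasDerivWithinAt (fun x : ℝ => (x, t)) ((1:ℝ), (0:ℝ)) Set.univ x :=
    ((hasDerivAt_id x).prodMk (hasDerivAt_const x t)).hasDerivWithinAt
  have h3 := h1.comp_hasDerivWithinAt (t := Set.univ ×ˢ Set.Ici (0:ℝ)) x h2 (fun s _ => ⟨trivial, t0⟩)
  rw [hasDerivWithinAt_univ] at h3
  refine h3.congr_deriv ?_
  simp [Lim.dF]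

lemma Lim.hdt (H : Lim α L a b C h0 Nn e J V B B' φ) (y : Ex) (x : ℝ) {t : ℝ} (t0 : 0 ≤ t) :
    HasDerivWithinAt (fun t => ev (UU L Nn V φ x t) y) (ev (UU L Nn V φ x t) (dt y)) (Set.Ici 0) t := by
  have h1 := H.fd y x t t0
  have h2 : HasDerivWithinAt (fun t : ℝ => (x, t)) ((0:ℝ), (1:ℝ)) (Set.Ici 0) t :=
    ((hasDerivAt_const t x).prodMk (hasDerivAt_id t)).hasDerivWithinAt
  have h3 := h1.comp_hasDerivWithinAt (t := Set.univ ×ˢ Set.Ici (0:ℝ)) t h2 (fun s hs => ⟨trivial, hs⟩)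
  refine h3.congr_deriv ?_
  simp [Lim.dF]

lemma Lim.uper (H : Lim α L a b C h0 Nn e J V B B' φ) (x t : ℝ) :
    UU L Nn V φ (x + 2 * L) t = UU L Nn V φ x t := by
  have : ∀ n, V n (ix L (Nn n) (x + 2 * L)) t = V n (ix L (Nn n) x) t := fun n => by
    rw [ix_add H.I.hL, (H.F n).S.per]
  unfold UU
  simp only [this]

lemma Lim.u_start (H : Lim α L a b C h0 Nn e J V B B' φ) (x : ℝ) :
    (UU L Nn V φ x 0).h = h0 x := by
  refine tendsto_nhds_unique (H.th le_rfl x) ?_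
  refine ((H.I.sm.continuous.tendsto x).comp (H.tix x)).congr fun n => ?_
  rw [Function.comp, (H.F n).ih, mul_comm]

lemma Lim.uind (H : Lim α L a b C h0 Nn e J V B B' φ) (x t : ℝ) (j : ℕ) :
    (UU L Nn V φ x t).l j = (UU L Nn V φ 0 t).l j := by
  unfold UU
  simp only
  congr 1
  funext n
  rw [(H.F n).S.lind, (H.F n).S.lind (ix L (Nn n) 0)]

lemma Lim.uord (H : Lim α L a b C h0 Nn e J V B B' φ) (x : ℝ) {t : ℝ} (t0 : 0 ≤ t) :
    ((UU L Nn V φ L t).z 0 ≤ (UU L Nn V φ x t).z 0 ∧ (UU L Nn V φ x t).z 0 ≤ (UU L Nn V φ 0 t).z 0)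
    ∧ ((UU L Nn V φ L t).z 0 ≤ (UU L Nn V φ x t).l 0 ∧ (UU L Nn V φ x t).l 0 ≤ (UU L Nn V φ 0 t).z 0) := by
  refine ⟨⟨le_of_tendsto_of_tendsto (H.tz t0 L 0) (H.tz t0 x 0) ?_,
    le_of_tendsto_of_tendsto (H.tz t0 x 0) (H.tz t0 0 0) ?_⟩,
    le_of_tendsto_of_tendsto (H.tz t0 L 0) (H.tl t0 x 0) ?_,
    le_of_tendsto_of_tendsto (H.tl t0 x 0) (H.tz t0 0 0) ?_⟩
  · filter_upwards [H.evt t] with n hn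
    rw [ix_L H.I.hL]; exact ((H.F n).ord _ t t0 hn).1
  · filter_upwards [H.evt t] with n hn
    rw [ix_zero]; exact ((H.F n).ord _ t t0 hn).2
  · filter_upwards [H.evt t] with n hn
    rw [ix_L H.I.hL]; exact ((H.F n).ordl _ t t0 hn).1
  · filter_upwards [H.evt t] with n hn
    rw [ix_zero]; exact ((H.F n).ordl _ t t0 hn).2

/-- discrete primitive -/
noncomputable def WW (δ : ℝ) (g : ℤ → ℝ) (i : ℤ) : ℝ := δ * ∑ k ∈ Finset.range i.toNat, g (k : ℤ)

lemma WW_step {δ : ℝ} {g : ℤ → ℝ} {K : ℝ} (hδ : 0 ≤ δ) (hK : 0 ≤ K)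
    (hg : ∀ i (m : ℕ), |g (i + m) - g i| ≤ K * (δ * m)) {i : ℤ} (hi : 0 ≤ i) (m : ℕ) :
    |WW δ g (i + m) - WW δ g i - δ * m * g i| ≤ δ * m * (K * (δ * m) + 0) := by
  refine step_taylor hδ hK (fun m => ?_) m
  have h1 : WW δ g (i + m + 1) - WW δ g (i + m) = δ * g (i + m) := by
    unfold WW
    have : (i + m + 1).toNat = (i + m).toNat + 1 := by omega
    rw [this, Finset.sum_range_succ]
    have : ((i + m).toNat : ℤ) = i + m := by omega
    rw [this]; ring
  rw [h1, ← mul_sub, abs_mul, abs_of_nonneg hδ]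
  refine mul_le_mul_of_nonneg_left ((hg i m).trans ?_) hδ
  have : K * (δ * m) ≤ K * (δ * (m + 1)) := by gcongr; linarith
  linarith

lemma Lim.int_TE (H : Lim α L a b C h0 Nn e J V B B' φ) {t : ℝ} (t0 : 0 ≤ t) :
    ∫ x in (0:ℝ)..(2 * L), ev (UU L Nn V φ x t) (TE α 0) = 0 := by
  obtain ⟨K, hK0, hK⟩ := ev_lip (C := b) H.apos B B' (TE α 0)
  obtain ⟨M, hM0, hM⟩ := ev_bdall (C := b) H.apos B (TE α 0)
  have hL := H.I.hL
  set W : ℕ → ℝ → ℝ := fun n x => WW (L / Nn n) (fun i => ev (V n i t) (TE α 0)) (ix L (Nn n) x) with hW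
  have key : ∀ x y, 0 ≤ x → x ≤ y → ∀ᶠ n in (φ : Filter ℕ),
      |W n y - W n x - L / Nn n * ((ix L (Nn n) y - ix L (Nn n) x).toNat : ℝ)
          * ev (V n (ix L (Nn n) x) t) (TE α 0)|
        ≤ L / Nn n * ((ix L (Nn n) y - ix L (Nn n) x).toNat : ℝ)
          * (K * (L / Nn n * ((ix L (Nn n) y - ix L (Nn n) x).toNat : ℝ)) + 0) := by
    intro x y hx hxy
    filter_upwards [H.evt t] with n hn
    have hi : 0 ≤ ix L (Nn n) x := by
      have := ix_mono hL (Nn n) hx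
      rwa [ix_zero] at this
    have hδ := (delta_pos hL (H.F n).hN).le
    have := WW_step (g := fun i => ev (V n i t) (TE α 0)) hδ hK0
      (fun i m => hK _ _ _ (by positivity) (H.hB n _ t t0 hn)
        (H.hB n _ t t0 hn) (H.hD n i m t t0 hn)) hi (ix L (Nn n) y - ix L (Nn n) x).toNat
    rwa [H.ixm hxy] at this
  have W0 : ∀ n, W n 0 = 0 := fun n => by simp [hW, WW, ix_zero]
  have hb : ∀ y, 0 ≤ y → ∀ᶠ n in (φ : Filter ℕ), |W n y| ≤ (y + 1) * M + (y + 1) * (K * (y + 1)) := by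
    intro y hy
    filter_upwards [key 0 y le_rfl hy, H.evBd t0 0,
      (H.tm hy).eventually_le_const (show y - 0 < y + 1 by linarith)] with n h1 h2 h3
    rw [W0, sub_zero] at h1
    have h4 := hM _ h2
    have hδ := (delta_pos hL (H.F n).hN).le
    set r := L / Nn n * ((ix L (Nn n) y - ix L (Nn n) 0).toNat : ℝ)
    have hr : 0 ≤ r := by positivity
    set g := ev (V n (ix L (Nn n) 0) t) (TE α 0)
    have h5 : |r * g| ≤ (y + 1) * M := by
      rw [abs_mul, abs_of_nonneg hr]; gcongr
    have h6 : r * (K * r + 0) ≤ (y + 1) * (K * (y + 1)) := by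
      rw [add_zero]; gcongr
    calc |W n y| = |(W n y - r * g) + r * g| := by ring_nf
      _ ≤ _ := (abs_add_le _ _).trans (by linarith)
  set w : ℝ → ℝ := fun x => limUnder (φ : Filter ℕ) fun n => W n x with hw
  have tw : ∀ y, 0 ≤ y → Tendsto (fun n => W n y) φ (nhds (w y)) := fun y hy =>
    ulim_tendsto φ (hb y hy)
  have w0 : w 0 = 0 := tendsto_nhds_unique (tw 0 le_rfl) (by simp [W0])
  have w2 : w (2 * L) = 0 := by
    refine tendsto_nhds_unique (tw _ (by linarith)) (Tendsto.congr' ?_ tendsto_const_nhds)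
    filter_upwards [H.evt t] with n hn
    have h1 := (H.F n).S.sum t ((H.F n).dom t t0 hn)
    have h2 : ix L (Nn n) (2 * L) = 2 * Nn n := by
      have := ix_add hL (Nn n) 0
      rwa [ix_zero, zero_add, zero_add] at this
    have h3 : (2 * (Nn n : ℤ)).toNat = 2 * Nn n := by omega
    simp only [hW, WW, h2, h3]
    exact h1.symm
  have est : ∀ x y, 0 ≤ x → x ≤ y → |w y - w x - (y - x) * ev (UU L Nn V φ x t) (TE α 0)|
      ≤ (y - x) * (K * (y - x) + 0) := by
    intro x y hx hxy
    exact le_of_tendsto_of_tendsto (((tw y (hx.trans hxy)).sub (tw x hx)).sub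
      ((H.tm hxy).mul (H.tev t0 x _))).abs ((H.tm hxy).mul (((H.tm hxy).const_mul K).add_const 0))
      (key x y hx hxy)
  have hbd : ∀ x, |ev (UU L Nn V φ x t) (TE α 0)| ≤ M := fun x => hM _ (H.bd t0 x)
  have hcont : Continuous fun x => ev (UU L Nn V φ x t) (TE α 0) :=
    continuous_iff_continuousAt.2 fun x => (H.hdx _ x t0).continuousAt
  have lip : ∀ x y, 0 ≤ x → x ≤ y → y ≤ 2 * L → |w y - w x| ≤ (M + K * (2 * L)) * (y - x) := by
    intro x y hx hxy hy
    have h1 := est x y hx hxy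
    have h2 : |(y - x) * ev (UU L Nn V φ x t) (TE α 0)| ≤ (y - x) * M := by
      rw [abs_mul, abs_of_nonneg (by linarith : 0 ≤ y - x)]
      exact mul_le_mul_of_nonneg_left (hbd x) (by linarith)
    have h3 : (y - x) * (K * (y - x) + 0) ≤ (y - x) * (K * (2 * L)) := by
      rw [add_zero]
      exact mul_le_mul_of_nonneg_left (mul_le_mul_of_nonneg_left (by linarith) hK0) (by linarith)
    calc |w y - w x| = |(w y - w x - (y - x) * ev (UU L Nn V φ x t) (TE α 0))
          + (y - x) * ev (UU L Nn V φ x t) (TE α 0)| := by ring_nf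
      _ ≤ _ := (abs_add_le _ _).trans (by linarith)
  have hlip : LipschitzOnWith (M + K * (2 * L)).toNNReal w (Set.Icc 0 (2 * L)) := by
    refine LipschitzOnWith.of_dist_le_mul fun x hx y hy => ?_
    rw [Real.dist_eq, Real.dist_eq, Real.coe_toNNReal _ (by positivity)]
    rcases le_total x y with h | h
    · rw [abs_sub_comm, abs_sub_comm x, abs_of_nonneg (by linarith : 0 ≤ y - x)]
      exact lip x y hx.1 h hy.2
    · rw [abs_of_nonneg (by linarith : 0 ≤ x - y)]
      exact lip y x hy.1 h hx.2
  have := intervalIntegral.integral_eq_sub_of_hasDeriv_right_of_le (a := 0) (b := 2 * L) (f := w)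
    (f' := fun x => ev (UU L Nn V φ x t) (TE α 0)) (by linarith) hlip.continuousOn
    (fun x hx => ?_) (hcont.intervalIntegrable _ _)
  · rw [this, w0, w2, sub_zero]
  · rw [hasDerivWithinAt_iff_isLittleO]
    have hO : (fun y => w y - w x - (y - x) • ev (UU L Nn V φ x t) (TE α 0))
        =O[nhdsWithin x (Set.Ioi x)] fun y => (y - x) ^ 2 := by
      refine Asymptotics.IsBigO.of_bound K ?_
      filter_upwards [self_mem_nhdsWithin] with y hy
      have := est x y hx.1.le (le_of_lt hy)
      rw [norm_eq_abs, norm_eq_abs, abs_of_nonneg (sq_nonneg (y - x)), smul_eq_mul]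
      linarith
    refine hO.trans_isLittleO ?_
    have := (Asymptotics.isLittleO_pow_id (𝕜 := ℝ) (n := 2) one_lt_two).comp_tendsto
      (k := fun y : ℝ => y - x) (l' := nhds x)
      (by
        have : Continuous fun y : ℝ => y - x := by fun_prop
        simpa using this.tendsto x)
    exact this.mono nhdsWithin_le_nhds

lemma exists_Lim (hα : 0 < α) (I : Init L h0) : ∃ a b C Nn e J V B B' φ,
    Lim α L a b C h0 Nn e J V B B' φ := by
  obtain ⟨a, b, C, N0, ha, hF⟩ := exists_fam hα I
  choose e J V F using fun n : ℕ => hF (N0 + n + 1) (by omega)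
  obtain ⟨B, hB⟩ := exists_Bd hα I F
  obtain ⟨B', hD⟩ := exists_Df I F hB
  refine ⟨a, b, C, fun n => N0 + n + 1, e, J, V, B, B', Filter.hyperfilter ℕ, hα, I, F, hB, hD, ?_⟩
  refine (tendsto_atTop_mono (fun n => ?_) tendsto_id).mono_left Nat.hyperfilter_le_atTop
  simp only [id]; omega

end seq
end APF

namespace APF

/-- A global solution of the flow, with its formal jet. -/
structure Flow (α L a b : ℝ) (B : ℕ → ℝ) (h0 : ℝ → ℝ) (U : ℝ → ℝ → Env) : Prop where
  hα : 0 < α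
  hL : 0 < L
  apos : 0 < a
  bd : ∀ x t, 0 ≤ t → Bd a b B (U x t)
  sm : ∀ y, ContDiffOn ℝ (⊤ : ℕ∞) (fun w : ℝ × ℝ => ev (U w.1 w.2) y) (Set.univ ×ˢ Set.Ici (0:ℝ))
  hdx : ∀ y x t, 0 ≤ t → HasDerivAt (fun x => ev (U x t) y) (ev (U x t) (dx α y)) x
  hdt : ∀ y x t, 0 ≤ t →
    HasDerivWithinAt (fun t => ev (U x t) y) (ev (U x t) (dt y)) (Set.Ici 0) t
  per : ∀ x t, U (x + 2 * L) t = U x t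
  start : ∀ x, (U x 0).h = h0 x
  ind : ∀ x t j, (U x t).l j = (U 0 t).l j
  ord : ∀ x t, 0 ≤ t → (U L t).z 0 ≤ (U x t).z 0 ∧ (U x t).z 0 ≤ (U 0 t).z 0
  ordl : ∀ x t, 0 ≤ t → (U L t).z 0 ≤ (U x t).l 0 ∧ (U x t).l 0 ≤ (U 0 t).z 0
  int_TE : ∀ t, 0 ≤ t → ∫ x in (0:ℝ)..(2 * L), ev (U x t) (TE α 0) = 0

lemma exists_Flow {α L : ℝ} {h0 : ℝ → ℝ} (hα : 0 < α) (I : Init L h0) :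
    ∃ a b B U, Flow α L a b B h0 U := by
  obtain ⟨a, b, C, Nn, e, J, V, B, B', φ, H⟩ := exists_Lim hα I
  exact ⟨a, b, B, UU L Nn V φ, hα, I.hL, H.apos, fun x t t0 => H.bd t0 x, H.smooth,
    fun y x t t0 => H.hdx y x t0, fun y x t t0 => H.hdt y x t0, H.uper, H.u_start, H.uind,
    fun x t t0 => (H.uord x t0).1, fun x t t0 => (H.uord x t0).2, fun t t0 => H.int_TE t0⟩

lemma landau {f f' : ℝ → ℝ} {x s A B : ℝ} (hs : 0 < s) (hc : ContinuousOn f (Set.Icc x (x + s)))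
    (hd : ∀ y ∈ Set.Ioo x (x + s), HasDerivAt f (f' y) y)
    (hl : ∀ y ∈ Set.Ioo x (x + s), |f' y - f' x| ≤ B) (hA : |f (x + s) - f x| ≤ A) :
    |f' x| ≤ A / s + B := by
  obtain ⟨y, hy, h⟩ := exists_hasDerivAt_eq_slope f f' (by linarith) hc hd
  have h1 : |f' y| ≤ A / s := by
    rw [h, add_sub_cancel_left, abs_div, abs_of_pos hs]; gcongr
  calc |f' x| = |f' y - (f' y - f' x)| := by ring_nf
    _ ≤ _ := (abs_sub _ _).trans (add_le_add h1 (hl y hy))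

section fl
variable {α L a b : ℝ} {B : ℕ → ℝ} {h0 : ℝ → ℝ} {U : ℝ → ℝ → Env}

lemma Flow.cont (F : Flow α L a b B h0 U) (y : Ex) {t : ℝ} (t0 : 0 ≤ t) :
    Continuous fun x => ev (U x t) y :=
  continuous_iff_continuousAt.2 fun x => (F.hdx y x t t0).continuousAt

lemma Flow.zpos (F : Flow α L a b B h0 U) (x : ℝ) {t : ℝ} (t0 : 0 ≤ t) : 0 < (U x t).z 0 :=
  F.apos.trans_le (F.bd x t t0).1

lemma Flow.rpos (F : Flow α L a b B h0 U) (x : ℝ) {t : ℝ} (t0 : 0 ≤ t) : 0 < ev (U x t) (rhoE α) :=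
  Real.rpow_pos_of_pos (F.zpos x t0) _

lemma Flow.int_h (F : Flow α L a b B h0 U) {t : ℝ} (t0 : 0 ≤ t) :
    ∫ x in (0:ℝ)..(2 * L), (U x t).h = ∫ x in (0:ℝ)..(2 * L), ev (U x t) (rhoE α) := by
  have h1 := intervalIntegral.integral_eq_sub_of_hasDerivAt (a := 0) (b := 2 * L)
    (fun x _ => F.hdx .q x t t0) ((F.cont _ t0).intervalIntegrable _ _)
  have h2 : U (2 * L) t = U 0 t := by simpa using F.per 0 t
  rw [h2, sub_self] at h1
  have h3 : ∀ x, ev (U x t) (dx α .q) = ev (U x t) (rhoE α) - (U x t).h := fun x => by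
    simp only [dx, ev]; ring
  simp only [h3] at h1
  rw [intervalIntegral.integral_sub (f := fun x => ev (U x t) (rhoE α)) (g := fun x => (U x t).h)
    ((F.cont _ t0).intervalIntegrable _ _) ((F.cont .h t0).intervalIntegrable _ _)] at h1
  linarith

lemma Flow.int_lam (F : Flow α L a b B h0 U) {t : ℝ} (t0 : 0 ≤ t) :
    ∫ x in (0:ℝ)..(2 * L), ev (U x t) (rhoE α) * (U x t).z 0
      = (U 0 t).l 0 * ∫ x in (0:ℝ)..(2 * L), ev (U x t) (rhoE α) := by
  have h1 := F.int_TE t t0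
  have h3 : ∀ x, ev (U x t) (TE α 0) = ev (U x t) (rhoE α) * (U x t).z 0
      - (U 0 t).l 0 * ev (U x t) (rhoE α) := fun x => by
    simp only [TE, gE, GG, ev, F.ind x]; ring
  simp only [h3] at h1
  rw [intervalIntegral.integral_sub (f := fun x => ev (U x t) (rhoE α) * (U x t).z 0)
    (g := fun x => (U 0 t).l 0 * ev (U x t) (rhoE α)) ((F.cont (.mul (rhoE α) (.z 0)) t0).intervalIntegrable _ _)
    ((F.cont (.mul (.c ((U 0 t).l 0)) (rhoE α)) t0).intervalIntegrable _ _),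
    intervalIntegral.integral_const_mul] at h1
  linarith

/-- Decreasing quantity. -/
noncomputable def DD (L : ℝ) (U : ℝ → ℝ → Env) (t : ℝ) : ℝ := (U 0 t).h - (U L t).h

lemma Flow.hDD (F : Flow α L a b B h0 U) {t : ℝ} (t0 : 0 ≤ t) :
    HasDerivWithinAt (DD L U) (-((U 0 t).z 0 - (U L t).z 0)) (Set.Ici 0) t := by
  refine ((F.hdt .h 0 t t0).sub (F.hdt .h L t t0)).congr_deriv ?_
  simp only [dt, ev, F.ind L]; ring

lemma anti_half {f f' : ℝ → ℝ} (h : ∀ t, 0 ≤ t → HasDerivWithinAt f (f' t) (Set.Ici 0) t)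
    (hn : ∀ t, 0 ≤ t → f' t ≤ 0) : AntitoneOn f (Set.Ici 0) := by
  refine antitoneOn_of_hasDerivWithinAt_nonpos (f' := f') (convex_Ici 0)
    (fun t ht => (h t ht).continuousWithinAt)
    (fun t ht => (h t (interior_subset ht)).mono interior_subset) (fun t ht => hn t (interior_subset ht))

lemma Flow.anti (F : Flow α L a b B h0 U) : AntitoneOn (DD L U) (Set.Ici 0) :=
  anti_half (fun t t0 => F.hDD t0) fun t t0 => by linarith [(F.ord L t t0).2]

lemma Flow.hdiff (F : Flow α L a b B h0 U) (x : ℝ) {t s : ℝ} (t0 : 0 ≤ t) (ts : t ≤ s) :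
    |(U x s).h - (U x t).h| ≤ DD L U t - DD L U s := by
  have h1 : AntitoneOn (fun t => (U x t).h + DD L U t) (Set.Ici 0) :=
    anti_half (fun t t0 => (F.hdt .h x t t0).add (F.hDD t0)) fun t t0 => by
      simp only [dt, ev]
      linarith [(F.ord x t t0).1, (F.ordl x t t0).2]
  have h2 : AntitoneOn (fun t => -(U x t).h + DD L U t) (Set.Ici 0) :=
    anti_half (fun t t0 => (F.hdt .h x t t0).neg.add (F.hDD t0)) fun t t0 => by
      simp only [dt, ev]
      linarith [(F.ord x t t0).2, (F.ordl x t t0).1]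
  have h3 := h1 t0 (t0.trans ts) ts
  have h4 := h2 t0 (t0.trans ts) ts
  simp only at h3 h4
  rw [abs_le]; constructor <;> linarith

lemma Flow.DDbd (F : Flow α L a b B h0 U) {t : ℝ} (t0 : 0 ≤ t) : |DD L U t| ≤ 2 * B 0 := by
  have h1 := (F.bd 0 t t0).2.2.2.2.2.1
  have h2 := (F.bd L t t0).2.2.2.2.2.1
  unfold DD
  exact (abs_sub _ _).trans (by linarith)

/-- The decreasing quantity is eventually almost constant. -/
lemma Flow.DDc (F : Flow α L a b B h0 U) {ε : ℝ} (hε : 0 < ε) :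
    ∃ T, 0 ≤ T ∧ ∀ t s, T ≤ t → t ≤ s → DD L U t - DD L U s ≤ ε := by
  set S := Set.image (DD L U) (Set.Ici 0)
  have hne : S.Nonempty := ⟨_, 0, Set.self_mem_Ici, rfl⟩
  have hbb : BddBelow S := ⟨-(2 * B 0), by
    rintro _ ⟨t, ht, rfl⟩
    exact (abs_le.1 (F.DDbd ht)).1⟩
  obtain ⟨_, ⟨T, hT, rfl⟩, h⟩ := exists_lt_of_csInf_lt hne (lt_add_of_pos_right (sInf S) hε)
  refine ⟨T, hT, fun t s ht hs => ?_⟩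
  have hT' : 0 ≤ T := hT
  have h1 := csInf_le hbb ⟨s, (by show 0 ≤ s; linarith), rfl⟩
  have h2 := F.anti hT (show 0 ≤ t by linarith) ht
  linarith

lemma Flow.osc (F : Flow α L a b B h0 U) {ε : ℝ} (hε : 0 < ε) :
    ∃ T, 0 ≤ T ∧ ∀ t, T ≤ t → (U 0 t).z 0 - (U L t).z 0 ≤ ε := by
  have hB1 : 0 ≤ B 1 := (abs_nonneg _).trans ((F.bd 0 0 le_rfl).2.2.1 1)
  set s := ε / (4 * (B 1 + 1)) with hs
  have hs0 : 0 < s := by positivity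
  obtain ⟨T, hT, h⟩ := F.DDc (ε := s * (ε / 2)) (by positivity)
  refine ⟨T, hT, fun t ht => ?_⟩
  have t0 : 0 ≤ t := hT.trans ht
  have hlip : ∀ x y, t ≤ y → |(U x y).z 0 - (U x t).z 0| ≤ B 1 * (y - t) := by
    intro x y hy
    have := (convex_Ici (0:ℝ)).norm_image_sub_le_of_norm_hasDerivWithin_le
      (f := fun t => ev (U x t) (.z 0)) (f' := fun t => ev (U x t) (dt (.z 0))) (C := B 1)
      (fun r hr => F.hdt (.z 0) x r hr) (fun r hr => (F.bd x r hr).2.2.1 1) t0 (t0.trans hy)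
    rw [norm_eq_abs, norm_eq_abs, abs_of_nonneg (by linarith : 0 ≤ y - t)] at this
    exact this
  have := landau (f := DD L U) (f' := fun t => -((U 0 t).z 0 - (U L t).z 0)) (x := t) (s := s)
    (A := s * (ε / 2)) (B := 2 * B 1 * s) hs0
    (fun y hy => (F.hDD (t0.trans hy.1)).continuousWithinAt.mono
      (fun r hr => t0.trans hr.1))
    (fun y hy => (F.hDD (t0.trans hy.1.le)).hasDerivAt (Ici_mem_nhds (by linarith [hy.1])))
    (fun y hy => by
      have h1 := hlip 0 y hy.1.le
      have h2 := hlip L y hy.1.le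
      have h3 : B 1 * (y - t) ≤ B 1 * s := mul_le_mul_of_nonneg_left (by linarith [hy.2]) hB1
      rw [abs_le] at h1 h2 ⊢
      constructor <;> linarith)
    (by
      rw [abs_sub_comm, abs_of_nonneg (by linarith [F.anti t0 (show 0 ≤ t + s by linarith) (by linarith)])]
      exact h _ _ ht (by linarith))
  rw [abs_neg] at this
  refine (le_abs_self _).trans (this.trans ?_)
  have e1 : s * (ε / 2) / s = ε / 2 := by field_simp
  have e2 : 2 * B 1 * s ≤ ε / 2 := by
    rw [hs, mul_div_assoc', div_le_iff₀ (by positivity)]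
    nlinarith
  linarith

end fl
end APF

namespace APF
section fl
variable {α L a b : ℝ} {B : ℕ → ℝ} {h0 : ℝ → ℝ} {U : ℝ → ℝ → Env}

/-- Uniform convergence of an expression to a constant. -/
def UC (U : ℝ → ℝ → Env) (y : Ex) (c : ℝ) : Prop :=
  ∀ ε : ℝ, 0 < ε → ∃ T : ℝ, 0 ≤ T ∧ ∀ t, T ≤ t → ∀ x, |ev (U x t) y - c| ≤ ε

lemma Flow.uc_dx (F : Flow α L a b B h0 U) {y : Ex} {c : ℝ} (h : UC U y c) : UC U (dx α y) 0 := by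
  intro ε hε
  obtain ⟨K, hK0, hK⟩ := ev_bdall (C := b) F.apos B (dx α (dx α y))
  set s := ε / (2 * (K + 1)) with hs
  have hs0 : 0 < s := by positivity
  obtain ⟨T, hT, h1⟩ := h (s * (ε / 4)) (by positivity)
  refine ⟨T, hT, fun t ht x => ?_⟩
  have t0 : 0 ≤ t := hT.trans ht
  have hlip : ∀ y', |ev (U y' t) (dx α y) - ev (U x t) (dx α y)| ≤ K * |y' - x| := by
    intro y'
    exact convex_univ.norm_image_sub_le_of_norm_hasDerivWithin_le
      (f := fun x => ev (U x t) (dx α y)) (f' := fun x => ev (U x t) (dx α (dx α y))) (C := K)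
      (fun r _ => (F.hdx _ r t t0).hasDerivWithinAt) (fun r _ => hK _ (F.bd r t t0)) trivial trivial
  have := landau (f := fun x => ev (U x t) y) (f' := fun x => ev (U x t) (dx α y)) (x := x) (s := s)
    (A := s * (ε / 2)) (B := K * s) hs0 (F.cont y t0).continuousOn (fun r _ => F.hdx y r t t0)
    (fun r hr => (hlip r).trans (by
      rw [abs_of_nonneg (by linarith [hr.1])]
      exact mul_le_mul_of_nonneg_left (by linarith [hr.2]) hK0))
    (by
      have e1 := abs_le.1 (h1 t ht (x + s))
      have e2 := abs_le.1 (h1 t ht x)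
      rw [abs_le]; constructor <;> linarith)
  rw [sub_zero]
  refine this.trans ?_
  have e1 : s * (ε / 2) / s = ε / 2 := by field_simp
  have e2 : K * s ≤ ε / 2 := by
    rw [hs, mul_div_assoc', div_le_iff₀ (by positivity)]
    nlinarith
  linarith

lemma Flow.rho_conv (F : Flow α L a b B h0 U) : ∃ P, 0 < P ∧ UC U (rhoE α) P := by
  have hL := F.hL
  obtain ⟨K, hK0, hK⟩ := rpow_lip (C := b) F.apos (-(1/α))
  set M : ℝ → ℝ := fun t => (∫ x in (0:ℝ)..(2 * L), ev (U x t) (rhoE α)) / (2 * L) with hM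
  have hM1 : ∀ t s, 0 ≤ t → t ≤ s → |M s - M t| ≤ DD L U t - DD L U s := by
    intro t s t0 ts
    have s0 := t0.trans ts
    have h1 : M s - M t = (∫ x in (0:ℝ)..(2 * L), ((U x s).h - (U x t).h)) / (2 * L) := by
      rw [intervalIntegral.integral_sub (f := fun x => (U x s).h) (g := fun x => (U x t).h)
        ((F.cont .h s0).intervalIntegrable _ _) ((F.cont .h t0).intervalIntegrable _ _),
        F.int_h s0, F.int_h t0, sub_div]
    have h2 := intervalIntegral.norm_integral_le_of_norm_le_const (a := 0) (b := 2 * L)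
      (f := fun x => (U x s).h - (U x t).h) (C := DD L U t - DD L U s)
      (fun x _ => F.hdiff x t0 ts)
    rw [h1, abs_div, abs_of_pos (by linarith : 0 < 2 * L), div_le_iff₀ (by linarith)]
    rw [sub_zero, abs_of_pos (by linarith : 0 < 2 * L)] at h2
    exact h2
  have hM2 : ∀ t x, 0 ≤ t → |ev (U x t) (rhoE α) - M t| ≤ K * ((U 0 t).z 0 - (U L t).z 0) := by
    intro t x t0
    have h1 : ev (U x t) (rhoE α) - M t
        = (∫ y in (0:ℝ)..(2 * L), (ev (U x t) (rhoE α) - ev (U y t) (rhoE α))) / (2 * L) := by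
      rw [intervalIntegral.integral_sub (f := fun _ => ev (U x t) (rhoE α))
        (g := fun x => ev (U x t) (rhoE α))
        (by simp) ((F.cont _ t0).intervalIntegrable _ _)]
      simp only [intervalIntegral.integral_const, hM, smul_eq_mul, sub_zero]
      field_simp
    have h2 := intervalIntegral.norm_integral_le_of_norm_le_const (a := 0) (b := 2 * L)
      (f := fun y => ev (U x t) (rhoE α) - ev (U y t) (rhoE α))
      (C := K * ((U 0 t).z 0 - (U L t).z 0))
      (fun y _ => by
        refine (hK _ _ (F.bd x t t0).1 (F.bd x t t0).2.1 (F.bd y t t0).1 (F.bd y t t0).2.1).trans ?_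
        refine mul_le_mul_of_nonneg_left ?_ hK0
        have e1 := F.ord x t t0
        have e2 := F.ord y t t0
        rw [abs_le]; constructor <;> linarith)
    rw [h1, abs_div, abs_of_pos (by linarith : 0 < 2 * L), div_le_iff₀ (by linarith)]
    rw [sub_zero, abs_of_pos (by linarith : 0 < 2 * L)] at h2
    exact h2
  have hcs : CauchySeq M := by
    rw [Metric.cauchySeq_iff']
    intro ε hε
    obtain ⟨T, hT, h⟩ := F.DDc (ε := ε / 2) (by linarith)
    refine ⟨T, fun s hs => ?_⟩
    rw [Real.dist_eq]
    exact ((hM1 T s hT hs).trans (h T s le_rfl hs)).trans_lt (by linarith)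
  obtain ⟨P, hP⟩ := cauchySeq_tendsto_of_complete hcs
  have huc : UC U (rhoE α) P := by
    intro ε hε
    obtain ⟨T1, hT1, h1⟩ := F.osc (ε := ε / (2 * (K + 1))) (by positivity)
    obtain ⟨T2, h2⟩ := (Metric.tendsto_atTop.1 hP) (ε / 2) (by linarith)
    refine ⟨max T1 T2, hT1.trans (le_max_left _ _), fun t ht x => ?_⟩
    have t0 : 0 ≤ t := hT1.trans ((le_max_left _ _).trans ht)
    have e1 := hM2 t x t0
    have e2 := h1 t ((le_max_left _ _).trans ht)
    have e3 := h2 t ((le_max_right _ _).trans ht)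
    rw [Real.dist_eq] at e3
    have e4 : K * ((U 0 t).z 0 - (U L t).z 0) ≤ ε / 2 := by
      refine (mul_le_mul_of_nonneg_left e2 hK0).trans ?_
      rw [mul_div_assoc', div_le_iff₀ (by positivity)]
      nlinarith
    calc |ev (U x t) (rhoE α) - P| = |(ev (U x t) (rhoE α) - M t) + (M t - P)| := by ring_nf
      _ ≤ _ := (abs_add_le _ _).trans (by linarith)
  refine ⟨P, ?_, huc⟩
  have hb : 0 < b := F.apos.trans_le ((F.bd 0 0 le_rfl).1.trans (F.bd 0 0 le_rfl).2.1)
  have hr : 0 < b ^ (-(1/α)) := Real.rpow_pos_of_pos hb _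
  obtain ⟨T, hT, h⟩ := huc (b ^ (-(1/α)) / 2) (by linarith)
  have h1 := (abs_le.1 (h T le_rfl 0)).2
  have h2 : b ^ (-(1/α)) ≤ ev (U 0 T) (rhoE α) :=
    Real.rpow_le_rpow_of_nonpos (F.zpos 0 hT) (F.bd 0 T hT).2.1
      (by have := F.hα; rw [neg_nonpos]; positivity)
  linarith

lemma Flow.kap (F : Flow α L a b B h0 U) (x : ℝ) {t : ℝ} (t0 : 0 ≤ t) :
    (ev (U x t) (rhoE α))⁻¹ = ev (U x t) (.pw (1/α)) := by
  simp only [rhoE, ev]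
  rw [Real.rpow_neg (F.zpos x t0).le, inv_inv]

lemma Flow.kap_conv (F : Flow α L a b B h0 U) : ∃ c, 0 < c ∧ UC U (.pw (1/α)) c := by
  obtain ⟨P, hP, h⟩ := F.rho_conv
  obtain ⟨K, hK0, hK⟩ := ev_bdall (C := b) F.apos B (.pw (1/α))
  refine ⟨P⁻¹, inv_pos.2 hP, fun ε hε => ?_⟩
  obtain ⟨T, hT, h1⟩ := h (ε * P / (K + 1)) (by positivity)
  refine ⟨T, hT, fun t ht x => ?_⟩
  have t0 := hT.trans ht
  have e1 := h1 t ht x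
  have e2 := hK _ (F.bd x t t0)
  rw [← F.kap x t0] at e2 ⊢
  have hr := F.rpos x t0
  set r := ev (U x t) (rhoE α)
  have e3 : r⁻¹ - P⁻¹ = r⁻¹ * (-(r - P)) * P⁻¹ := by field_simp; ring
  rw [e3, abs_mul, abs_mul, abs_neg, abs_of_pos (inv_pos.2 hP), ← div_eq_mul_inv, div_le_iff₀ hP]
  calc _ ≤ K * (ε * P / (K + 1)) := by gcongr
    _ ≤ ε * P := by
      rw [mul_div_assoc', div_le_iff₀ (by positivity)]
      nlinarith [mul_pos hε hP]

lemma Flow.iter (F : Flow α L a b B h0 U) (y : Ex) (k : ℕ) {t : ℝ} (t0 : 0 ≤ t) :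
    iteratedDeriv k (fun x => ev (U x t) y) = fun x => ev (U x t) ((dx α)^[k] y) := by
  induction k with
  | zero => simp
  | succ k ih =>
    rw [iteratedDeriv_succ, ih]
    funext x
    rw [(F.hdx _ x t t0).deriv, Function.iterate_succ_apply']

lemma Flow.uc_iter (F : Flow α L a b B h0 U) {y : Ex} {c : ℝ} (h : UC U y c) (k : ℕ) :
    UC U ((dx α)^[k] y) (if k = 0 then c else 0) := by
  induction k with
  | zero => simpa using h
  | succ k ih =>
    rw [Function.iterate_succ_apply', if_neg (by omega)]
    exact F.uc_dx ih

/-- From the abstract flow to the statement. -/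
lemma Flow.final (F : Flow α L a b B h0 U) {m n : ℕ} (hn : 1 ≤ n) (hmL : 2 * m * π = n * (2 * L)) :
    ∃ h : ℝ → ℝ → ℝ,
      ContDiffOn ℝ (⊤ : ℕ∞) (Function.uncurry h) (Set.univ ×ˢ Set.Ici (0:ℝ)) ∧
      (∀ θ, h θ 0 = h0 θ) ∧
      (∀ θ t, 0 ≤ t → h (θ + 2 * m * π) t = h θ t) ∧
      (∀ θ t, 0 ≤ t → 0 < h θ t + hpp h θ t) ∧
      (∀ θ t, 0 ≤ t →
        derivWithin (fun s => h θ s) (Set.Ici 0) t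
          = -(h θ t + hpp h θ t) ^ (-α) + lamAP m α h t) ∧
      ∃ c : ℝ, 0 < c ∧ ∀ k : ℕ,
        TendstoUniformly
          (fun t θ => iteratedDeriv k (fun x => (h x t + hpp h x t)⁻¹) θ)
          (fun _ => if k = 0 then c else 0) atTop := by
  have hL := F.hL
  have hα := F.hα
  set h : ℝ → ℝ → ℝ := fun x t => (U x t).h with hh
  have hr : ∀ x t, 0 ≤ t → h x t + hpp h x t = ev (U x t) (rhoE α) := by
    intro x t t0
    have : hpp h x t = ev (U x t) (rhoE α) - (U x t).h := by
      have := congrFun (F.iter .h 2 t0) x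
      simp only [Function.iterate_succ, Function.iterate_zero, Function.comp, id, dx, ev] at this
      simp only [hpp, hh]
      rw [this]; ring
    rw [this]; simp only [hh]; ring
  have hper : ∀ y t, Function.Periodic (fun x => ev (U x t) y) (2 * L) := fun y t x => by
    simp only [F.per]
  have integ : ∀ y t, 0 ≤ t → ∫ x in (0:ℝ)..(2 * m * π), ev (U x t) y
      = n * ∫ x in (0:ℝ)..(2 * L), ev (U x t) y := by
    intro y t t0
    have := (hper y t).intervalIntegral_add_zsmul_eq n 0
      (fun _ _ => (F.cont y t0).intervalIntegrable _ _)
    rw [zero_add, zero_add] at this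
    rw [hmL]
    simpa using this
  refine ⟨h, F.sm .h, F.start, ?_, ?_, ?_, ?_⟩
  · intro θ t _
    have := (hper .h t).nat_mul n θ
    rw [hmL]; exact this
  · intro θ t t0
    rw [hr θ t t0]; exact F.rpos θ t0
  · intro θ t t0
    have e0 : derivWithin (fun s => h θ s) (Set.Ici 0) t = ev (U θ t) (dt .h) :=
      (F.hdt .h θ t t0).derivWithin (uniqueDiffOn_Ici 0 t t0)
    rw [e0, hr θ t t0]
    have e1 : (ev (U θ t) (rhoE α)) ^ (-α) = (U θ t).z 0 := by
      simp only [rhoE, ev]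
      rw [← Real.rpow_mul (F.zpos θ t0).le]
      have : -(1/α) * -α = 1 := by field_simp
      rw [this, Real.rpow_one]
    have e2 : lamAP m α h t = (U 0 t).l 0 := by
      have hp : 0 < ∫ x in (0:ℝ)..(2 * L), ev (U x t) (rhoE α) :=
        intervalIntegral.intervalIntegral_pos_of_pos_on ((F.cont _ t0).intervalIntegrable _ _)
          (fun x _ => F.rpos x t0) (by linarith)
      have e3 : ∀ x, (h x t + hpp h x t) ^ (1 - α) = ev (U x t) (.mul (rhoE α) (.z 0)) := by
        intro x
        rw [hr x t t0]
        simp only [rhoE, ev]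
        rw [← Real.rpow_mul (F.zpos x t0).le]
        have : -(1/α) * (1 - α) = -(1/α) + 1 := by field_simp; ring
        rw [this, Real.rpow_add (F.zpos x t0), Real.rpow_one]
      unfold lamAP
      simp only [e3]
      have e4 := integ .h t t0
      have e5 := F.int_h t0
      have e6 := F.int_lam t0
      have e7 := integ (.mul (rhoE α) (.z 0)) t t0
      have hn' : (0:ℝ) < n := by exact_mod_cast hn
      simp only [ev] at e4 e7 ⊢
      rw [e7, e6, e4, e5]
      field_simp
    rw [e1, e2]
    simp only [dt, ev, F.ind θ]; ring
  · obtain ⟨c, hc, huc⟩ := F.kap_conv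
    refine ⟨c, hc, fun k => ?_⟩
    rw [Metric.tendstoUniformly_iff]
    intro ε hε
    obtain ⟨T, hT, h1⟩ := F.uc_iter huc k (ε / 2) (by linarith)
    filter_upwards [eventually_ge_atTop T] with t ht x
    have t0 := hT.trans ht
    have e1 : (fun x => (h x t + hpp h x t)⁻¹) = fun x => ev (U x t) (.pw (1/α)) := by
      funext x
      rw [hr x t t0, F.kap x t0]
    rw [e1, F.iter _ k t0, dist_comm, Real.dist_eq]
    exact (h1 t ht x).trans_lt (by linarith)
end fl
end APF

namespace APF

lemma mono_closed {f : ℝ → ℝ} {L : ℝ} (hL : 0 < L) (hf : Continuous f)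
    (h : MonotoneOn f (Set.Ioo 0 L)) : MonotoneOn f (Set.Icc 0 L) := by
  intro x hx y hy hxy
  have hc : ∀ x, Tendsto (fun s : ℝ => f ((1 - s) * x + s * (L / 2))) (nhdsWithin 0 (Set.Ioi 0))
      (nhds (f x)) := by
    intro x
    have : Continuous fun s : ℝ => f ((1 - s) * x + s * (L / 2)) := by fun_prop
    have h1 := this.tendsto 0
    simp only [sub_zero, one_mul, zero_mul, add_zero] at h1
    exact h1.mono_left nhdsWithin_le_nhds
  refine le_of_tendsto_of_tendsto (hc x) (hc y) ?_
  filter_upwards [Ioo_mem_nhdsGT (zero_lt_one (α := ℝ))] with s hs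
  have key : ∀ x ∈ Set.Icc 0 L, (1 - s) * x + s * (L / 2) ∈ Set.Ioo 0 L := by
    intro x hx
    have h1 := mul_nonneg (sub_nonneg.2 hs.2.le) hx.1
    have h2 := mul_nonneg (sub_nonneg.2 hs.2.le) (sub_nonneg.2 hx.2)
    have h3 := mul_pos hs.1 hL
    constructor <;> nlinarith
  refine h (key x hx) (key y hy) ?_
  have := mul_nonneg (sub_nonneg.2 hs.2.le) (sub_nonneg.2 hxy)
  linarith

lemma L_lt_pi {h0 : ℝ → ℝ} {L : ℝ} (hL : 0 < L) (sm : ContDiff ℝ (⊤ : ℕ∞) h0)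
    (evn : ∀ x, h0 (-x) = h0 x) (anti : AntitoneOn h0 (Set.Icc 0 L))
    (mono : StrictMonoOn (fun x => h0 x + iteratedDeriv 2 h0 x) (Set.Ioo 0 L)) : L < π := by
  by_contra hcon
  push Not at hcon
  have hpi := Real.pi_pos
  have d0 : ∀ x, HasDerivAt h0 (iteratedDeriv 1 h0 x) x := fun x => by
    simpa using smd sm 0 x
  have d1 : ∀ x, HasDerivAt (iteratedDeriv 1 h0) (iteratedDeriv 2 h0 x) x := smd sm 1
  have v0 : iteratedDeriv 1 h0 0 = 0 := by
    have h1 : HasDerivAt (fun x => h0 (-x)) (iteratedDeriv 1 h0 0 * (-1)) 0 := by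
      have h2 : HasDerivAt h0 (iteratedDeriv 1 h0 0) (-0) := by simpa using d0 0
      exact h2.comp (h := fun x : ℝ => -x) 0 (hasDerivAt_neg 0)
    have h3 : (fun x => h0 (-x)) = h0 := funext evn
    rw [h3] at h1
    have := h1.unique (d0 0)
    linarith
  have vpi : iteratedDeriv 1 h0 π ≤ 0 := by
    have h1 : AntitoneOn h0 (Set.Icc 0 π) := anti.mono (Set.Icc_subset_Icc_right hcon)
    have h2 := h1.derivWithin_nonpos (x := π)
    rwa [(d0 π).hasDerivWithinAt.derivWithin
      (uniqueDiffOn_Icc hpi π (Set.right_mem_Icc.2 hpi.le))] at h2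
  set Y : ℝ → ℝ := fun x => iteratedDeriv 1 h0 x * cos x + h0 x * sin x with hY
  have dY : ∀ x, HasDerivAt Y ((h0 x + iteratedDeriv 2 h0 x) * cos x) x := fun x =>
    (((d1 x).mul (hasDerivAt_cos x)).add ((d0 x).mul (hasDerivAt_sin x))).congr_deriv (by ring)
  set Z : ℝ → ℝ := fun x => Y x - Y (π - x) with hZ
  have dZ : ∀ x, HasDerivAt Z (((h0 x + iteratedDeriv 2 h0 x)
      - (h0 (π - x) + iteratedDeriv 2 h0 (π - x))) * cos x) x := fun x => by
    refine ((dY x).sub ((dY (π - x)).comp x ((hasDerivAt_id x).const_sub π))).congr_deriv ?_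
    rw [cos_pi_sub]; ring
  have hanti : StrictAntiOn Z (Set.Icc 0 (π / 2)) := by
    refine strictAntiOn_of_deriv_neg (convex_Icc _ _)
      (fun x _ => (dZ x).continuousAt.continuousWithinAt) fun x hx => ?_
    rw [interior_Icc] at hx
    rw [(dZ x).deriv]
    have h1 : 0 < cos x := cos_pos_of_mem_Ioo ⟨by linarith [hx.1], hx.2⟩
    have h2 := mono (a := x) (b := π - x) ⟨hx.1, by linarith [hx.2]⟩
      ⟨by linarith [hx.2], by linarith [hx.1]⟩ (by linarith [hx.2])
    simp only at h2
    exact mul_neg_of_neg_of_pos (by linarith) h1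
  have h1 := hanti (Set.left_mem_Icc.2 (by linarith)) (Set.right_mem_Icc.2 (by linarith))
    (by linarith : (0:ℝ) < π / 2)
  have h2 : Z (π / 2) = 0 := by simp only [hZ]; rw [sub_half, sub_self]
  have h3 : Z 0 = iteratedDeriv 1 h0 π := by
    simp only [hZ, hY, v0, sub_zero, cos_pi, sin_pi, sin_zero]; ring
  linarith

end APF

theorem ap_flow_abresch_langer_global_convergence
    (m n : ℕ) (hm : 1 ≤ m) (hn : 1 ≤ n) (hmn : Nat.Coprime m n) (hn2m : n < 2 * m)
    (α : ℝ) (hα : 0 < α) (h₀ : ℝ → ℝ)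
    (h₀smooth : ContDiff ℝ (⊤ : ℕ∞) h₀)
    (h₀per : ∀ θ, h₀ (θ + 2 * m * π / n) = h₀ θ)
    (h₀conv : ∀ θ, 0 < h₀ θ + iteratedDeriv 2 h₀ θ)
    (h₀sym0 : ∀ θ, h₀ (-θ) = h₀ θ)
    (h₀symn : ∀ θ, h₀ (m * π / n + θ) = h₀ (m * π / n - θ))
    (κ₀sym0 : ∀ θ, curv₀ h₀ (-θ) = curv₀ h₀ θ)
    (κ₀symn : ∀ θ, curv₀ h₀ (m * π / n + θ) = curv₀ h₀ (m * π / n - θ))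
    (h₀anti : StrictAntiOn h₀ (Set.Ioo 0 (m * π / n)))
    (κ₀anti : StrictAntiOn (curv₀ h₀) (Set.Ioo 0 (m * π / n)))
    (h₀pos : 0 < h₀ (m * π / n)) :
    ∃ h : ℝ → ℝ → ℝ,
      ContDiffOn ℝ (⊤ : ℕ∞) (Function.uncurry h) (Set.univ ×ˢ Set.Ici (0:ℝ)) ∧
      (∀ θ, h θ 0 = h₀ θ) ∧
      (∀ θ t, 0 ≤ t → h (θ + 2 * m * π) t = h θ t) ∧
      (∀ θ t, 0 ≤ t → 0 < h θ t + hpp h θ t) ∧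
      (∀ θ t, 0 ≤ t →
        derivWithin (fun s => h θ s) (Set.Ici 0) t
          = -(h θ t + hpp h θ t) ^ (-α) + lamAP m α h t) ∧
      ∃ c : ℝ, 0 < c ∧ ∀ k : ℕ,
        TendstoUniformly
          (fun t θ => iteratedDeriv k (fun x => (h x t + hpp h x t)⁻¹) θ)
          (fun _ => if k = 0 then c else 0) atTop := by
  have hm' : (0:ℝ) < m := by exact_mod_cast hm
  have hn' : (0:ℝ) < n := by exact_mod_cast hn
  have hL : 0 < m * π / n := by have := Real.pi_pos; positivity
  have hsm : StrictMonoOn (fun x => h₀ x + iteratedDeriv 2 h₀ x) (Set.Ioo 0 (m * π / n)) := by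
    intro x hx y hy hxy
    have := κ₀anti hx hy hxy
    unfold curv₀ at this
    exact (inv_lt_inv₀ (h₀conv y) (h₀conv x)).1 this
  have hanti : AntitoneOn h₀ (Set.Icc 0 (m * π / n)) := by
    have := APF.mono_closed (f := fun x => -h₀ x) hL h₀smooth.continuous.neg h₀anti.antitoneOn.neg
    intro x hx y hy hxy
    have := this hx hy hxy
    simp only at this
    linarith
  have I : APF.Init (m * π / n) h₀ :=
    { hL := hL
      hLpi := APF.L_lt_pi hL h₀smooth h₀sym0 hanti hsm
      sm := h₀smooth
      per := fun x => by
        rw [← h₀per x]; congr 1; ring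
      evn := h₀sym0
      pos := h₀conv
      mono := APF.mono_closed hL
        (h₀smooth.continuous.add (APF.smi h₀smooth 2).continuous) hsm.monotoneOn
      anti := hanti
      posL := h₀pos }
  obtain ⟨a, b, B, U, F⟩ := APF.exists_Flow hα I
  exact F.final hn (by field_simp)
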